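/- arXiv:1107.3776 — 8 statements merged into one kernel-verified Lean document; each statement's English description precedes it below -/
import Mathlib

section
/- Let A ≥ 1 and d ≥ 2 be integers and let b be an integer with gcd(b,d) = 1 and b/d = [a₁,…,a_k] a continued fraction expansion with all partial quotients a_j ≤ A. For n = 1,…,d set z_n = (n/d mod 1, bn/d mod 1) ∈ [0,1)². Then the discrepancy D of the points z₁,…,z_d, defined as the supremum over axis-parallel rectangles B ⊆ [0,1]² of |(1/d)·#{1 ≤ n ≤ d : z_n ∈ B} − area(B)|, satisfies D ≤ (4A/log(A+1) + (4A+1)/log d)·(log d)/d. -/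
open Filter

/-- Value of the finite continued fraction `[a₁,…,a_k] = 1/(a₁+1/(a₂+⋯+1/a_k))`. -/
def cfVal : List ℕ → ℚ
  | [] => 0
  | a :: l => 1 / ((a : ℚ) + cfVal l)

/-- `q ∈ 𝔯_𝒜`: `q` is a rational in `(0,1)` admitting a continued fraction expansion with
all partial quotients in the alphabet `𝒜`. -/
def memR (A : Set ℕ) (q : ℚ) : Prop :=
  0 < q ∧ q < 1 ∧ ∃ l : List ℕ, l ≠ [] ∧ (∀ a ∈ l, a ∈ A) ∧ cfVal l = q

/-- number of hits among `L` consecutive multiples -/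
noncomputable def zcnt (x u v : ℝ) (s L : ℕ) : ℝ :=
  ∑ j ∈ Finset.range L, (((⌊x * ((s + j : ℕ) : ℝ) - u⌋ - ⌊x * ((s + j : ℕ) : ℝ) - v⌋ : ℤ)) : ℝ)

lemma zcnt_add (x u v : ℝ) (s L M : ℕ) :
    zcnt x u v s (L + M) = zcnt x u v s L + zcnt x u v (s + L) M := by
  unfold zcnt
  rw [Finset.sum_range_add]
  simp only [add_assoc]

lemma zind (y u v : ℝ) (hu : 0 ≤ u) (huv : u ≤ v) (hv : v ≤ 1) :
    (⌊y - u⌋ - ⌊y - v⌋ : ℤ) = if Int.fract y ∈ Set.Ico u v then 1 else 0 := by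
  have key : ∀ w : ℝ, 0 ≤ w → w ≤ 1 → ⌊y - w⌋ = ⌊y⌋ + if w ≤ Int.fract y then 0 else -1 := by
    intro w hw0 hw1
    have h1 := Int.fract_lt_one y
    have h0 := Int.fract_nonneg y
    have h2 := Int.floor_add_fract y
    rw [Int.floor_eq_iff]
    split_ifs with h
    · push_cast; constructor <;> linarith
    · push_cast; push Not at h; constructor <;> linarith
  rw [key u hu (huv.trans hv), key v (hu.trans huv) hv]
  simp only [Set.mem_Ico]
  by_cases h1 : u ≤ Int.fract y <;> by_cases h2 : v ≤ Int.fract y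
  · simp [h1, h2, not_lt.mpr h2]
  · simp [h1, h2, not_le.mp h2]
  · exact absurd (huv.trans h2) h1
  · simp [h1, h2]

lemma zsum_mod (q : ℕ) (hq : 0 < q) (p : ℤ) (hp : IsCoprime p (q : ℤ)) (M : ℤ) :
    ∑ j ∈ Finset.range q, (M + j * p) % (q : ℤ) = ∑ j ∈ Finset.range q, (j : ℤ) := by
  have hq' : (q : ℤ) ≠ 0 := by positivity
  have hqp : (0 : ℤ) < q := by positivity
  have hmaps : ∀ j ∈ Finset.range q, ((M + j * p) % (q : ℤ)).toNat ∈ Finset.range q := by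
    intro j _
    have h1 := Int.emod_nonneg (M + j * p) hq'
    have h2 := Int.emod_lt_of_pos (M + j * p) hqp
    simp only [Finset.mem_range]; omega
  have hinj : Set.InjOn (fun j : ℕ => ((M + j * p) % (q : ℤ)).toNat) (Finset.range q : Finset ℕ) := by
    intro i hi j hj hij
    have h1 := Int.emod_nonneg (M + i * p) hq'
    have h2 := Int.emod_nonneg (M + j * p) hq'
    have h3 : (M + i * p) % (q : ℤ) = (M + j * p) % (q : ℤ) := by
      simp only at hij; omega
    have h4 : (q : ℤ) ∣ (i - j) * p := by
      have h5 := Int.ModEq.dvd (show (M + j * p) ≡ (M + i * p) [ZMOD q] from h3.symm)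
      have h6 : (i - j : ℤ) * p = M + i * p - (M + j * p) := by ring
      rw [h6]; exact h5
    have h5 : (q : ℤ) ∣ (i - j) := hp.symm.dvd_of_dvd_mul_right h4
    simp only [Finset.coe_range, Set.mem_Iio] at hi hj
    have h6 : (i : ℤ) - j = 0 := Int.eq_zero_of_abs_lt_dvd h5 (by rw [abs_lt]; omega)
    omega
  refine Finset.sum_nbij (fun j : ℕ => ((M + j * p) % (q : ℤ)).toNat) hmaps hinj ?_ ?_
  · exact Finset.surjOn_of_injOn_of_card_le _ hmaps hinj le_rfl
  · intro j _
    have h1 := Int.emod_nonneg (M + j * p) hq'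
    omega

lemma zhermite (q : ℕ) (hq : 0 < q) (p : ℤ) (hp : IsCoprime p (q : ℤ)) (α : ℝ) :
    ∑ j ∈ Finset.range q, ⌊α + j * ((p : ℝ) / q)⌋ =
      ⌊q * α⌋ + ∑ j ∈ Finset.range q, (j * p) / (q : ℤ) := by
  have hqp : (0 : ℤ) < q := by positivity
  have hqr : (0 : ℝ) < q := by positivity
  have h1 : ∀ j : ℕ, ⌊α + j * ((p : ℝ) / q)⌋ = (⌊q * α⌋ + j * p) / (q : ℤ) := by
    intro j
    have : α + j * ((p : ℝ) / q) = (q * α + ((j * p : ℤ) : ℝ)) / (q : ℝ) := by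
      push_cast; field_simp
    rw [this, Int.floor_div_natCast, Int.floor_add_intCast]
  simp only [h1]
  have h2 : ∀ M : ℤ, (q : ℤ) * ∑ j ∈ Finset.range q, (M + j * p) / (q : ℤ)
      = ∑ j ∈ Finset.range q, (M + j * p) - ∑ j ∈ Finset.range q, (j : ℤ) := by
    intro M
    rw [← zsum_mod q hq p hp M, Finset.mul_sum, ← Finset.sum_sub_distrib]
    refine Finset.sum_congr rfl fun j _ => ?_
    have := Int.emod_add_mul_ediv (M + j * p) q
    linarith
  have h3 := h2 ⌊q * α⌋
  have h4 := h2 0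
  rw [Finset.sum_add_distrib, Finset.sum_const, Finset.card_range] at h3
  simp only [zero_add] at h4
  apply mul_left_cancel₀ hqp.ne'
  rw [h3, mul_add, h4]; simp only [nsmul_eq_mul]; ring

lemma zfloor_sum (q : ℕ) (hq : 0 < q) (p : ℤ) (hp : IsCoprime p (q : ℤ)) (x : ℝ)
    (hx : |x - p / q| ≤ 1 / (q : ℝ) ^ 2) :
    ∃ C : ℤ, ∀ α : ℝ, ⌊q * α⌋ + C ≤ ∑ j ∈ Finset.range q, ⌊α + j * x⌋ ∧
      ∑ j ∈ Finset.range q, ⌊α + j * x⌋ ≤ ⌊q * α⌋ + C + 1 := by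
  have hqr : (0 : ℝ) < q := by positivity
  rw [abs_le] at hx
  have hsq : (q : ℝ) * (1 / (q : ℝ) ^ 2) = 1 / q := by field_simp
  have hq1 : (q : ℝ) * (1 / q) = 1 := by field_simp
  have hj : ∀ j ∈ Finset.range q, (j : ℝ) ≤ q := by
    intro j hj; exact_mod_cast (Finset.mem_range.mp hj).le
  rcases le_total 0 (x - p / q) with h | h
  · refine ⟨∑ j ∈ Finset.range q, (j * p) / (q : ℤ), fun α => ⟨?_, ?_⟩⟩
    · rw [← zhermite q hq p hp α]
      refine Finset.sum_le_sum fun j _ => Int.floor_le_floor ?_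
      have : (0 : ℝ) ≤ j * (x - p / q) := by positivity
      linarith
    · have h1 := zhermite q hq p hp (α + 1 / q)
      rw [mul_add, hq1, Int.floor_add_one] at h1
      have : ∑ j ∈ Finset.range q, ⌊α + j * x⌋ ≤ ∑ j ∈ Finset.range q, ⌊α + 1 / q + j * ((p : ℝ) / q)⌋ := by
        refine Finset.sum_le_sum fun j hjq => Int.floor_le_floor ?_
        have h2 : (j : ℝ) * (x - p / q) ≤ q * (1 / (q : ℝ) ^ 2) :=
          mul_le_mul (hj j hjq) hx.2 h (by positivity)
        linarith
      linarith
  · refine ⟨∑ j ∈ Finset.range q, (j * p) / (q : ℤ) - 1, fun α => ⟨?_, ?_⟩⟩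
    · have h1 := zhermite q hq p hp (α - 1 / q)
      rw [mul_sub, hq1, Int.floor_sub_one] at h1
      have : ∑ j ∈ Finset.range q, ⌊α - 1 / q + j * ((p : ℝ) / q)⌋ ≤ ∑ j ∈ Finset.range q, ⌊α + j * x⌋ := by
        refine Finset.sum_le_sum fun j hjq => Int.floor_le_floor ?_
        have h2 : (j : ℝ) * -(x - p / q) ≤ q * (1 / (q : ℝ) ^ 2) :=
          mul_le_mul (hj j hjq) (by linarith) (by linarith) (by positivity)
        linarith
      linarith
    · have h1 := zhermite q hq p hp α
      have : ∑ j ∈ Finset.range q, ⌊α + j * x⌋ ≤ ∑ j ∈ Finset.range q, ⌊α + j * ((p : ℝ) / q)⌋ := by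
        refine Finset.sum_le_sum fun j _ => Int.floor_le_floor ?_
        have h2 : (0 : ℝ) ≤ j * -(x - p / q) := mul_nonneg (by positivity) (by linarith)
        linarith
      linarith

lemma zblock (q : ℕ) (hq : 0 < q) (p : ℤ) (hp : IsCoprime p (q : ℤ)) (x u v : ℝ)
    (hx : |x - p / q| ≤ 1 / (q : ℝ) ^ 2) (s : ℕ) :
    |zcnt x u v s q - q * (v - u)| ≤ 2 := by
  obtain ⟨C, hC⟩ := zfloor_sum q hq p hp x hx
  have h1 : zcnt x u v s q = ((∑ j ∈ Finset.range q, ⌊(x * s - u) + j * x⌋ : ℤ) : ℝ)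
      - ((∑ j ∈ Finset.range q, ⌊(x * s - v) + j * x⌋ : ℤ) : ℝ) := by
    unfold zcnt
    push_cast
    rw [← Finset.sum_sub_distrib]
    refine Finset.sum_congr rfl fun j _ => ?_
    congr 3 <;> ring_nf
  obtain ⟨a1, a2⟩ := hC (x * s - u)
  obtain ⟨b1, b2⟩ := hC (x * s - v)
  rw [h1]
  generalize (∑ j ∈ Finset.range q, ⌊(x * s - u) + j * x⌋ : ℤ) = X at *
  generalize (∑ j ∈ Finset.range q, ⌊(x * s - v) + j * x⌋ : ℤ) = Y at *
  have f1 := Int.floor_le (q * (x * s - u))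
  have f2 := Int.lt_floor_add_one (q * (x * s - u))
  have g1 := Int.floor_le (q * (x * s - v))
  have g2 := Int.lt_floor_add_one (q * (x * s - v))
  have a1' : (⌊q * (x * s - u)⌋ : ℝ) + C ≤ X := by exact_mod_cast a1
  have a2' : (X : ℝ) ≤ ⌊q * (x * s - u)⌋ + C + 1 := by exact_mod_cast a2
  have b1' : (⌊q * (x * s - v)⌋ : ℝ) + C ≤ Y := by exact_mod_cast b1
  have b2' : (Y : ℝ) ≤ ⌊q * (x * s - v)⌋ + C + 1 := by exact_mod_cast b2
  rw [abs_le]; constructor <;> linarith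

lemma zblocks (q : ℕ) (x u v : ℝ)
    (h : ∀ s, |zcnt x u v s q - q * (v - u)| ≤ 2) (c : ℕ) :
    ∀ s, |zcnt x u v s (c * q) - (c * q : ℕ) * (v - u)| ≤ 2 * c := by
  induction c with
  | zero => intro s; simp [zcnt]
  | succ c ih =>
    intro s
    rw [add_mul, one_mul, zcnt_add]
    have h1 := ih s
    have h2 := h (s + c * q)
    rw [abs_le] at *
    push_cast at *
    constructor <;> linarith

lemma cfVal_bounds (l : List ℕ) (h : ∀ a ∈ l, 1 ≤ a) : 0 ≤ cfVal l ∧ cfVal l ≤ 1 := by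
  induction l with
  | nil => simp [cfVal]
  | cons a l ih =>
    have := ih fun b hb => h b (by simp [hb])
    have ha : (1 : ℚ) ≤ a := by exact_mod_cast h a (by simp)
    simp only [cfVal]
    refine ⟨by have := this.1; positivity, ?_⟩
    rw [div_le_one (by linarith)]; linarith

lemma zapprox (x t : ℝ) (p p' : ℤ) (q q' : ℕ) (hq : 0 < q) (hdet : |p * q' - p' * q| = 1)
    (ht0 : 0 ≤ t) (ht1 : t ≤ 1) (hx : x * (q + q' * t) = p + p' * t) :
    |x - p / q| ≤ 1 / (q : ℝ) ^ 2 := by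
  have hqr : (0 : ℝ) < q := by positivity
  have hpos : (0 : ℝ) < q + q' * t := by positivity
  have hdet' : |(p * q' - p' * q : ℝ)| = 1 := by exact_mod_cast hdet
  have : x - p / q = -(p * q' - p' * q) * (t / (q * (q + q' * t))) := by
    rw [eq_div_of_mul_eq hpos.ne' hx]; field_simp; ring
  rw [this, abs_mul, abs_neg, hdet', one_mul, abs_of_nonneg (by positivity)]
  rw [div_le_div_iff₀ (by positivity) (by positivity)]
  have : 0 ≤ (q : ℝ) * (q' * t) := by positivity
  nlinarith [mul_le_mul_of_nonneg_right ht1 (sq_nonneg (q : ℝ))]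

lemma zcop (p p' : ℤ) (q q' : ℕ) (hdet : |p * q' - p' * q| = 1) : IsCoprime p (q : ℤ) := by
  rcases (abs_eq (by norm_num)).mp hdet with h | h
  · exact ⟨q', -p', by linarith⟩
  · exact ⟨-q', p', by linarith⟩

lemma zmain (x u v : ℝ) (l : List ℕ) (hl : ∀ a ∈ l, 1 ≤ a) :
    ∀ (p p' : ℤ) (q q' S P : ℕ), 0 < q → q' ≤ q → |p * q' - p' * q| = 1 →
      x * (q + q' * ((cfVal l : ℚ) : ℝ)) = p + p' * ((cfVal l : ℚ) : ℝ) →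
      (∀ L < q, ∀ s, |zcnt x u v s L - L * (v - u)| ≤ 2 * S) →
      P ≤ q * (q + q') →
      ∃ (r : ℤ) (m : ℕ), 0 < m ∧ IsCoprime r (m : ℤ) ∧ x * m = r ∧
        (∀ L < m, ∀ s, |zcnt x u v s L - L * (v - u)| ≤ 2 * (S + l.sum : ℕ)) ∧
        (∀ s, |zcnt x u v s m - m * (v - u)| ≤ 2) ∧
        P * (l.map (· + 1)).prod ≤ 2 * m ^ 2 := by
  induction l with
  | nil =>
    intro p p' q q' S P hq hqq hdet hx hL hP
    have hx' := hx
    simp only [cfVal, Rat.cast_zero, mul_zero, add_zero] at hx'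
    refine ⟨p, q, hq, zcop p p' q q' hdet, hx', by simpa using hL, ?_, ?_⟩
    · exact zblock q hq p (zcop p p' q q' hdet) x u v
        (zapprox x _ p p' q q' hq hdet (by simp [cfVal]) (by simp [cfVal]) hx)
    · simp; nlinarith
  | cons a l ih =>
    intro p p' q q' S P hq hqq hdet hx hL hP
    have ha : 1 ≤ a := hl a (by simp)
    have hl' : ∀ a ∈ l, 1 ≤ a := fun b hb => hl b (by simp [hb])
    have hb0 := cfVal_bounds l hl'
    have hb1 := cfVal_bounds (a :: l) hl
    have hblk := zblock q hq p (zcop p p' q q' hdet) x u v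
        (zapprox x _ p p' q q' hq hdet (by exact_mod_cast hb1.1) (by exact_mod_cast hb1.2) hx)
    have hblks := zblocks q x u v hblk
    obtain ⟨r, m, hm, hc, hxm, h1, h2, h3⟩ := ih hl' (a * p + p') p (a * q + q') q (S + a) (P * (a + 1))
      (by positivity) (by nlinarith)
      (by
        rw [← hdet, ← abs_neg]; congr 1; push_cast; ring)
      (by
        have hpos : (0 : ℝ) < a + ((cfVal l : ℚ) : ℝ) := by
          have : (0 : ℝ) ≤ ((cfVal l : ℚ) : ℝ) := by exact_mod_cast hb0.1
          have : (1 : ℝ) ≤ a := by exact_mod_cast ha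
          linarith
        simp only [cfVal] at hx
        push_cast at hx ⊢
        field_simp at hx
        linarith)
      (by
        intro L hLq s
        have e := Nat.div_add_mod L q
        have hlt := Nat.mod_lt L hq
        have hca : L / q ≤ a := by
          rw [← Nat.lt_succ_iff, Nat.div_lt_iff_lt_mul hq]
          nlinarith
        have hca' : ((L / q : ℕ) : ℝ) ≤ a := by exact_mod_cast hca
        have i1 := hblks (L / q) s
        have i2 := hL (L % q) hlt (s + L / q * q)
        have e' : L = L / q * q + L % q := by rw [mul_comm]; exact e.symm
        generalize L / q = c at *
        generalize L % q = w at *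
        subst e'
        rw [zcnt_add]
        rw [abs_le] at *
        push_cast at *
        constructor <;> linarith)
      (by
        have : P * (a + 1) ≤ (q * (q + q')) * (a + 1) := Nat.mul_le_mul_right _ hP
        have e1 : q + q' ≤ a * q + q' := by nlinarith
        have e2 : (a + 1) * q ≤ a * q + q' + q := by nlinarith
        calc _ ≤ _ := this
          _ = (q + q') * ((a + 1) * q) := by ring
          _ ≤ _ := Nat.mul_le_mul e1 e2)
    refine ⟨r, m, hm, hc, hxm, ?_, h2, ?_⟩
    · simpa [List.sum_cons, add_assoc] using h1
    · simpa [List.map_cons, List.prod_cons, mul_assoc] using h3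

lemma zprod (A : ℕ) (hA : 1 ≤ A) (l : List ℕ) (hl : ∀ a ∈ l, a ≤ A) :
    (l.sum : ℝ) * Real.log (A + 1) ≤ A * Real.log ((l.map (· + 1)).prod : ℕ) := by
  have hAr : (1 : ℝ) ≤ A := by exact_mod_cast hA
  induction l with
  | nil => simp
  | cons a l ih =>
    have ih' := ih fun b hb => hl b (by simp [hb])
    have haA : (a : ℝ) ≤ A := by exact_mod_cast hl a (by simp)
    have hne : (((l.map (· + 1)).prod : ℕ) : ℝ) ≠ 0 := by
      rw [Nat.cast_ne_zero]
      simp [List.prod_eq_zero_iff]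
    have key : (a : ℝ) * Real.log (A + 1) ≤ A * Real.log (a + 1) := by
      have h := rpow_one_add_le_one_add_mul_self (s := (A : ℝ)) (p := a / A) (by linarith)
        (by positivity) (by rw [div_le_one (by linarith)]; exact haA)
      have h2 := Real.log_le_log (by positivity) h
      rw [Real.log_rpow (by positivity), div_mul_cancel₀ _ (by positivity)] at h2
      have h3 := mul_le_mul_of_nonneg_left h2 (by linarith : (0:ℝ) ≤ A)
      have h4 : (A : ℝ) * (a / A * Real.log (1 + A)) = a * Real.log (A + 1) := by
        rw [add_comm (1:ℝ)]; field_simp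
      rw [h4, add_comm (1:ℝ)] at h3
      exact h3
    simp only [List.sum_cons, List.map_cons, List.prod_cons]
    push_cast
    push_cast at ih' hne
    rw [Real.log_mul (by positivity) hne]
    linarith

lemma zset (d : ℕ) (b : ℤ) (hd : 2 ≤ d) (u₁ v₁ u₂ v₂ : ℝ) (h0 : 0 ≤ u₁) (h1 : u₁ ≤ v₁)
    (h2 : v₁ ≤ 1) (h3 : 0 ≤ u₂) (h4 : u₂ ≤ v₂) (h5 : v₂ ≤ 1) :
    (Set.ncard {n : ℕ | 1 ≤ n ∧ n ≤ d ∧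
            Int.fract ((n : ℝ) / (d : ℝ)) ∈ Set.Ico u₁ v₁ ∧
            Int.fract ((b : ℝ) * (n : ℝ) / (d : ℝ)) ∈ Set.Ico u₂ v₂} : ℝ)
      = zcnt ((b : ℝ) / d) u₂ v₂ ⌈d * u₁⌉₊ (⌈d * v₁⌉₊ - ⌈d * u₁⌉₊) := by
  classical
  have hdr : (0 : ℝ) < d := by positivity
  have hle : ⌈d * u₁⌉₊ ≤ ⌈d * v₁⌉₊ := Nat.ceil_le_ceil (by gcongr)
  have hvd : ⌈d * v₁⌉₊ ≤ d := by
    rw [Nat.ceil_le]; nlinarith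
  set s := ⌈d * u₁⌉₊ with hs
  set t := ⌈d * v₁⌉₊ with ht
  have hcell : ∀ n : ℕ, ((n : ℝ) / d ∈ Set.Ico u₁ v₁ ↔ s ≤ n ∧ n < t) := by
    intro n
    rw [Set.mem_Ico, hs, ht, Nat.ceil_le, Nat.lt_ceil, le_div_iff₀ hdr, div_lt_iff₀ hdr,
      mul_comm u₁, mul_comm v₁]
  have himg : {n : ℕ | 1 ≤ n ∧ n ≤ d ∧
            Int.fract ((n : ℝ) / (d : ℝ)) ∈ Set.Ico u₁ v₁ ∧
            Int.fract ((b : ℝ) * (n : ℝ) / (d : ℝ)) ∈ Set.Ico u₂ v₂} =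
      (fun j : ℕ => if s + j = 0 then d else s + j) ''
        (((Finset.range (t - s)).filter fun j : ℕ =>
          Int.fract ((b : ℝ) / d * ((s + j : ℕ) : ℝ)) ∈ Set.Ico u₂ v₂ : Finset ℕ) : Set ℕ) := by
    have hfr : ∀ n : ℕ, n < d → Int.fract ((n : ℝ) / d) = n / d := by
      intro n hn
      rw [Int.fract_eq_self]
      exact ⟨by positivity, by rw [div_lt_one hdr]; exact_mod_cast hn⟩
    have hdd : Int.fract ((d : ℝ) / d) = ((0 : ℕ) : ℝ) / d := by
      rw [div_self hdr.ne']; simp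
    have hbd : Int.fract ((b : ℝ) * d / d) = Int.fract ((b : ℝ) / d * ((0 : ℕ) : ℝ)) := by
      rw [mul_div_cancel_right₀ _ hdr.ne']; simp
    ext n
    simp only [Set.mem_setOf_eq, Set.mem_image, Finset.coe_filter, Finset.mem_range]
    constructor
    · rintro ⟨n1, n2, n3, n4⟩
      rcases n2.lt_or_eq with hn | rfl
      · rw [hfr n hn, hcell] at n3
        refine ⟨n - s, ⟨by omega, ?_⟩, ?_⟩
        · rw [Nat.add_sub_cancel' n3.1, div_mul_eq_mul_div]; exact n4
        · rw [Nat.add_sub_cancel' n3.1, if_neg (by omega)]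
      · rw [hdd, hcell] at n3
        rw [hbd] at n4
        have : s = 0 := by omega
        exact ⟨0, ⟨by omega, by rw [this]; exact n4⟩, by simp [this]⟩
    · rintro ⟨j, ⟨j1, j2⟩, rfl⟩
      split_ifs with h
      · rw [h] at j2
        refine ⟨by omega, le_rfl, ?_, ?_⟩
        · rw [hdd, hcell]; omega
        · rw [hbd]; exact j2
      · refine ⟨by omega, by omega, ?_, ?_⟩
        · rw [hfr _ (by omega), hcell]; omega
        · rw [div_mul_eq_mul_div] at j2; exact j2
  rw [himg, Set.ncard_image_of_injOn, Set.ncard_coe_finset]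
  · unfold zcnt
    rw [Finset.card_filter]
    push_cast
    refine Finset.sum_congr rfl fun j _ => ?_
    have := zind ((b : ℝ) / d * ((s + j : ℕ) : ℝ)) u₂ v₂ h3 h4 h5
    have h := congrArg (Int.cast : ℤ → ℝ) this
    push_cast at h
    exact h.symm
  · intro i hi j hj hij
    simp only [Finset.coe_filter, Finset.mem_range, Set.mem_setOf_eq] at hi hj
    simp only at hij
    split_ifs at hij <;> omega

/-- **Zaremba's discrepancy bound** (Zaremba 1966, Cor. 5.2): if `gcd(b,d) = 1` and `b/d` has a
continued fraction expansion with all partial quotients at most `A`, then the discrepancy of the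
points `z_n = (n/d mod 1, bn/d mod 1)`, `n = 1,…,d`, is at most
`(4A/log(A+1) + (4A+1)/log d)·(log d)/d`: every axis-parallel rectangle
`B = [u₁,v₁) × [u₂,v₂) ⊆ [0,1]²` satisfies `|#{n ≤ d : z_n ∈ B}/d − area(B)| ≤` this bound. -/
theorem zaremba_discrepancy (A d : ℕ) (b : ℤ) (hA : 1 ≤ A) (hd : 2 ≤ d)
    (hcop : IsCoprime b (d : ℤ))
    (hcf : memR {a : ℕ | 1 ≤ a ∧ a ≤ A} ((b : ℚ) / (d : ℚ))) :
    ∀ u₁ v₁ u₂ v₂ : ℝ, 0 ≤ u₁ → u₁ ≤ v₁ → v₁ ≤ 1 → 0 ≤ u₂ → u₂ ≤ v₂ → v₂ ≤ 1 →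
      |(Set.ncard {n : ℕ | 1 ≤ n ∧ n ≤ d ∧
            Int.fract ((n : ℝ) / (d : ℝ)) ∈ Set.Ico u₁ v₁ ∧
            Int.fract ((b : ℝ) * (n : ℝ) / (d : ℝ)) ∈ Set.Ico u₂ v₂} : ℝ) / (d : ℝ)
          - (v₁ - u₁) * (v₂ - u₂)|
        ≤ (4 * (A : ℝ) / Real.log ((A : ℝ) + 1) + (4 * (A : ℝ) + 1) / Real.log (d : ℝ))
            * Real.log (d : ℝ) / (d : ℝ) := by
  intro u₁ v₁ u₂ v₂ h0 h1 h2 h3 h4 h5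
  obtain ⟨hpos, hlt, l, hne, hl, hval⟩ := hcf
  have hdr : (0 : ℝ) < d := by positivity
  have hAr : (1 : ℝ) ≤ A := by exact_mod_cast hA
  have hvalR : ((cfVal l : ℚ) : ℝ) = (b : ℝ) / d := by rw [hval]; push_cast; rfl
  obtain ⟨r, m, hm, hc, hxm, e1, e2, e3⟩ := zmain ((b : ℝ) / d) u₂ v₂ l (fun a ha => (hl a ha).1)
    0 1 1 0 0 1 (by norm_num) (by norm_num) (by norm_num) (by rw [hvalR]; simp)
    (by intro L hL s; have : L = 0 := by omega
        subst this; simp [zcnt]) (by norm_num)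
  have hmd : m = d := by
    have hmul : b * m = r * d := by
      have : (b : ℝ) * m = r * d := by
        rw [← hxm]; field_simp
      exact_mod_cast this
    have d1 : (d : ℤ) ∣ m := hcop.symm.dvd_of_dvd_mul_left (Dvd.intro_left r hmul.symm)
    have d2 : (m : ℤ) ∣ d := hc.symm.dvd_of_dvd_mul_left (Dvd.intro_left b hmul)
    exact Nat.dvd_antisymm (Int.natCast_dvd_natCast.mp d2) (Int.natCast_dvd_natCast.mp d1)
  subst hmd
  have hS1 : 1 ≤ l.sum := by
    cases l with
    | nil => exact absurd rfl hne
    | cons a l => have := (hl a (by simp)).1; simp only [List.sum_cons]; omega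
  have hS1r : (1 : ℝ) ≤ l.sum := by exact_mod_cast hS1
  have hE : ∀ L ≤ m, ∀ s, |zcnt ((b : ℝ) / m) u₂ v₂ s L - L * (v₂ - u₂)| ≤ 2 * (l.sum : ℝ) := by
    intro L hL s
    rcases hL.lt_or_eq with h | rfl
    · simpa using e1 L h s
    · exact (e2 s).trans (by linarith)
  rw [zset m b hd u₁ v₁ u₂ v₂ h0 h1 h2 h3 h4 h5]
  have hle : ⌈m * u₁⌉₊ ≤ ⌈m * v₁⌉₊ := Nat.ceil_le_ceil (by gcongr)
  have hvd : ⌈m * v₁⌉₊ ≤ m := by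
    rw [Nat.ceil_le]; nlinarith
  have hN := hE (⌈m * v₁⌉₊ - ⌈m * u₁⌉₊) (by omega) ⌈m * u₁⌉₊
  have c1 := Nat.le_ceil (m * u₁)
  have c2 := Nat.ceil_lt_add_one (a := m * u₁) (by positivity)
  have c3 := Nat.le_ceil (m * v₁)
  have c4 := Nat.ceil_lt_add_one (a := m * v₁) (mul_nonneg hdr.le (h0.trans h1))
  have hw : |((⌈m * v₁⌉₊ - ⌈m * u₁⌉₊ : ℕ) : ℝ) - m * (v₁ - u₁)| ≤ 1 := by
    rw [Nat.cast_sub hle, abs_le]; constructor <;> linarith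
  generalize zcnt ((b : ℝ) / m) u₂ v₂ ⌈m * u₁⌉₊ (⌈m * v₁⌉₊ - ⌈m * u₁⌉₊) = N at *
  generalize ((⌈m * v₁⌉₊ - ⌈m * u₁⌉₊ : ℕ) : ℝ) = L at *
  have hw2 : |(L - m * (v₁ - u₁)) * (v₂ - u₂)| ≤ 1 := by
    rw [abs_mul, abs_of_nonneg (by linarith : 0 ≤ v₂ - u₂)]
    exact mul_le_one₀ hw (by linarith) (by linarith)
  have htot : |N - m * ((v₁ - u₁) * (v₂ - u₂))| ≤ 2 * (l.sum : ℝ) + 1 := by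
    have : N - m * ((v₁ - u₁) * (v₂ - u₂)) = (N - L * (v₂ - u₂)) + (L - m * (v₁ - u₁)) * (v₂ - u₂) := by
      ring
    rw [this]
    exact (abs_add_le _ _).trans (by linarith)
  have hlogA : 0 < Real.log ((A : ℝ) + 1) := Real.log_pos (by linarith)
  have hlogm : 0 < Real.log (m : ℝ) := Real.log_pos (by exact_mod_cast hd)
  have hprod := zprod A hA l (fun a ha => (hl a ha).2)
  have hppos : 0 < (l.map (· + 1)).prod := by
    apply Nat.pos_of_ne_zero
    simp [List.prod_eq_zero_iff]
  have hlogP : Real.log ((l.map (· + 1)).prod : ℕ) ≤ Real.log 2 + 2 * Real.log m := by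
    have : (((l.map (· + 1)).prod : ℕ) : ℝ) ≤ 2 * (m : ℝ) ^ 2 := by
      rw [one_mul] at e3; exact_mod_cast e3
    have h := Real.log_le_log (by exact_mod_cast hppos) this
    rw [Real.log_mul (by norm_num) (by positivity), Real.log_pow] at h
    exact_mod_cast h
  have hlog2 : Real.log 2 ≤ Real.log ((A : ℝ) + 1) := Real.log_le_log (by norm_num) (by linarith)
  have hSb : (l.sum : ℝ) ≤ 2 * A * (Real.log m / Real.log (A + 1)) + A := by
    have h : (l.sum : ℝ) * Real.log (A + 1) ≤ A * (Real.log (A + 1) + 2 * Real.log m) :=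
      hprod.trans (mul_le_mul_of_nonneg_left (by linarith) (by linarith))
    rw [← le_div_iff₀ hlogA] at h
    refine h.trans (le_of_eq ?_)
    field_simp; ring
  have eL : N / m - (v₁ - u₁) * (v₂ - u₂) = (N - m * ((v₁ - u₁) * (v₂ - u₂))) / m := by
    field_simp
  rw [eL, abs_div, abs_of_pos hdr]
  gcongr
  refine htot.trans ?_
  have eR : (4 * (A : ℝ) / Real.log ((A : ℝ) + 1) + (4 * (A : ℝ) + 1) / Real.log (m : ℝ)) * Real.log m
      = 4 * A * (Real.log m / Real.log (A + 1)) + (4 * A + 1) := by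
    field_simp
  rw [eR]
  linarith
end

section
/- For the alphabet 𝒜 = {2,4,6,8,10}, every d ∈ 𝔇_𝒜 satisfies d mod 4 ∈ {0,1,2}; equivalently, no integer congruent to 3 modulo 4 is the denominator of a reduced fraction all of whose continued fraction partial quotients lie in {2,4,6,8,10}. In particular, infinitely many integers fail to lie in 𝔇_𝒜. -/
open Filter

/-- `d ∈ 𝔇_𝒜`: `d ≥ 1` is the denominator of a reduced fraction `b/d ∈ 𝔯_𝒜`. -/
def memD (A : Set ℕ) (d : ℕ) : Prop :=
  1 ≤ d ∧ ∃ b : ℕ, Nat.Coprime b d ∧ memR A ((b : ℚ) / d)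

/-- `#𝔇_𝒜(N)`, the number of `d ∈ 𝔇_𝒜` with `d ≤ N`. -/
noncomputable def Dcount (A : Set ℕ) (N : ℕ) : ℕ :=
  Set.ncard {d : ℕ | d ≤ N ∧ memD A d}

/-- The Cantor set `𝔠_𝒜` of irrationals in `[0,1]` all of whose continued fraction partial
quotients lie in `𝒜` (equivalently, limits of the convergents `[a₁,…,a_k]` with all `a_j ∈ 𝒜`). -/
def cantorCF (A : Set ℕ) : Set ℝ :=
  {x | Irrational x ∧ 0 ≤ x ∧ x ≤ 1 ∧
    ∃ a : ℕ → ℕ, (∀ n, a n ∈ A) ∧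
      Tendsto (fun k => ((cfVal (List.ofFn fun i : Fin k => a i) : ℚ) : ℝ)) atTop (nhds x)}

/-- `δ_𝒜`, the Hausdorff dimension of `𝔠_𝒜` (as a real number). -/
noncomputable def hdim (A : Set ℕ) : ℝ := (dimH (cantorCF A)).toReal

theorem cf_inv (l : List ℕ) (hl : ∀ a ∈ l, a % 2 = 0 ∧ 1 ≤ a) :
    ∃ b d : ℕ, 1 ≤ d ∧ Nat.Coprime b d ∧ cfVal l = (b : ℚ) / d ∧
      ((b % 2 = 0 ∧ d % 4 = 1) ∨ (b % 4 = 1 ∧ d % 2 = 0)) := by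
  induction l with
  | nil => exact ⟨0, 1, by simp [cfVal]⟩
  | cons a l ih =>
    obtain ⟨b, d, hd, hc, hv, hi⟩ := ih (fun x hx => hl x (List.mem_cons_of_mem _ hx))
    obtain ⟨ha, ha1⟩ := hl a (List.mem_cons_self)
    refine ⟨d, a * d + b, by nlinarith, ?_, ?_, ?_⟩
    · rw [add_comm, Nat.coprime_add_mul_right_right]
      exact hc.symm
    · have : (d : ℚ) ≠ 0 := by positivity
      simp only [cfVal, hv]
      push_cast
      rw [add_div' _ _ _ this, one_div_div]
    · obtain ⟨k, rfl⟩ : ∃ k, a = 2 * k := ⟨a / 2, by omega⟩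
      rcases hi with ⟨h1, h2⟩ | ⟨h1, h2⟩
      · right
        refine ⟨h2, ?_⟩
        rw [mul_assoc]
        omega
      · left
        refine ⟨h2, ?_⟩
        obtain ⟨m, rfl⟩ : ∃ m, d = 2 * m := ⟨d / 2, by omega⟩
        rw [show 2 * k * (2 * m) = 4 * (k * m) by ring]
        omega

theorem local_obs (d : ℕ) (h : memD ({2, 4, 6, 8, 10} : Set ℕ) d) :
      d % 4 = 0 ∨ d % 4 = 1 ∨ d % 4 = 2 := by
  obtain ⟨hd, b, hc, -, -, l, -, hl, hv⟩ := h
  obtain ⟨b', d', hd', hc', hv', hi⟩ := cf_inv l (fun a ha => by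
    have := hl a ha
    simp only [Set.mem_insert_iff, Set.mem_singleton_iff] at this
    omega)
  have h1 : (d : ℚ) ≠ 0 := by positivity
  have h2 : (d' : ℚ) ≠ 0 := by positivity
  rw [hv', div_eq_div_iff h2 h1] at hv
  have e : b' * d = b * d' := by exact_mod_cast hv
  have hdd : d = d' := by
    apply Nat.dvd_antisymm
    · exact hc.symm.dvd_of_dvd_mul_left (e ▸ Dvd.intro_left _ rfl)
    · exact hc'.symm.dvd_of_dvd_mul_left (e ▸ Dvd.intro_left _ rfl)
  subst hdd
  omega

/-- **Local obstruction for the alphabet `{2,4,6,8,10}`** (Lemma 1.19 of Bourgain–Kontorovich):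
every denominator `d ∈ 𝔇_𝒜` satisfies `d mod 4 ∈ {0,1,2}`; in particular infinitely many
integers are not in `𝔇_𝒜`. -/
theorem zaremba_local_obstruction :
    (∀ d : ℕ, memD ({2, 4, 6, 8, 10} : Set ℕ) d →
      d % 4 = 0 ∨ d % 4 = 1 ∨ d % 4 = 2) ∧
    {d : ℕ | ¬ memD ({2, 4, 6, 8, 10} : Set ℕ) d}.Infinite := by
  refine ⟨local_obs, ?_⟩
  apply Set.infinite_of_injective_forall_mem (f := fun n : ℕ => 4 * n + 3)
  · intro m n h
    simp only at h
    omega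
  · intro n h
    have := local_obs _ h
    omega
end

section
/- (Hensley) Let 𝒜 be a finite alphabet of positive integers with at least two elements. Then there exist constants c, C > 0 such that for all sufficiently large N, c·N^{2δ_𝒜} ≤ #𝔯_𝒜(N) ≤ C·N^{2δ_𝒜}, where #𝔯_𝒜(N) counts pairs (b,d) with 1 ≤ b < d < N, gcd(b,d) = 1, and b/d ∈ 𝔯_𝒜. -/
open Filter

/-- `#𝔯_𝒜(N)`: the number of pairs `(b,d)` with `1 ≤ b < d < N`, `gcd(b,d)=1`, `b/d ∈ 𝔯_𝒜`. -/
noncomputable def Rcount (A : Set ℕ) (N : ℕ) : ℕ :=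
  Set.ncard {p : ℕ × ℕ | 1 ≤ p.1 ∧ p.1 < p.2 ∧ p.2 < N ∧ Nat.Coprime p.1 p.2 ∧
    memR A ((p.1 : ℚ) / p.2)}

namespace Hens

noncomputable def phi : List ℕ → ℝ → ℝ
  | [], x => x
  | a :: l, x => 1 / ((a : ℝ) + phi l x)

noncomputable def Dd : List ℕ → ℝ → ℝ
  | [], _ => 1
  | a :: l, x => ((a : ℝ) + phi l x) * Dd l x

def nd : List ℕ → ℕ × ℕ
  | [] => (0, 1)
  | a :: l => ((nd l).2, a * (nd l).2 + (nd l).1)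

def Pos (l : List ℕ) : Prop := ∀ a ∈ l, 0 < a

lemma Pos.tail {a : ℕ} {l : List ℕ} (h : Pos (a :: l)) : Pos l :=
  fun b hb => h b (List.mem_cons_of_mem _ hb)

lemma Pos.head {a : ℕ} {l : List ℕ} (h : Pos (a :: l)) : (1 : ℝ) ≤ a := by
  have := h a (by simp)
  exact_mod_cast this

lemma phi_append (u v : List ℕ) (x : ℝ) : phi (u ++ v) x = phi u (phi v x) := by
  induction u with
  | nil => rfl
  | cons a l ih => simp [phi, ih]

lemma Dd_append (u v : List ℕ) (x : ℝ) : Dd (u ++ v) x = Dd u (phi v x) * Dd v x := by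
  induction u with
  | nil => simp [Dd]
  | cons a l ih => simp [Dd, ih, phi_append, mul_assoc]

lemma phi_mem {l : List ℕ} (hl : Pos l) {x : ℝ} (h0 : 0 ≤ x) (h1 : x ≤ 1) :
    0 ≤ phi l x ∧ phi l x ≤ 1 := by
  induction l with
  | nil => exact ⟨h0, h1⟩
  | cons a l ih =>
    obtain ⟨i0, i1⟩ := ih hl.tail
    have := hl.head
    simp only [phi]
    constructor
    · positivity
    · rw [div_le_one (by linarith)]; linarith

lemma phi_mem' {l : List ℕ} (hl : Pos l) {x : ℝ} (h0 : 0 < x) (h1 : x < 1) :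
    0 < phi l x ∧ phi l x < 1 := by
  induction l with
  | nil => exact ⟨h0, h1⟩
  | cons a l ih =>
    obtain ⟨i0, i1⟩ := ih hl.tail
    have := hl.head
    simp only [phi]
    constructor
    · positivity
    · rw [div_lt_one (by linarith)]; linarith

lemma Dd_pos {l : List ℕ} (hl : Pos l) {x : ℝ} (h0 : 0 ≤ x) (h1 : x ≤ 1) : 0 < Dd l x := by
  induction l with
  | nil => simp [Dd]
  | cons a l ih =>
    have := (phi_mem hl.tail h0 h1).1
    have := hl.head
    have := ih hl.tail
    simp only [Dd]; positivity

lemma phi_sub {l : List ℕ} (hl : Pos l) {x y : ℝ} (hx0 : 0 ≤ x) (hx1 : x ≤ 1)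
    (hy0 : 0 ≤ y) (hy1 : y ≤ 1) : |phi l x - phi l y| = |x - y| / (Dd l x * Dd l y) := by
  induction l with
  | nil => simp [phi, Dd]
  | cons a l ih =>
    have hX := (phi_mem hl.tail hx0 hx1).1
    have hY := (phi_mem hl.tail hy0 hy1).1
    have ha := hl.head
    have dx := Dd_pos hl.tail hx0 hx1
    have dy := Dd_pos hl.tail hy0 hy1
    simp only [phi, Dd]
    have : 1 / ((a : ℝ) + phi l x) - 1 / (a + phi l y)
      = (phi l y - phi l x) / ((a + phi l x) * (a + phi l y)) := by
      field_simp; ring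
    have hp : 0 < ((a : ℝ) + phi l x) * (a + phi l y) := by positivity
    rw [this, abs_div, abs_of_pos hp, abs_sub_comm, ih hl.tail, div_div]
    congr 1; ring

/-- numerator recursion -/
lemma num_cons {a : ℕ} {l : List ℕ} (hl : Pos (a :: l)) {x : ℝ} (h0 : 0 ≤ x) (h1 : x ≤ 1) :
    phi (a :: l) x * Dd (a :: l) x = Dd l x := by
  have hX := (phi_mem hl.tail h0 h1).1
  have ha := hl.head
  simp only [phi, Dd]
  field_simp

lemma Dd_bounds {l : List ℕ} (hl : Pos l) {x : ℝ} (h0 : 0 ≤ x) (h1 : x ≤ 1) :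
    (Dd l 0 ≤ Dd l x ∧ phi l 0 * Dd l 0 ≤ phi l x * Dd l x) ∧
    (Dd l x ≤ 2 * Dd l 0 ∧ phi l x * Dd l x + Dd l x ≤ 2 * (phi l 0 * Dd l 0 + Dd l 0)) := by
  induction l with
  | nil => simp [phi, Dd]; constructor <;> linarith
  | cons a l ih =>
    obtain ⟨⟨i1, i2⟩, i3, i4⟩ := ih hl.tail
    have ha := hl.head
    rw [num_cons hl h0 h1, num_cons hl le_rfl zero_le_one]
    simp only [Dd, add_mul]
    refine ⟨⟨?_, i1⟩, ?_, ?_⟩ <;> nlinarith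

lemma nd_coprime (l : List ℕ) : Nat.Coprime (nd l).1 (nd l).2 := by
  induction l with
  | nil => simp [nd]
  | cons a l ih =>
    simp only [nd]
    rw [Nat.coprime_mul_right_add_right]
    exact ih.symm

lemma nd_den_pos {l : List ℕ} (hl : Pos l) : 0 < (nd l).2 := by
  induction l with
  | nil => simp [nd]
  | cons a l ih =>
    simp only [nd]
    have := ih hl.tail
    have := hl a (by simp)
    positivity

lemma nd_num_pos {l : List ℕ} (hl : Pos l) (h : l ≠ []) : 0 < (nd l).1 := by
  cases l with
  | nil => exact absurd rfl h
  | cons a l => exact nd_den_pos hl.tail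

lemma nd_len {l : List ℕ} (hl : Pos l) : l.length ≤ (nd l).2 := by
  induction l with
  | nil => simp [nd]
  | cons a l ih =>
    have h1 := ih hl.tail
    have h2 := hl a (by simp)
    have h3 : (nd l).2 ≤ a * (nd l).2 := Nat.le_mul_of_pos_left _ h2
    simp only [nd, List.length_cons]
    by_cases h : l = []
    · subst h; simp [nd]; omega
    · have := nd_num_pos hl.tail h
      omega

lemma cfVal_eq {l : List ℕ} (hl : Pos l) : cfVal l = (nd l).1 / (nd l).2 := by
  induction l with
  | nil => simp [nd, cfVal]
  | cons a l ih =>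
    have h1 : (0 : ℚ) < (nd l).2 := by exact_mod_cast nd_den_pos hl.tail
    simp only [nd, cfVal, ih hl.tail]
    push_cast
    field_simp

lemma cfVal_phi (l : List ℕ) : ((cfVal l : ℚ) : ℝ) = phi l 0 := by
  induction l with
  | nil => simp [cfVal, phi]
  | cons a l ih => simp [cfVal, phi, ih]

lemma Dd_nd {l : List ℕ} (hl : Pos l) : Dd l 0 = (nd l).2 ∧ phi l 0 * Dd l 0 = (nd l).1 := by
  induction l with
  | nil => simp [nd, Dd, phi]
  | cons a l ih =>
    obtain ⟨i1, i2⟩ := ih hl.tail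
    rw [num_cons hl le_rfl zero_le_one]
    simp only [nd, Dd, add_mul, i1, i2]
    push_cast
    rw [← i1, i2]; simp

lemma Pos.append {u v : List ℕ} (hu : Pos u) (hv : Pos v) : Pos (u ++ v) := by
  intro a ha
  rcases List.mem_append.1 ha with h | h
  exacts [hu a h, hv a h]

lemma den_append_le {u v : List ℕ} (hu : Pos u) (hv : Pos v) :
    (nd (u ++ v)).2 ≤ 2 * (nd u).2 * (nd v).2 := by
  have h := Dd_append u v 0
  have hb := phi_mem hv le_rfl zero_le_one
  have h2 := (Dd_bounds hu hb.1 hb.2).2.1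
  have h3 := Dd_pos hv le_rfl zero_le_one
  have : Dd (u ++ v) 0 ≤ 2 * Dd u 0 * Dd v 0 := by rw [h]; nlinarith
  rw [(Dd_nd (hu.append hv)).1, (Dd_nd hu).1, (Dd_nd hv).1] at this
  exact_mod_cast this

lemma den_append_ge {u v : List ℕ} (hu : Pos u) (hv : Pos v) :
    (nd u).2 ≤ (nd (u ++ v)).2 := by
  have h := Dd_append u v 0
  have hb := phi_mem hv le_rfl zero_le_one
  have h2 := (Dd_bounds hu hb.1 hb.2).1.1
  have h4 := Dd_pos hu le_rfl zero_le_one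
  have h3 : 1 ≤ Dd v 0 := by
    rw [(Dd_nd hv).1]; exact_mod_cast nd_den_pos hv
  have : Dd u 0 ≤ Dd (u ++ v) 0 := by rw [h]; nlinarith
  rw [(Dd_nd (hu.append hv)).1, (Dd_nd hu).1] at this
  exact_mod_cast this

lemma phi_sub_le {l : List ℕ} (hl : Pos l) {x y : ℝ} (hx0 : 0 ≤ x) (hx1 : x ≤ 1)
    (hy0 : 0 ≤ y) (hy1 : y ≤ 1) {N : ℝ} (hN : 0 < N) (h : N ≤ (nd l).2) :
    |phi l x - phi l y| ≤ (N ^ 2)⁻¹ * |x - y| := by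
  rw [phi_sub hl hx0 hx1 hy0 hy1, div_eq_inv_mul]
  rw [← (Dd_nd hl).1] at h
  have h1 := (Dd_bounds hl hx0 hx1).1.1
  have h2 := (Dd_bounds hl hy0 hy1).1.1
  gcongr
  nlinarith

lemma phi_sub_ge {l : List ℕ} (hl : Pos l) {x y : ℝ} (hx0 : 0 ≤ x) (hx1 : x ≤ 1)
    (hy0 : 0 ≤ y) (hy1 : y ≤ 1) {N : ℝ} (h : (nd l).2 ≤ N) :
    |x - y| ≤ (4 * N ^ 2) * |phi l x - phi l y| := by
  rw [phi_sub hl hx0 hx1 hy0 hy1]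
  rw [← (Dd_nd hl).1] at h
  have h1 := (Dd_bounds hl hx0 hx1).2.1
  have h2 := (Dd_bounds hl hy0 hy1).2.1
  have h3 := Dd_pos hl hx0 hx1
  have h4 := Dd_pos hl hy0 hy1
  rw [← mul_div_assoc, le_div_iff₀ (by positivity), mul_comm]
  refine mul_le_mul_of_nonneg_right ?_ (abs_nonneg _)
  calc Dd l x * Dd l y ≤ (2 * N) * (2 * N) := by
        apply mul_le_mul <;> linarith
    _ = 4 * N ^ 2 := by ring

lemma nat_add_inj {a b : ℕ} {s t : ℝ} (hs : 0 < s ∧ s < 1) (ht : 0 < t ∧ t < 1)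
    (h : (a : ℝ) + s = b + t) : a = b ∧ s = t := by
  have : a = b := by
    have h1 : (a : ℝ) < b + 1 := by linarith [hs.1, ht.2]
    have h2 : (b : ℝ) < a + 1 := by linarith [ht.1, hs.2]
    have h1' : a < b + 1 := by exact_mod_cast h1
    have h2' : b < a + 1 := by exact_mod_cast h2
    omega
  subst this
  exact ⟨rfl, by linarith⟩

lemma phi_cons_inj {a b : ℕ} {u v : List ℕ} {s t : ℝ} (hu : Pos (a :: u)) (hv : Pos (b :: v))
    (hs : 0 < s ∧ s < 1) (ht : 0 < t ∧ t < 1) (h : phi (a :: u) s = phi (b :: v) t) :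
    a = b ∧ phi u s = phi v t := by
  have h1 := phi_mem' hu.tail hs.1 hs.2
  have h2 := phi_mem' hv.tail ht.1 ht.2
  apply nat_add_inj h1 h2
  simp only [phi] at h
  have ha := hu.head
  have hb := hv.head
  rw [div_eq_div_iff (by linarith) (by linarith)] at h
  linarith

lemma phi_prefix {u v : List ℕ} {s t : ℝ} (hu : Pos u) (hv : Pos v)
    (hs : 0 < s ∧ s < 1) (ht : 0 < t ∧ t < 1) (h : phi u s = phi v t) :
    u <+: v ∨ v <+: u := by
  induction u generalizing v with
  | nil => left; simp
  | cons a u ih =>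
    cases v with
    | nil => right; simp
    | cons b v =>
      obtain ⟨rfl, h'⟩ := phi_cons_inj hu hv hs ht h
      simpa [List.cons_prefix_cons] using ih hu.tail hv.tail h'

lemma phi_inj {u v : List ℕ} {a : ℕ} (ha : 2 ≤ a) (hu : Pos u) (hv : Pos v)
    (h : phi u (1 / (a : ℝ)) = phi v (1 / (a : ℝ))) : u = v := by
  have ha' : (2 : ℝ) ≤ a := by exact_mod_cast ha
  have hx : 0 < 1 / (a : ℝ) ∧ 1 / (a : ℝ) < 1 :=
    ⟨by positivity, by rw [div_lt_one (by linarith)]; linarith⟩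
  have key : ∀ (b : ℕ) (l : List ℕ), Pos (b :: l) → 1 / (a : ℝ) ≠ phi (b :: l) (1 / (a : ℝ)) := by
    intro b l hl e
    have h1 := phi_mem' hl.tail hx.1 hx.2
    have hb := hl.head
    conv_rhs at e => rw [phi]
    rw [div_eq_div_iff (by linarith) (by linarith)] at e
    have e1 : (a : ℝ) < b + 1 := by linarith [h1.2]
    have e2 : (b : ℝ) < a := by linarith [h1.1]
    have e1' : a < b + 1 := by exact_mod_cast e1
    have e2' : b < a := by exact_mod_cast e2
    omega
  induction u generalizing v with
  | nil =>
    cases v with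
    | nil => rfl
    | cons b l => exact absurd h (key b l hv)
  | cons b u ih =>
    cases v with
    | nil => exact absurd h.symm (key b u hu)
    | cons c v =>
      obtain ⟨rfl, h'⟩ := phi_cons_inj hu hv hx hx h
      rw [ih hu.tail hv.tail h']

lemma phi_continuousOn {l : List ℕ} (hl : Pos l) : ContinuousOn (phi l) (Set.Icc 0 1) := by
  induction l with
  | nil => exact continuousOn_id
  | cons a l ih =>
    have : phi (a :: l) = fun x => 1 / ((a : ℝ) + phi l x) := by funext x; rfl
    rw [this]
    refine ContinuousOn.div continuousOn_const (continuousOn_const.add (ih hl.tail)) ?_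
    intro x hx
    have := (phi_mem hl.tail hx.1 hx.2).1
    have := hl.head
    linarith


open MeasureTheory in
/-- Upper bound for the dimension of a self-similar cover. -/
lemma dim_upper {ι : Type} [Fintype ι] (f : ι → ℝ → ℝ) (E : Set ℝ) (hE : E ⊆ Set.Icc 0 1)
    (hcov : E ⊆ ⋃ i, f i '' E) (r : ℝ) (hr0 : 0 ≤ r) (hr1 : r < 1)
    (hf : ∀ i, ∀ x ∈ E, ∀ y ∈ E, |f i x - f i y| ≤ r * |x - y|)
    (d : ℝ) (hd : 0 ≤ d) (hG : (Fintype.card ι : ℝ) * r ^ d ≤ 1) :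
    (dimH E).toReal ≤ d := by
  have key : ∀ n : ℕ, ∃ t : (Fin n → ι) → Set ℝ, (∀ v, t v ⊆ Set.univ) ∧ E ⊆ ⋃ v, t v ∧
      (∀ v, ∀ x ∈ t v, ∀ y ∈ t v, |x - y| ≤ r ^ n) := by
    intro n
    suffices ∃ t : (Fin n → ι) → Set ℝ, (∀ v, t v ⊆ E) ∧ E ⊆ ⋃ v, t v ∧
      (∀ v, ∀ x ∈ t v, ∀ y ∈ t v, |x - y| ≤ r ^ n) by
      obtain ⟨t, -, h⟩ := this
      exact ⟨t, fun _ => Set.subset_univ _, h⟩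
    induction n with
    | zero =>
      refine ⟨fun _ => E, fun _ => le_rfl, by intro x hx; simpa using hx, ?_⟩
      intro _ x hx y hy
      have h1 := hE hx
      have h2 := hE hy
      rw [pow_zero, abs_le]
      constructor <;> linarith [h1.1, h1.2, h2.1, h2.2]
    | succ n ih =>
      obtain ⟨t, h1, h2, h3⟩ := ih
      refine ⟨fun v => (f (v 0) '' t (Fin.tail v)) ∩ E, fun v => Set.inter_subset_right, ?_, ?_⟩
      · intro x hx
        obtain ⟨i, y, hy, rfl⟩ := Set.mem_iUnion.1 (hcov hx)
        obtain ⟨v, hv⟩ := Set.mem_iUnion.1 (h2 hy)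
        refine Set.mem_iUnion.2 ⟨Fin.cons i v, ⟨y, ?_, ?_⟩, hx⟩
        · simpa using hv
        · simp
      · rintro v _ ⟨⟨x, hx, rfl⟩, -⟩ _ ⟨⟨y, hy, rfl⟩, -⟩
        calc _ ≤ r * |x - y| := hf _ x (h1 _ hx) y (h1 _ hy)
          _ ≤ r * r ^ n := by gcongr; exact h3 _ x hx y hy
          _ = r ^ (n + 1) := by ring
  choose t h1 h2 h3 using key
  have hdiam : ∀ n v, Metric.ediam (t n v) ≤ ENNReal.ofReal (r ^ n) := by
    intro n v
    refine Metric.ediam_le fun x hx y hy => ?_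
    rw [edist_dist, Real.dist_eq]
    exact ENNReal.ofReal_le_ofReal (h3 n v x hx y hy)
  have hm : μH[d] E ≤ 1 := by
    refine (Measure.hausdorffMeasure_le_liminf_sum d E (l := atTop)
      (fun n => ENNReal.ofReal (r ^ n)) ?_ t (Eventually.of_forall hdiam)
      (Eventually.of_forall h2)).trans ?_
    · have := (tendsto_pow_atTop_nhds_zero_of_lt_one hr0 hr1)
      simpa using ENNReal.tendsto_ofReal this
    · refine liminf_le_of_le (by isBoundedDefault) ?_
      intro b hb
      obtain ⟨n, hn⟩ := hb.exists
      refine hn.trans ?_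
      calc ∑ v, Metric.ediam (t n v) ^ d ≤ ∑ v : Fin n → ι, ENNReal.ofReal (r ^ n) ^ d := by
            gcongr with v _; exact hdiam n v
        _ = ENNReal.ofReal (((Fintype.card ι : ℝ) * r ^ d) ^ n) := by
            rw [ENNReal.ofReal_rpow_of_nonneg (by positivity) hd]
            simp only [Finset.sum_const, Finset.card_univ, Fintype.card_fun, Fintype.card_fin,
              nsmul_eq_mul, mul_pow]
            rw [ENNReal.ofReal_mul (by positivity)]
            congr 1
            · rw [ENNReal.ofReal_pow (by positivity)]; simp
            · rw [← Real.rpow_natCast, ← Real.rpow_natCast, ← Real.rpow_mul hr0,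
                ← Real.rpow_mul hr0, mul_comm]
        _ ≤ 1 := by
            rw [← ENNReal.ofReal_one]
            exact ENNReal.ofReal_le_ofReal (pow_le_one₀ (by positivity) hG)
  have hd' : dimH E ≤ (d.toNNReal : ENNReal) := by
    apply dimH_le_of_hausdorffMeasure_ne_top
    rw [Real.coe_toNNReal d hd]
    exact ne_top_of_le_ne_top ENNReal.one_ne_top hm
  calc _ ≤ ((d.toNNReal : ENNReal)).toReal := ENNReal.toReal_mono ENNReal.coe_ne_top hd'
    _ = d := by simp [hd]

def Fc {G : ℕ} (f : Fin G → ℝ → ℝ) (ω : ℕ → Fin G) : ℕ → ℝ → ℝ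
  | 0, x => x
  | n + 1, x => Fc f ω n (f (ω n) x)

lemma Fc_congr {G : ℕ} (f : Fin G → ℝ → ℝ) {ω η : ℕ → Fin G} {n : ℕ}
    (h : ∀ i < n, ω i = η i) (x : ℝ) : Fc f ω n x = Fc f η n x := by
  induction n generalizing x with
  | zero => rfl
  | succ n ih =>
    simp only [Fc]
    rw [h n (by omega), ih (fun i hi => h i (by omega))]

lemma dim_lower {G : ℕ} (hG : 1 < G) (f : Fin G → ℝ → ℝ) (J : Set ℝ) (hJ : IsCompact J)
    (hJn : J.Nonempty) (hfJ : ∀ i, ∀ x ∈ J, f i x ∈ J) (hfc : ∀ i, ContinuousOn (f i) J)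
    (R : ℝ) (hR : 1 < R) (hexp : ∀ i, ∀ x ∈ J, ∀ y ∈ J, |x - y| ≤ R * |f i x - f i y|)
    (hdisj : ∀ i j, i ≠ j → ∀ x ∈ J, ∀ y ∈ J, f i x ≠ f j y) (T : Set ℝ)
    (hT : ∀ ω : ℕ → Fin G, ∀ x, (∀ n, ∃ y ∈ J, Fc f ω n y = x) → x ∈ T) :
    Real.log G / Real.log R ≤ (dimH T).toReal := by
  have hne0 : Nonempty (Fin G) := ⟨⟨0, by omega⟩⟩
  have hexpn : ∀ (ω : ℕ → Fin G) n, ∀ x ∈ J, ∀ y ∈ J,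
      |x - y| ≤ R ^ n * |Fc f ω n x - Fc f ω n y| := by
    intro ω n
    induction n with
    | zero => intro x _ y _; simp [Fc]
    | succ n ih =>
      intro x hx y hy
      calc _ ≤ R * |f (ω n) x - f (ω n) y| := hexp _ x hx y hy
        _ ≤ R * (R ^ n * _) := by
          gcongr
          exact ih _ (hfJ _ x hx) _ (hfJ _ y hy)
        _ = _ := by simp only [Fc]; ring
  have hcn : ∀ (ω : ℕ → Fin G) n, ContinuousOn (Fc f ω n) J := by
    intro ω n
    induction n with
    | zero => exact continuousOn_id
    | succ n ih => exact ih.comp (hfc (ω n)) (fun x hx => hfJ _ x hx)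
  have hpt : ∀ ω : ℕ → Fin G, ∃ x, ∀ n, ∃ y ∈ J, Fc f ω n y = x := by
    intro ω
    have := IsCompact.nonempty_iInter_of_sequence_nonempty_isCompact_isClosed
      (fun n => Fc f ω n '' J) (by
        rintro n _ ⟨y, hy, rfl⟩
        exact ⟨f (ω n) y, hfJ _ y hy, rfl⟩) (fun n => hJn.image _)
      (hJ.image_of_continuousOn (hcn ω 0))
      (fun n => (hJ.image_of_continuousOn (hcn ω n)).isClosed)
    obtain ⟨x, hx⟩ := this
    refine ⟨x, fun n => ?_⟩
    exact Set.mem_iInter.1 hx n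
  choose p hp using hpt
  -- separation
  have hsep : ∃ ε > 0, ∀ i j, i ≠ j → ∀ x ∈ J, ∀ y ∈ J, ε ≤ |f i x - f j y| := by
    have h1 : ∀ i j, ∃ ε > 0, i ≠ j → ∀ x ∈ J, ∀ y ∈ J, ε ≤ |f i x - f j y| := by
      intro i j
      have hc : ContinuousOn (fun z : ℝ × ℝ => |f i z.1 - f j z.2|) (J ×ˢ J) := by
        apply ContinuousOn.abs
        apply ContinuousOn.sub
        · exact (hfc i).comp continuousOn_fst (fun z hz => hz.1)
        · exact (hfc j).comp continuousOn_snd (fun z hz => hz.2)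
      obtain ⟨z, hz, hmin⟩ := (hJ.prod hJ).exists_isMinOn (hJn.prod hJn) hc
      by_cases hij : i = j
      · exact ⟨1, one_pos, fun h => absurd hij h⟩
      · refine ⟨|f i z.1 - f j z.2|, ?_, fun _ x hx y hy => ?_⟩
        · exact abs_pos.2 (sub_ne_zero.2 (hdisj i j hij _ hz.1 _ hz.2))
        · exact hmin (Set.mk_mem_prod hx hy)
    choose ε h0 h using h1
    refine ⟨Finset.univ.inf' Finset.univ_nonempty (fun z : Fin G × Fin G => ε z.1 z.2), ?_, ?_⟩
    · rw [gt_iff_lt, Finset.lt_inf'_iff]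
      intro z _; exact h0 _ _
    · intro i j hij x hx y hy
      exact (Finset.inf'_le (fun z : Fin G × Fin G => ε z.1 z.2)
        (Finset.mem_univ (i, j))).trans (h i j hij x hx y hy)
  obtain ⟨ε, hε, hsep⟩ := hsep
  set t := Real.log G / Real.log R with ht
  have hG' : (1 : ℝ) < G := by exact_mod_cast hG
  have ht0 : 0 < t := div_pos (Real.log_pos hG') (Real.log_pos hR)
  have hRt : R ^ t = G := by
    rw [Real.rpow_def_of_pos (by linarith), ht, mul_div_cancel₀ _ (Real.log_pos hR).ne',
      Real.exp_log (by linarith)]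
  have hold : ∀ ω η : ℕ → Fin G, |Real.ofDigits ω - Real.ofDigits η| ≤
      (ε⁻¹) ^ t * |p ω - p η| ^ t := by
    intro ω η
    by_cases hne : ω = η
    · subst hne; simp only [sub_self, abs_zero]; positivity
    have hex : ∃ n, ω n ≠ η n := by
      by_contra hcon; push Not at hcon; exact hne (funext hcon)
    classical
    set n := Nat.find hex with hn
    have hn1 : ω n ≠ η n := Nat.find_spec hex
    have hn2 : ∀ i < n, ω i = η i := fun i hi => by
      have := Nat.find_min hex hi; push Not at this; exact this
    have h1 := Real.abs_ofDigits_sub_ofDigits_le hn2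
    obtain ⟨x, hx, hx'⟩ := hp ω (n + 1)
    obtain ⟨y, hy, hy'⟩ := hp η (n + 1)
    have h2 : ε ≤ R ^ n * |p ω - p η| := by
      rw [← hx', ← hy']
      simp only [Fc]
      rw [← Fc_congr f hn2]
      exact (hsep _ _ hn1 x hx y hy).trans (hexpn ω n _ (hfJ _ x hx) _ (hfJ _ y hy))
    refine h1.trans ?_
    rw [← Real.mul_rpow (by positivity) (by positivity)]
    have h3 : (R ^ n)⁻¹ ≤ ε⁻¹ * |p ω - p η| := by
      rw [inv_mul_eq_div, le_div_iff₀ hε, inv_mul_eq_div, div_le_iff₀ (by positivity)]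
      linarith
    calc ((G : ℝ) ^ n)⁻¹ = ((R ^ n)⁻¹) ^ t := by
          rw [← hRt, Real.inv_rpow (by positivity), ← Real.rpow_natCast, ← Real.rpow_natCast,
            ← Real.rpow_mul (by positivity), ← Real.rpow_mul (by positivity), mul_comm]
      _ ≤ _ := Real.rpow_le_rpow (by positivity) h3 ht0.le
  set g : ℝ → ℝ := fun x => Real.ofDigits (Function.invFun p x) with hg
  have hgp : ∀ ω, g (p ω) = Real.ofDigits ω := by
    intro ω
    have e : p (Function.invFun p (p ω)) = p ω := Function.invFun_eq ⟨ω, rfl⟩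
    have := hold (Function.invFun p (p ω)) ω
    rw [e, sub_self, abs_zero, Real.zero_rpow ht0.ne', mul_zero] at this
    exact sub_eq_zero.1 (abs_eq_zero.1 (le_antisymm this (abs_nonneg _)))
  have hH : HolderOnWith ((ε⁻¹ ^ t).toNNReal) t.toNNReal g (Set.range p) := by
    rintro _ ⟨ω, rfl⟩ _ ⟨η, rfl⟩
    rw [hgp, hgp, edist_dist, edist_dist, Real.dist_eq, Real.dist_eq,
      Real.coe_toNNReal _ ht0.le, ENNReal.ofReal_rpow_of_nonneg (abs_nonneg _) ht0.le]
    change _ ≤ ENNReal.ofReal _ * _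
    rw [← ENNReal.ofReal_mul (by positivity)]
    exact ENNReal.ofReal_le_ofReal (hold ω η)
  have him := hH.dimH_image_le (by simpa using ht0)
  have hsub : Set.Icc (0 : ℝ) 1 ⊆ g '' Set.range p := by
    intro y hy
    obtain ⟨ω, -, hω⟩ := Real.ofDigits_SurjOn hG hy
    exact ⟨p ω, ⟨ω, rfl⟩, by rw [hgp, hω]⟩
  have h1 : (1 : ENNReal) ≤ dimH (g '' Set.range p) := by
    have : dimH (Set.Icc (0 : ℝ) 1) = 1 := by
      have := Real.dimH_of_nonempty_interior (E := ℝ) (s := Set.Icc (0 : ℝ) 1)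
        (by simp [interior_Icc])
      simpa using this
    rw [← this]; exact dimH_mono hsub
  have h2 : dimH (Set.range p) ≤ dimH T := dimH_mono (by
    rintro _ ⟨ω, rfl⟩; exact hT ω _ (hp ω))
  have h3 : (t.toNNReal : ENNReal) ≤ dimH T := by
    have h4 := h1.trans him
    rw [ENNReal.le_div_iff_mul_le (Or.inl (by simpa using ht0)) (Or.inl ENNReal.coe_ne_top)] at h4
    rw [one_mul] at h4
    exact h4.trans h2
  have hfin : dimH T ≠ ⊤ := by
    have : dimH T ≤ dimH (Set.univ : Set ℝ) := dimH_mono (Set.subset_univ _)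
    rw [Real.dimH_univ] at this
    exact ne_top_of_le_ne_top ENNReal.one_ne_top this
  have := ENNReal.toReal_mono hfin h3
  simpa [ht0.le] using this


def U (A : Finset ℕ) (N : ℕ) : Set (List ℕ) := {l | (∀ a ∈ l, a ∈ A) ∧ (nd l).2 < N}

def W (A : Finset ℕ) (N : ℕ) : Set (List ℕ) :=
  {l | ∃ u b, l = u ++ [b] ∧ u ∈ U A N ∧ b ∈ A ∧ N ≤ (nd l).2}

section
variable {A : Finset ℕ}

lemma pos_of (hA : ∀ a ∈ A, 0 < a) {l : List ℕ} (h : ∀ a ∈ l, a ∈ A) : Pos l :=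
  fun a ha => hA a (h a ha)

lemma W_mem {N : ℕ} {w : List ℕ} (h : w ∈ W A N) : ∀ a ∈ w, a ∈ A := by
  obtain ⟨u, b, rfl, hu, hb, -⟩ := h
  intro a ha
  rcases List.mem_append.1 ha with h | h
  · exact hu.1 a h
  · simp at h; subst h; exact hb

lemma U_finite (hA : ∀ a ∈ A, 0 < a) (N : ℕ) : (U A N).Finite := by
  have key : ∀ n, {l : List ℕ | (∀ a ∈ l, a ∈ A) ∧ l.length ≤ n}.Finite := by
    intro n
    induction n with
    | zero =>
      refine (Set.finite_singleton []).subset ?_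
      rintro l ⟨-, h⟩
      simpa using h
    | succ n ih =>
      refine ((Set.finite_singleton []).union
        (Set.Finite.image2 (fun a l => a :: l) A.finite_toSet ih)).subset ?_
      rintro l ⟨h1, h2⟩
      cases l with
      | nil => left; rfl
      | cons a l =>
        right
        refine ⟨a, h1 a (by simp), l, ⟨fun b hb => h1 b (by simp [hb]), ?_⟩, rfl⟩
        simpa using h2
  refine (key N).subset ?_
  rintro l ⟨h1, h2⟩
  exact ⟨h1, (nd_len (pos_of hA h1)).trans h2.le⟩

lemma W_sub (N : ℕ) : W A N ⊆ (fun p : List ℕ × ℕ => p.1 ++ [p.2]) '' (U A N ×ˢ (A : Set ℕ)) := by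
  rintro _ ⟨u, b, rfl, hu, hb, -⟩
  exact ⟨(u, b), ⟨hu, hb⟩, rfl⟩

lemma W_finite (hA : ∀ a ∈ A, 0 < a) (N : ℕ) : (W A N).Finite :=
  (((U_finite hA N).prod A.finite_toSet).image _).subset (W_sub N)

lemma W_le (hA : ∀ a ∈ A, 0 < a) (N : ℕ) : (W A N).ncard ≤ (U A N).ncard * A.card := by
  have hf := (U_finite hA N).prod A.finite_toSet
  calc _ ≤ _ := Set.ncard_le_ncard (W_sub N) (hf.image _)
    _ ≤ _ := Set.ncard_image_le hf
    _ = _ := by rw [Set.ncard_prod, Set.ncard_coe_finset]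

lemma strip {a b : ℕ} (hab : a ≠ b) {u v : List ℕ} (m k : ℕ)
    (h : u ++ [a] ++ List.replicate m b = v ++ [a] ++ List.replicate k b) : u = v := by
  induction m generalizing k with
  | zero =>
    cases k with
    | zero => simpa using h
    | succ k =>
      rw [List.replicate_succ', ← List.append_assoc] at h
      rw [List.replicate_zero, List.append_nil] at h
      have := (List.append_inj' h (by simp)).2
      simp at this
      exact absurd this hab
  | succ m ih =>
    cases k with
    | zero =>
      rw [List.replicate_succ', ← List.append_assoc] at h
      rw [List.replicate_zero, List.append_nil] at h
      have := (List.append_inj' h (by simp)).2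
      simp at this
      exact absurd this.symm hab
    | succ k =>
      rw [List.replicate_succ', List.replicate_succ', ← List.append_assoc, ← List.append_assoc] at h
      exact ih k (List.append_inj' h (by simp)).1

lemma U_le_W (hA : ∀ a ∈ A, 0 < a) (hcard : 2 ≤ A.card) (N : ℕ) :
    (U A N).ncard ≤ (W A N).ncard := by
  obtain ⟨a, ha, b, hb, hab⟩ := Finset.one_lt_card.1 (show 1 < A.card by omega)
  have key : ∀ u ∈ U A N, ∃ m, u ++ [a] ++ List.replicate m b ∈ W A N := by
    intro u hu
    have hmem : ∀ m, ∀ c ∈ u ++ [a] ++ List.replicate m b, c ∈ A := by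
      intro m c hc
      simp only [List.mem_append, List.mem_singleton, List.mem_replicate] at hc
      rcases hc with (h | h) | h
      · exact hu.1 c h
      · exact h ▸ ha
      · exact h.2 ▸ hb
    have hex : ∃ m, N ≤ (nd (u ++ [a] ++ List.replicate m b)).2 := by
      refine ⟨N, le_trans ?_ (nd_len (pos_of hA (hmem N)))⟩
      simp; omega
    classical
    refine ⟨Nat.find hex, ?_⟩
    have h1 := Nat.find_spec hex
    have h2 : ∀ k < Nat.find hex, _ := fun k hk => Nat.find_min hex hk
    generalize Nat.find hex = m at h1 h2
    cases m with
    | zero =>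
      refine ⟨u, a, by simp, hu, ha, by simpa using h1⟩
    | succ k =>
      refine ⟨u ++ [a] ++ List.replicate k b, b, ?_, ⟨hmem k, ?_⟩, hb, h1⟩
      · rw [List.replicate_succ', ← List.append_assoc]
      · have := h2 k (by omega)
        omega
  choose! m hm using key
  refine Set.ncard_le_ncard_of_injOn (fun u => u ++ [a] ++ List.replicate (m u) b) hm ?_
    (W_finite hA N)
  intro u _ v _ h
  exact strip hab _ _ h

lemma E_self (hA : ∀ a ∈ A, 0 < a) {x : ℝ} (hx : x ∈ cantorCF (A : Set ℕ)) :
    ∃ a ∈ A, ∃ y ∈ cantorCF (A : Set ℕ), phi [a] y = x := by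
  obtain ⟨hirr, h0, h1, a, haA, hlim⟩ := hx
  have hx0 : x ≠ 0 := hirr.ne_zero
  have ha1 : (1 : ℝ) ≤ a 0 := by exact_mod_cast hA _ (haA 0)
  set y := 1 / x - a 0 with hy
  have hxy : x = 1 / (a 0 + y) := by rw [hy]; simp
  have hpos : ∀ k, Pos (List.ofFn fun i : Fin k => a (i + 1)) := by
    intro k c hc
    obtain ⟨i, rfl⟩ := List.mem_ofFn.1 hc
    exact hA _ (haA _)
  have hlim' : Tendsto (fun k => ((cfVal (List.ofFn fun i : Fin k => a (i + 1)) : ℚ) : ℝ))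
      atTop (nhds y) := by
    have h2 := ((hlim.comp (tendsto_add_atTop_nat 1)).inv₀ hx0).sub_const (a 0 : ℝ)
    have h3 : x⁻¹ - a 0 = y := by rw [hy]; simp
    rw [h3] at h2
    refine h2.congr fun k => ?_
    simp only [Function.comp, List.ofFn_succ, cfVal]
    simp
  have hb : ∀ k, ((cfVal (List.ofFn fun i : Fin k => a (i + 1)) : ℚ) : ℝ) ∈ Set.Icc (0 : ℝ) 1 := by
    intro k
    rw [cfVal_phi]
    exact phi_mem (hpos k) le_rfl zero_le_one
  have hyI : y ∈ Set.Icc (0 : ℝ) 1 :=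
    isClosed_Icc.mem_of_tendsto hlim' (Eventually.of_forall hb)
  refine ⟨a 0, haA 0, y, ⟨?_, hyI.1, hyI.2, fun n => a (n + 1), fun n => haA _, hlim'⟩, ?_⟩
  · rw [hy]
    have := (hirr.inv).sub_natCast (a 0)
    simpa using this
  · simp [phi, hxy]

lemma W_cover (hA : ∀ a ∈ A, 0 < a) (N : ℕ) (k : ℕ) : ∀ u ∈ U A N, N ≤ u.length + k →
    ∀ y ∈ cantorCF (A : Set ℕ), ∃ w ∈ W A N, ∃ z ∈ cantorCF (A : Set ℕ), phi w z = phi u y := by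
  induction k with
  | zero =>
    intro u hu hk
    have := nd_len (pos_of hA hu.1)
    have := hu.2
    omega
  | succ k ih =>
    intro u hu hk y hy
    obtain ⟨a, ha, z, hz, rfl⟩ := E_self hA hy
    by_cases h : N ≤ (nd (u ++ [a])).2
    · exact ⟨u ++ [a], ⟨u, a, rfl, hu, ha, h⟩, z, hz, by rw [phi_append]⟩
    · rw [← phi_append]
      refine ih (u ++ [a]) ⟨?_, by omega⟩ (by simp; omega) z hz
      intro c hc
      rcases List.mem_append.1 hc with h | h
      · exact hu.1 c h
      · simp at h; subst h; exact ha

lemma nil_mem_U {N : ℕ} (hN : 2 ≤ N) : [] ∈ U A N := by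
  refine ⟨by simp, ?_⟩
  simp [nd]; omega

lemma W_pos (hA : ∀ a ∈ A, 0 < a) (hcard : 2 ≤ A.card) {N : ℕ} (hN : 2 ≤ N) :
    0 < (W A N).ncard := by
  refine lt_of_lt_of_le ?_ (U_le_W hA hcard N)
  rw [Set.ncard_pos (U_finite hA N)]
  exact ⟨[], nil_mem_U hN⟩

/-- `N^{2δ} ≤ #W_N`. -/
lemma W_ge (hA : ∀ a ∈ A, 0 < a) (hcard : 2 ≤ A.card) {N : ℕ} (hN : 2 ≤ N) :
    (N : ℝ) ^ (2 * hdim (A : Set ℕ)) ≤ (W A N).ncard := by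
  have hG := W_pos hA hcard hN
  have hN' : (2 : ℝ) ≤ N := by exact_mod_cast hN
  have hlN : 0 < Real.log N := Real.log_pos (by linarith)
  set G := (W A N).ncard with hGd
  have hG1 : (1 : ℝ) ≤ G := by exact_mod_cast hG
  have := (W_finite hA N).fintype
  have hc : Fintype.card (W A N) = G := by
    rw [hGd, Set.ncard_eq_toFinset_card', Set.toFinset_card]
  have hsub : cantorCF (A : Set ℕ) ⊆ Set.Icc 0 1 := fun x hx => ⟨hx.2.1, hx.2.2.1⟩
  have h := dim_upper (fun i : W A N => phi i.1) (cantorCF (A : Set ℕ)) hsub ?_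
    (((N : ℝ) ^ 2)⁻¹) (by positivity) (inv_lt_one_of_one_lt₀ (by nlinarith)) ?_
    (Real.log G / (2 * Real.log N)) (div_nonneg (Real.log_nonneg hG1) (by positivity)) ?_
  · rw [le_div_iff₀ (by positivity)] at h
    rw [Real.rpow_def_of_pos (by linarith), ← Real.le_log_iff_exp_le (by linarith)]
    unfold hdim
    linarith
  · intro x hx
    obtain ⟨w, hw, z, hz, e⟩ := W_cover hA N N [] (nil_mem_U hN) (by simp) x hx
    exact Set.mem_iUnion.2 ⟨⟨w, hw⟩, z, hz, e⟩
  · rintro ⟨w, hw⟩ x hx y hy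
    have hwp := pos_of hA (W_mem hw)
    obtain ⟨u, b, e, hu, hb, hle⟩ := hw
    exact phi_sub_le hwp (hsub hx).1 (hsub hx).2 (hsub hy).1 (hsub hy).2 (by linarith)
      (by exact_mod_cast hle)
  · rw [hc, Real.inv_rpow (by positivity), ← Real.rpow_natCast, ← Real.rpow_mul (by positivity),
      Real.rpow_def_of_pos (by linarith)]
    have : Real.log N * (((2 : ℕ) : ℝ) * (Real.log G / (2 * Real.log N))) = Real.log G := by
      push_cast; field_simp
    rw [this, Real.exp_log (by linarith), mul_inv_cancel₀ (by linarith)]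

def Lw {G : ℕ} (w : Fin G → List ℕ) (ω : ℕ → Fin G) : ℕ → List ℕ
  | 0 => []
  | n + 1 => Lw w ω n ++ w (ω n)

lemma Fc_Lw {G : ℕ} (w : Fin G → List ℕ) (ω : ℕ → Fin G) (n : ℕ) (x : ℝ) :
    Fc (fun i => phi (w i)) ω n x = phi (Lw w ω n) x := by
  induction n generalizing x with
  | zero => rfl
  | succ n ih => simp only [Fc, Lw, phi_append, ih]

lemma Lw_prefix {G : ℕ} (w : Fin G → List ℕ) (ω : ℕ → Fin G) {m n : ℕ} (h : m ≤ n) :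
    Lw w ω m <+: Lw w ω n := by
  induction n, h using Nat.le_induction with
  | base => exact List.prefix_rfl
  | succ n _ ih => exact ih.trans (List.prefix_append _ _)

lemma Lw_len {G : ℕ} (w : Fin G → List ℕ) (hw : ∀ i, w i ≠ []) (ω : ℕ → Fin G) (n : ℕ) :
    n ≤ (Lw w ω n).length := by
  induction n with
  | zero => simp
  | succ n ih =>
    have := List.length_pos_iff.2 (hw (ω n))
    simp only [Lw, List.length_append]
    omega

lemma Lw_mem {G : ℕ} (w : Fin G → List ℕ) (hw : ∀ i, ∀ a ∈ w i, a ∈ A) (ω : ℕ → Fin G) (n : ℕ) :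
    ∀ a ∈ Lw w ω n, a ∈ A := by
  induction n with
  | zero => simp [Lw]
  | succ n ih =>
    intro a ha
    simp only [Lw, List.mem_append] at ha
    rcases ha with h | h
    exacts [ih a h, hw _ a h]

lemma limit_mem (hA : ∀ a ∈ A, 0 < a) {G : ℕ} (w : Fin G → List ℕ) (hw0 : ∀ i, w i ≠ [])
    (hw : ∀ i, ∀ a ∈ w i, a ∈ A) (ω : ℕ → Fin G) (x : ℝ)
    (h : ∀ n, ∃ y ∈ Set.Icc (0 : ℝ) 1, phi (Lw w ω n) y = x) (hx : Irrational x) :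
    x ∈ cantorCF (A : Set ℕ) := by
  have hxI : x ∈ Set.Icc (0 : ℝ) 1 := by
    obtain ⟨y, hy, e⟩ := h 0
    simp only [Lw, phi] at e
    exact e ▸ hy
  set a : ℕ → ℕ := fun n => (Lw w ω (n + 1)).getD n 0 with ha
  have hlen := Lw_len w hw0 ω
  have haget : ∀ n, a n = (Lw w ω (n + 1))[n]'(hlen (n + 1)) := by
    intro n
    simp only [ha]
    exact List.getD_eq_getElem _ _ _
  have haA : ∀ n, a n ∈ A := by
    intro n
    rw [haget]
    exact Lw_mem w hw ω (n + 1) _ (List.getElem_mem _)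
  have hof : ∀ k, (List.ofFn fun i : Fin k => a i) = (Lw w ω k).take k := by
    intro k
    apply List.ext_getElem
    · simp [hlen k]
    · intro i h1 h2
      have hik : i < k := by simpa using h1
      simp only [List.getElem_ofFn, List.getElem_take]
      rw [haget]
      exact (Lw_prefix w ω (show i + 1 ≤ k by omega)).getElem _
  refine ⟨hx, hxI.1, hxI.2, a, haA, ?_⟩
  rw [tendsto_iff_dist_tendsto_zero]
  have hbound : ∀ᶠ k : ℕ in atTop,
      dist ((cfVal (List.ofFn fun i : Fin k => a i) : ℚ) : ℝ) x ≤ 1 / (k : ℝ) := by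
    filter_upwards [eventually_ge_atTop 1] with k hk
    rw [cfVal_phi, hof, Real.dist_eq]
    obtain ⟨y, hy, e⟩ := h k
    rw [← List.take_append_drop k (Lw w ω k), phi_append] at e
    have hm := Lw_mem w hw ω k
    have hd : Pos ((Lw w ω k).drop k) := pos_of hA fun c hc => hm c (List.mem_of_mem_drop hc)
    have ht : Pos ((Lw w ω k).take k) := pos_of hA fun c hc => hm c (List.mem_of_mem_take hc)
    have hz := phi_mem hd hy.1 hy.2
    have hk' : (1 : ℝ) ≤ k := by exact_mod_cast hk
    have hden : (k : ℝ) ≤ (nd ((Lw w ω k).take k)).2 := by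
      have := nd_len ht
      rw [List.length_take, min_eq_left (hlen k)] at this
      exact_mod_cast this
    have := phi_sub_le ht le_rfl zero_le_one hz.1 hz.2 (by linarith) hden
    rw [e] at this
    refine this.trans ?_
    rw [zero_sub, abs_neg, abs_of_nonneg hz.1]
    calc ((k : ℝ) ^ 2)⁻¹ * _ ≤ ((k : ℝ) ^ 2)⁻¹ * 1 := by gcongr; exact hz.2
      _ ≤ 1 / k := by
        rw [mul_one, one_div]
        apply inv_anti₀ (by linarith); nlinarith
  exact squeeze_zero' (Eventually.of_forall fun _ => dist_nonneg) hbound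
    tendsto_one_div_atTop_nhds_zero_nat

/-- `#W_N ≤ (16 M² N²)^δ`. -/
lemma W_le_pow (hA : ∀ a ∈ A, 0 < a) {M : ℕ} (hM1 : 1 ≤ M) (hM : ∀ a ∈ A, a ≤ M)
    {N : ℕ} (hN : 2 ≤ N) :
    ((W A N).ncard : ℝ) ≤ (16 * (M : ℝ) ^ 2 * (N : ℝ) ^ 2) ^ (hdim (A : Set ℕ)) := by
  have hN' : (2 : ℝ) ≤ N := by exact_mod_cast hN
  have hM' : (1 : ℝ) ≤ M := by exact_mod_cast hM1
  have hR : 1 < 16 * (M : ℝ) ^ 2 * (N : ℝ) ^ 2 := by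
    have h1 : (1 : ℝ) ≤ (M : ℝ) ^ 2 := one_le_pow₀ hM'
    have h2 : (1 : ℝ) ≤ (N : ℝ) ^ 2 := one_le_pow₀ (by linarith)
    nlinarith
  set R := 16 * (M : ℝ) ^ 2 * (N : ℝ) ^ 2 with hRd
  have hδ : 0 ≤ hdim (A : Set ℕ) := ENNReal.toReal_nonneg
  rcases Nat.lt_or_ge 1 (W A N).ncard with hG | hG
  swap
  · calc ((W A N).ncard : ℝ) ≤ 1 := by exact_mod_cast hG
      _ ≤ _ := Real.one_le_rpow hR.le hδ
  have := (W_finite hA N).fintype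
  have hc : Fintype.card (W A N) = (W A N).ncard := by
    rw [Set.ncard_eq_toFinset_card', Set.toFinset_card]
  let e := (Fintype.equivFinOfCardEq hc).symm
  set G := (W A N).ncard with hGd
  let w : Fin G → List ℕ := fun i => (e i).1
  have hwW : ∀ i, w i ∈ W A N := fun i => (e i).2
  have hwA : ∀ i, ∀ a ∈ w i, a ∈ A := fun i => W_mem (hwW i)
  have hwP : ∀ i, Pos (w i) := fun i => pos_of hA (hwA i)
  have hw0 : ∀ i, w i ≠ [] := by
    intro i
    obtain ⟨u, b, h, -⟩ := hwW i
    rw [h]; simp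
  have hJ1 : ∀ x ∈ Set.Icc (1 / ((M : ℝ) + 1)) ((M + 1) / (M + 2)), 0 < x ∧ x < 1 := by
    intro x hx
    constructor
    · exact lt_of_lt_of_le (by positivity) hx.1
    · refine lt_of_le_of_lt hx.2 ?_
      rw [div_lt_one (by positivity)]; linarith
  have hJphi : ∀ l : List ℕ, (∀ a ∈ l, a ∈ A) →
      ∀ x ∈ Set.Icc (1 / ((M : ℝ) + 1)) ((M + 1) / (M + 2)),
      phi l x ∈ Set.Icc (1 / ((M : ℝ) + 1)) ((M + 1) / (M + 2)) := by
    intro l hl x hx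
    induction l with
    | nil => exact hx
    | cons a l ih =>
      have h1 := ih fun c hc => hl c (by simp [hc])
      have h2 := hJ1 _ h1
      have ha : (a : ℝ) ≤ M := by exact_mod_cast hM a (hl a (by simp))
      have ha1 : (1 : ℝ) ≤ a := by exact_mod_cast hA a (hl a (by simp))
      simp only [phi]
      constructor
      · apply one_div_le_one_div_of_le <;> linarith
      · rw [div_le_div_iff₀ (by linarith) (by linarith)]
        have h3 := h1.1
        rw [div_le_iff₀ (by linarith)] at h3
        nlinarith
  have h := dim_lower hG (fun i => phi (w i)) (Set.Icc (1 / ((M : ℝ) + 1)) ((M + 1) / (M + 2)))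
    isCompact_Icc ?_ (fun i => hJphi _ (hwA i)) ?_ R hR ?_ ?_
    (cantorCF (A : Set ℕ) ∪ Set.range ((↑) : ℚ → ℝ)) ?_
  · rw [dimH_union, dimH_countable (Set.countable_range _), max_eq_left (zero_le)] at h
    rw [div_le_iff₀ (Real.log_pos hR)] at h
    rw [Real.rpow_def_of_pos (by linarith), ← Real.log_le_iff_le_exp (by
      have : 0 < G := by omega
      exact_mod_cast this)]
    unfold hdim
    linarith
  · rw [Set.nonempty_Icc, div_le_div_iff₀ (by linarith) (by linarith)]
    nlinarith
  · intro i
    refine (phi_continuousOn (hwP i)).mono ?_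
    intro x hx
    exact ⟨(hJ1 x hx).1.le, (hJ1 x hx).2.le⟩
  · intro i x hx y hy
    obtain ⟨u, b, e, hu, hb, hle⟩ := hwW i
    have hden : ((nd (w i)).2 : ℝ) ≤ 2 * M * N := by
      have h1 := den_append_le (pos_of hA hu.1) (v := [b]) (pos_of hA (by simpa using hb))
      rw [← e] at h1
      have h2 : (nd [b]).2 = b := by simp [nd]
      rw [h2] at h1
      have h3 := hM b hb
      have h4 := hu.2
      have : (nd (w i)).2 ≤ 2 * N * M := h1.trans (by gcongr)
      have : ((nd (w i)).2 : ℝ) ≤ 2 * N * M := by exact_mod_cast this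
      linarith
    have := phi_sub_ge (hwP i) (hJ1 x hx).1.le (hJ1 x hx).2.le (hJ1 y hy).1.le (hJ1 y hy).2.le hden
    refine this.trans (le_of_eq ?_)
    rw [hRd]; ring
  · intro i j hij x hx y hy heq
    have hne : w i ≠ w j := fun h => hij (e.injective (Subtype.ext h))
    have hcode : ∀ u v : List ℕ, u ∈ W A N → v ∈ W A N → u <+: v → u = v := by
      rintro u v hu hv ⟨t, ht⟩
      rcases List.eq_nil_or_concat t with rfl | ⟨s, c, rfl⟩
      · simpa using ht
      · exfalso
        have hvA := W_mem hv
        obtain ⟨u', b, rfl, hu', hb, -⟩ := hv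
        have e1 : u ++ s = u' := by
          rw [List.concat_eq_append, ← List.append_assoc] at ht
          exact (List.append_inj' ht (by simp)).1
        have hsA : Pos s := pos_of hA fun d hd => hu'.1 d (by rw [← e1]; simp [hd])
        have h1 := den_append_ge (pos_of hA (W_mem hu)) hsA
        obtain ⟨_, _, _, _, _, h2⟩ := hu
        have h3 := hu'.2
        rw [← e1] at h3
        omega
    rcases phi_prefix (hwP i) (hwP j) (hJ1 x hx) (hJ1 y hy) heq with h | h
    · exact hne (hcode _ _ (hwW i) (hwW j) h)
    · exact hne (hcode _ _ (hwW j) (hwW i) h).symm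
  · intro ω x hx
    by_cases hirr : Irrational x
    · left
      refine limit_mem hA w hw0 hwA ω x (fun n => ?_) hirr
      obtain ⟨y, hy, e⟩ := hx n
      rw [Fc_Lw] at e
      exact ⟨y, ⟨(hJ1 y hy).1.le, (hJ1 y hy).2.le⟩, e⟩
    · right
      simpa [Irrational] using hirr

lemma frac_unique {b d p q : ℕ} (hbd : Nat.Coprime b d) (hpq : Nat.Coprime p q) (hd : 0 < d)
    (hq : 0 < q) (h : (b : ℚ) / d = p / q) : b = p ∧ d = q := by
  have hd' : (d : ℚ) ≠ 0 := by positivity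
  have hq' : (q : ℚ) ≠ 0 := by positivity
  rw [div_eq_div_iff hd' hq'] at h
  have h' : b * q = p * d := by exact_mod_cast h
  have h1 : d ∣ q := hbd.symm.dvd_of_dvd_mul_left ⟨p, by rw [h']; ring⟩
  have h2 : q ∣ d := hpq.symm.dvd_of_dvd_mul_left ⟨b, by rw [← h']; ring⟩
  have h3 := Nat.dvd_antisymm h1 h2
  subst h3
  exact ⟨Nat.eq_of_mul_eq_mul_right hd h', rfl⟩

lemma R_sub (hA : ∀ a ∈ A, 0 < a) (N : ℕ) :
    {p : ℕ × ℕ | 1 ≤ p.1 ∧ p.1 < p.2 ∧ p.2 < N ∧ Nat.Coprime p.1 p.2 ∧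
      memR (A : Set ℕ) ((p.1 : ℚ) / p.2)} ⊆ nd '' (U A N) := by
  rintro ⟨b, d⟩ ⟨h1, h2, h3, h4, -, -, l, -, hl, e⟩
  have hP : Pos l := pos_of hA hl
  rw [cfVal_eq hP] at e
  obtain ⟨e1, e2⟩ := frac_unique (nd_coprime l) h4 (nd_den_pos hP) (by simp at h1 h2 ⊢; omega) e
  exact ⟨l, ⟨hl, by rw [e2]; exact h3⟩, Prod.ext e1 e2⟩

lemma R_le (hA : ∀ a ∈ A, 0 < a) (N : ℕ) : Rcount (A : Set ℕ) N ≤ (U A N).ncard := by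
  have hf := U_finite hA N
  exact (Set.ncard_le_ncard (R_sub hA N) (hf.image _)).trans (Set.ncard_image_le hf)

lemma R_ge (hA : ∀ a ∈ A, 0 < a) {a : ℕ} (ha : a ∈ A) (ha2 : 2 ≤ a) {m N : ℕ}
    (hm : 2 * a * m ≤ N) : (U A m).ncard ≤ Rcount (A : Set ℕ) N := by
  refine Set.ncard_le_ncard_of_injOn (fun u => nd (u ++ [a])) ?_ ?_
    (((U_finite hA N).image _).subset (R_sub hA N))
  · intro u hu
    have hlA : ∀ c ∈ u ++ [a], c ∈ A := by
      intro c hc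
      rcases List.mem_append.1 hc with h | h
      · exact hu.1 c h
      · simp at h; subst h; exact ha
    have hP := pos_of hA hlA
    have hval : ((cfVal (u ++ [a]) : ℚ) : ℝ) = phi u (1 / (a : ℝ)) := by
      rw [cfVal_phi, phi_append]; simp [phi]
    have ha' : (2 : ℝ) ≤ a := by exact_mod_cast ha2
    have hb := phi_mem' (pos_of hA hu.1) (x := 1 / (a : ℝ)) (by positivity)
      (by rw [div_lt_one (by linarith)]; linarith)
    rw [← hval] at hb
    have hb0 : 0 < cfVal (u ++ [a]) := by exact_mod_cast hb.1
    have hb1 : cfVal (u ++ [a]) < 1 := by exact_mod_cast hb.2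
    have hdp := nd_den_pos hP
    have hmem : memR (A : Set ℕ) (((nd (u ++ [a])).1 : ℚ) / (nd (u ++ [a])).2) := by
      rw [← cfVal_eq hP]
      exact ⟨hb0, hb1, u ++ [a], by simp, hlA, rfl⟩
    refine ⟨nd_num_pos hP (by simp), ?_, ?_, nd_coprime _, hmem⟩
    · rw [cfVal_eq hP, div_lt_one (by exact_mod_cast hdp)] at hb1
      exact_mod_cast hb1
    · have h1 := den_append_le (pos_of hA hu.1) (v := [a]) (pos_of hA (by simpa using ha))
      have h2 : (nd [a]).2 = a := by simp [nd]
      rw [h2] at h1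
      have h3 := hu.2
      have h4 : 2 * (nd u).2 * a < 2 * a * m := by nlinarith
      exact lt_of_le_of_lt h1 (lt_of_lt_of_le h4 hm)
  · intro u hu v hv h
    have hPu : Pos (u ++ [a]) := (pos_of hA hu.1).append (pos_of hA (by simpa using ha))
    have hPv : Pos (v ++ [a]) := (pos_of hA hv.1).append (pos_of hA (by simpa using ha))
    apply phi_inj ha2 (pos_of hA hu.1) (pos_of hA hv.1)
    have : cfVal (u ++ [a]) = cfVal (v ++ [a]) := by
      rw [cfVal_eq hPu, cfVal_eq hPv]
      simp only at h
      rw [h]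
    have h2 := congrArg (fun q : ℚ => (q : ℝ)) this
    simp only [cfVal_phi, phi_append] at h2
    simpa [phi] using h2

end

end Hens

/-- **Hensley's counting theorem**: for a finite alphabet `𝒜` of positive integers with at
least two elements, `#𝔯_𝒜(N) ≍ N^{2δ_𝒜}` as `N → ∞`. -/
theorem hensley_count (A : Finset ℕ) (hA : ∀ a ∈ A, 0 < a) (hcard : 2 ≤ A.card) :
    ∃ c C : ℝ, 0 < c ∧ 0 < C ∧ ∃ N₀ : ℕ, ∀ N : ℕ, N₀ ≤ N →
      c * (N : ℝ) ^ (2 * hdim (A : Set ℕ)) ≤ (Rcount (A : Set ℕ) N : ℝ) ∧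
      (Rcount (A : Set ℕ) N : ℝ) ≤ C * (N : ℝ) ^ (2 * hdim (A : Set ℕ)) := by
  obtain ⟨a, ha, ha2⟩ : ∃ a ∈ A, 2 ≤ a := by
    by_contra hcon
    push Not at hcon
    have : A ⊆ {1} := by
      intro a ha
      have := hA a ha
      have := hcon a ha
      simp; omega
    have := Finset.card_le_card this
    simp at this
    omega
  have ha' : (2 : ℝ) ≤ a := by exact_mod_cast ha2
  set δ := hdim (A : Set ℕ) with hδd
  have hδ : 0 ≤ δ := ENNReal.toReal_nonneg
  set M := A.sup id with hMd
  have hM : ∀ b ∈ A, b ≤ M := fun b hb => Finset.le_sup (f := id) hb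
  have hM1 : 1 ≤ M := le_trans (by omega) (hM a ha)
  have hM' : (1 : ℝ) ≤ M := by exact_mod_cast hM1
  have hAc : (0 : ℝ) < A.card := by
    have : 0 < A.card := by omega
    exact_mod_cast this
  refine ⟨((4 * a : ℝ) ^ (2 * δ))⁻¹ / A.card, (16 * (M : ℝ) ^ 2) ^ δ, by positivity, by positivity,
    4 * a, ?_⟩
  intro N hN
  constructor
  · set m := N / (2 * a) with hm
    have hm2 : 2 ≤ m := by
      rw [hm, Nat.le_div_iff_mul_le (by omega)]; omega
    have hmN : 2 * a * m ≤ N := Nat.mul_div_le _ _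
    have hNm : N < 2 * a * (m + 1) := Nat.lt_mul_div_succ _ (by omega)
    have hNm' : (N : ℝ) / (4 * a) ≤ m := by
      rw [div_le_iff₀ (by linarith)]
      have h1 : (N : ℝ) < 2 * a * (m + 1) := by exact_mod_cast hNm
      have h2 : (2 : ℝ) ≤ m := by exact_mod_cast hm2
      nlinarith
    have h1 := Hens.W_ge hA hcard hm2
    have h2 : ((Hens.W A m).ncard : ℝ) ≤ (Hens.U A m).ncard * A.card := by
      exact_mod_cast Hens.W_le hA m
    have h3 : ((Hens.U A m).ncard : ℝ) ≤ Rcount (A : Set ℕ) N := by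
      exact_mod_cast Hens.R_ge hA ha ha2 hmN
    have h4 : ((N : ℝ) / (4 * a)) ^ (2 * δ) ≤ (m : ℝ) ^ (2 * δ) :=
      Real.rpow_le_rpow (by positivity) hNm' (by positivity)
    rw [Real.div_rpow (by positivity) (by positivity)] at h4
    calc ((4 * a : ℝ) ^ (2 * δ))⁻¹ / A.card * (N : ℝ) ^ (2 * δ)
        = ((N : ℝ) ^ (2 * δ) / (4 * a : ℝ) ^ (2 * δ)) / A.card := by ring
      _ ≤ (((Hens.U A m).ncard : ℝ) * A.card) / A.card := by
          gcongr
          exact h4.trans (h1.trans h2)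
      _ = (Hens.U A m).ncard := by field_simp
      _ ≤ _ := h3
  · have hN2 : 2 ≤ N := by omega
    have h1 : (Rcount (A : Set ℕ) N : ℝ) ≤ (Hens.W A N).ncard := by
      exact_mod_cast (Hens.R_le hA N).trans (Hens.U_le_W hA hcard N)
    refine h1.trans ((Hens.W_le_pow hA hM1 hM hN2).trans (le_of_eq ?_))
    rw [Real.mul_rpow (by positivity) (by positivity), ← Real.rpow_natCast (N : ℝ) 2,
      ← Real.rpow_mul (by positivity)]
    push_cast
    rfl
end

section
/- Every non-identity element γ = (a b; c d) of the semigroup Γ (an even-length product of at least two matrices (0 1; 1 aᵢ) with aᵢ ≥ 1) satisfies 1 ≤ a ≤ min(b,c) ≤ max(b,c) < d. Consequently ‖γ‖ ≤ 2·tr(γ) ≤ 4‖γ‖ and d = ‖γ‖_∞ < √(b²+d²) < ‖γ‖ < 2√(b²+d²) < 4‖γ‖_∞. -/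
/-- The generator `(0 1; 1 a)`. -/
def cfGen (a : ℕ) : Matrix (Fin 2) (Fin 2) ℤ := !![0, 1; 1, (a : ℤ)]

/-- Membership in the semigroup `Γ`: products of an even number (at least two) of generators
`(0 1; 1 a)` with `a ≥ 1`. -/
def inGamma (γ : Matrix (Fin 2) (Fin 2) ℤ) : Prop :=
  ∃ l : List ℕ, 2 ≤ l.length ∧ l.length % 2 = 0 ∧ (∀ a ∈ l, 0 < a) ∧
    γ = (l.map cfGen).prod

/-- The Frobenius norm `‖γ‖ = √(a²+b²+c²+d²)`. -/
noncomputable def frob (γ : Matrix (Fin 2) (Fin 2) ℤ) : ℝ :=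
  Real.sqrt (((γ 0 0 : ℝ)) ^ 2 + ((γ 0 1 : ℝ)) ^ 2 + ((γ 1 0 : ℝ)) ^ 2 + ((γ 1 1 : ℝ)) ^ 2)

/-- The sup norm `‖γ‖_∞ = max(|a|,|b|,|c|,|d|)`. -/
def supNorm (γ : Matrix (Fin 2) (Fin 2) ℤ) : ℤ :=
  max (max |γ 0 0| |γ 0 1|) (max |γ 1 0| |γ 1 1|)

theorem gamma_aux : ∀ l : List ℕ, 2 ≤ l.length → l.length % 2 = 0 → (∀ a ∈ l, 0 < a) →
    ∃ a b c d : ℤ, (l.map cfGen).prod = !![a, b; c, d] ∧ 1 ≤ a ∧ a ≤ b ∧ a ≤ c ∧ b < d ∧ c < d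
  | [], h, _, _ => by simp at h
  | [_], h, _, _ => by simp at h
  | [x, y], _, _, h => by
    have hx : (1 : ℤ) ≤ x := by exact_mod_cast h x (by simp)
    have hy : (1 : ℤ) ≤ y := by exact_mod_cast h y (by simp)
    refine ⟨1, y, x, 1 + x * y, ?_, le_refl _, hy, hx, ?_, ?_⟩
    · simp [cfGen]
    · nlinarith
    · nlinarith
  | [x, y, z], _, h, _ => by simp at h
  | x :: y :: z :: w :: l, _, h2, h => by
    have hx : (1 : ℤ) ≤ x := by exact_mod_cast h x (by simp)
    have hy : (1 : ℤ) ≤ y := by exact_mod_cast h y (by simp)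
    obtain ⟨a, b, c, d, he, h1, hab, hac, hbd, hcd⟩ := gamma_aux (z :: w :: l) (by simp)
      (by simp only [List.length_cons] at h2 ⊢; omega)
      (fun a ha => h a (List.mem_cons_of_mem _ (List.mem_cons_of_mem _ ha)))
    have hxy : (1 : ℤ) ≤ x * y := by nlinarith
    have e1 : (y : ℤ) * c ≤ x * y * c := by nlinarith [mul_nonneg (sub_nonneg.2 hx) (mul_nonneg (by linarith : (0:ℤ) ≤ y) (by linarith : 0 ≤ c))]
    have e2 : (y : ℤ) * d ≤ x * y * d := by nlinarith [mul_nonneg (sub_nonneg.2 hx) (mul_nonneg (by linarith : (0:ℤ) ≤ y) (by linarith : 0 ≤ d))]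
    have e3 : (x : ℤ) * y * c < x * y * d := by nlinarith
    have e4 : (y : ℤ) * c < y * d := by nlinarith
    have e5 : (x : ℤ) * a ≤ x * b := by nlinarith
    have e6 : a ≤ (x : ℤ) * a := by nlinarith
    have e7 : b ≤ (x : ℤ) * b := by nlinarith
    have e8 : 0 ≤ (y : ℤ) * c := by nlinarith
    refine ⟨a + y * c, b + y * d, x * a + c + x * y * c, x * b + d + x * y * d, ?_,
      by linarith, by linarith, by linarith, by linarith, by linarith⟩
    rw [List.map_cons, List.map_cons, List.prod_cons, List.prod_cons, he]
    simp only [cfGen, Matrix.mul_fin_two]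
    congr! 3 <;> ring_nf

/-- **Entry ordering and norm comparisons in `Γ`**: every `γ = (a b; c d)` in the semigroup `Γ`
satisfies `1 ≤ a ≤ min(b,c) ≤ max(b,c) < d`; consequently `‖γ‖ ≤ 2·tr(γ) ≤ 4‖γ‖` and
`d = ‖γ‖_∞ < √(b²+d²) < ‖γ‖ < 2√(b²+d²) < 4‖γ‖_∞`. -/
theorem gamma_entries_and_norms (γ : Matrix (Fin 2) (Fin 2) ℤ) (hγ : inGamma γ) :
    (1 ≤ γ 0 0 ∧ γ 0 0 ≤ min (γ 0 1) (γ 1 0) ∧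
      min (γ 0 1) (γ 1 0) ≤ max (γ 0 1) (γ 1 0) ∧ max (γ 0 1) (γ 1 0) < γ 1 1) ∧
    (frob γ ≤ 2 * ((γ 0 0 + γ 1 1 : ℤ) : ℝ) ∧
      2 * ((γ 0 0 + γ 1 1 : ℤ) : ℝ) ≤ 4 * frob γ) ∧
    (γ 1 1 = supNorm γ ∧
      ((supNorm γ : ℤ) : ℝ) < Real.sqrt ((γ 0 1 : ℝ) ^ 2 + (γ 1 1 : ℝ) ^ 2) ∧
      Real.sqrt ((γ 0 1 : ℝ) ^ 2 + (γ 1 1 : ℝ) ^ 2) < frob γ ∧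
      frob γ < 2 * Real.sqrt ((γ 0 1 : ℝ) ^ 2 + (γ 1 1 : ℝ) ^ 2) ∧
      2 * Real.sqrt ((γ 0 1 : ℝ) ^ 2 + (γ 1 1 : ℝ) ^ 2) < 4 * ((supNorm γ : ℤ) : ℝ)) := by
  obtain ⟨l, hl, hl2, hp, rfl⟩ := hγ
  obtain ⟨a, b, c, d, he, h1, hab, hac, hbd, hcd⟩ := gamma_aux l hl hl2 hp
  rw [he]
  have hs : supNorm !![a, b; c, d] = d := by
    simp only [supNorm, Matrix.of_apply, Matrix.cons_val', Matrix.cons_val_zero,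
      Matrix.cons_val_one, Matrix.cons_val_fin_one]
    rw [abs_of_nonneg (by linarith), abs_of_nonneg (by linarith), abs_of_nonneg (by linarith),
      abs_of_nonneg (by linarith)]
    omega
  rw [hs]
  simp only [frob, Matrix.of_apply, Matrix.cons_val', Matrix.cons_val_zero,
      Matrix.cons_val_one, Matrix.cons_val_fin_one]
  have r1 : (1 : ℝ) ≤ a := by exact_mod_cast h1
  have r2 : (a : ℝ) ≤ b := by exact_mod_cast hab
  have r3 : (a : ℝ) ≤ c := by exact_mod_cast hac
  have r4 : (b : ℝ) < d := by exact_mod_cast hbd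
  have r5 : (c : ℝ) < d := by exact_mod_cast hcd
  push_cast
  generalize (a : ℝ) = a' at *
  generalize (b : ℝ) = b' at *
  generalize (c : ℝ) = c' at *
  generalize (d : ℝ) = d' at *
  have q1 : 1 ≤ a' ^ 2 := by nlinarith
  have q2 : a' ^ 2 ≤ b' ^ 2 := by nlinarith
  have q3 : a' ^ 2 ≤ c' ^ 2 := by nlinarith
  have q4 : b' ^ 2 < d' ^ 2 := by nlinarith
  have q5 : c' ^ 2 < d' ^ 2 := by nlinarith
  have s1 := Real.sq_sqrt (show 0 ≤ a' ^ 2 + b' ^ 2 + c' ^ 2 + d' ^ 2 by positivity)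
  have s2 := Real.sq_sqrt (show 0 ≤ b' ^ 2 + d' ^ 2 by positivity)
  have p1 := Real.sqrt_nonneg (a' ^ 2 + b' ^ 2 + c' ^ 2 + d' ^ 2)
  have p2 := Real.sqrt_nonneg (b' ^ 2 + d' ^ 2)
  refine ⟨⟨h1, by omega, by omega, by omega⟩, ⟨?_, ?_⟩, trivial, ?_, ?_, ?_, ?_⟩
  · refine abs_le_of_sq_le_sq' ?_ (by linarith) |>.2
    nlinarith
  · refine abs_le_of_sq_le_sq' ?_ (by linarith) |>.2
    nlinarith [sq_nonneg (a' - d')]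
  · exact lt_of_pow_lt_pow_left₀ 2 p2 (by linarith)
  · exact lt_of_pow_lt_pow_left₀ 2 p1 (by linarith)
  · exact lt_of_pow_lt_pow_left₀ 2 (by linarith) (by linarith)
  · exact lt_of_pow_lt_pow_left₀ 2 (by linarith) (by linarith)
end

section
/- There is an absolute constant C > 0 such that for all non-identity γ, γ' ∈ Γ: (i) |λ(γγ') − λ(γ)λ(γ')| ≤ C·λ(γ)λ(γ')·( |v₊(γ) − v₊(γ')| + ‖γ‖⁻² + ‖γ'‖⁻² ), i.e. the expanding eigenvalues behave essentially multiplicatively when the expanding eigenvectors point in nearby directions; and (ii) |v₊(γγ') − v₊(γ)| ≤ C·‖γ‖⁻² and |v₋(γγ') − v₋(γ')| ≤ C·‖γ'‖⁻². -/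
/-- The trace of `γ`, as a real number. -/
def trR (γ : Matrix (Fin 2) (Fin 2) ℤ) : ℝ := ((γ 0 0 + γ 1 1 : ℤ) : ℝ)

/-- The expanding (larger) eigenvalue `λ(γ) = (tr γ + √((tr γ)² − 4))/2`. -/
noncomputable def lamPlus (γ : Matrix (Fin 2) (Fin 2) ℤ) : ℝ :=
  (trR γ + Real.sqrt (trR γ ^ 2 - 4)) / 2

/-- The unit eigenvector of `γ ∈ Γ` for the expanding eigenvalue `λ(γ)`, with positive
coordinates: it is proportional to `(b, λ(γ) − a)`. -/
noncomputable def vPlus (γ : Matrix (Fin 2) (Fin 2) ℤ) : Fin 2 → ℝ := fun i =>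
  ![(γ 0 1 : ℝ), lamPlus γ - (γ 0 0 : ℝ)] i /
    Real.sqrt ((γ 0 1 : ℝ) ^ 2 + (lamPlus γ - (γ 0 0 : ℝ)) ^ 2)

/-- The unit eigenvector of `γ ∈ Γ` for the contracting eigenvalue `1/λ(γ)`, with positive
second coordinate: it is proportional to `(1/λ(γ) − d, c)`. -/
noncomputable def vMinus (γ : Matrix (Fin 2) (Fin 2) ℤ) : Fin 2 → ℝ := fun i =>
  ![(lamPlus γ)⁻¹ - (γ 1 1 : ℝ), (γ 1 0 : ℝ)] i /
    Real.sqrt (((lamPlus γ)⁻¹ - (γ 1 1 : ℝ)) ^ 2 + (γ 1 0 : ℝ) ^ 2)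

/-- The Euclidean norm on `ℝ²` (as functions `Fin 2 → ℝ`). -/
noncomputable def enorm2 (v : Fin 2 → ℝ) : ℝ := Real.sqrt (v 0 ^ 2 + v 1 ^ 2)

def GoodI (g : Matrix (Fin 2) (Fin 2) ℤ) : Prop :=
  1 ≤ g 0 0 ∧ g 0 0 ≤ g 0 1 ∧ g 0 0 ≤ g 1 0 ∧ g 0 1 ≤ g 1 1 ∧ g 1 0 ≤ g 1 1 ∧ 2 ≤ g 1 1 ∧
    g 0 0 * g 1 1 - g 0 1 * g 1 0 = 1

lemma good_pair (x y : ℕ) (hx : 0 < x) (hy : 0 < y) : GoodI (cfGen x * cfGen y) := by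
  have hx' : (1:ℤ) ≤ x := by exact_mod_cast hx
  have hy' : (1:ℤ) ≤ y := by exact_mod_cast hy
  simp only [GoodI, cfGen, Matrix.mul_apply, Fin.sum_univ_two]
  simp
  refine ⟨by omega, by omega, by nlinarith, by nlinarith, by nlinarith, by ring⟩

lemma good_mul (g h : Matrix (Fin 2) (Fin 2) ℤ) (hg : GoodI g) (hh : GoodI h) :
    GoodI (g * h) := by
  simp only [GoodI, Matrix.mul_apply, Fin.sum_univ_two] at *
  generalize g 0 0 = a at *
  generalize g 0 1 = b at *
  generalize g 1 0 = c at *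
  generalize g 1 1 = d at *
  generalize h 0 0 = a' at *
  generalize h 0 1 = b' at *
  generalize h 1 0 = c' at *
  generalize h 1 1 = d' at *
  obtain ⟨h1, h2, h3, h4, h5, h6, h7⟩ := hg
  obtain ⟨k1, k2, k3, k4, k5, k6, k7⟩ := hh
  have e1 : 1 ≤ a * a' := by nlinarith
  have e2 : 0 ≤ b * c' := mul_nonneg (by omega) (by omega)
  have e3 : 0 ≤ c * b' := mul_nonneg (by omega) (by omega)
  refine ⟨by omega, ?_, ?_, ?_, ?_, ?_, ?_⟩
  · gcongr <;> omega
  · gcongr <;> omega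
  · gcongr <;> omega
  · gcongr <;> omega
  · nlinarith
  · linear_combination (a' * d' - b' * c') * h7 + k7

lemma good_list : ∀ l : List ℕ, l.length % 2 = 0 → (∀ a ∈ l, 0 < a) →
    l = [] ∨ GoodI ((l.map cfGen).prod)
  | [], _, _ => Or.inl rfl
  | [x], h, _ => by simp at h
  | x :: y :: l, h, hp => by
    right
    have h1 := good_pair x y (hp x (by simp)) (hp y (by simp))
    rcases good_list l (by simp at h; omega) (fun a ha => hp a (by simp [ha])) with h2 | h2
    · subst h2; simpa using h1
    · have := good_mul _ _ h1 h2
      simpa [mul_assoc] using this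

lemma good_of_inGamma (g : Matrix (Fin 2) (Fin 2) ℤ) (hg : inGamma g) : GoodI g := by
  obtain ⟨l, h1, h2, h3, rfl⟩ := hg
  rcases good_list l h2 h3 with h | h
  · subst h; simp at h1
  · exact h

/-- real data -/
structure RD (a b c d L : ℝ) : Prop where
  a1 : 1 ≤ a
  ab : a ≤ b
  ac : a ≤ c
  bd : b ≤ d
  cd : c ≤ d
  d2 : 2 ≤ d
  det : a * d - b * c = 1
  Ld : d ≤ L
  tr : L + L⁻¹ = a + d

lemma rd_of_good (g : Matrix (Fin 2) (Fin 2) ℤ) (hg : GoodI g) :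
    RD (g 0 0) (g 0 1) (g 1 0) (g 1 1) (lamPlus g) := by
  obtain ⟨h1, h2, h3, h4, h5, h6, h7⟩ := hg
  have h1' : (1:ℝ) ≤ g 0 0 := by exact_mod_cast h1
  have h6' : (2:ℝ) ≤ g 1 1 := by exact_mod_cast h6
  have ht : trR g = (g 0 0 : ℝ) + g 1 1 := by simp [trR]
  have hs : 0 ≤ trR g ^ 2 - 4 := by rw [ht]; nlinarith
  have hs0 := Real.sqrt_nonneg (trR g ^ 2 - 4)
  have hss := Real.sq_sqrt hs
  have hL : lamPlus g * (trR g - lamPlus g) = 1 := by unfold lamPlus; nlinarith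
  have hLp : 0 < lamPlus g := by unfold lamPlus; nlinarith
  have hinv : (lamPlus g)⁻¹ = trR g - lamPlus g := (eq_inv_of_mul_eq_one_right hL).symm
  refine ⟨h1', by exact_mod_cast h2, by exact_mod_cast h3, by exact_mod_cast h4,
    by exact_mod_cast h5, h6', by exact_mod_cast h7, ?_, ?_⟩
  · have : (g 1 1 : ℝ) - g 0 0 ≤ √(trR g ^ 2 - 4) := by
      apply Real.le_sqrt_of_sq_le
      rw [ht]; nlinarith
    have h8 : lamPlus g = (trR g + √(trR g ^ 2 - 4)) / 2 := rfl
    rw [h8, ht] at *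
    linarith
  · rw [hinv, ← ht]; ring

lemma RD.invL {a b c d L : ℝ} (h : RD a b c d L) : 0 < L⁻¹ ∧ L⁻¹ ≤ 1 / d ∧ d / 2 ≤ d - L⁻¹ := by
  have hd := h.d2
  have hL := h.Ld
  have h1 : L⁻¹ ≤ 1 / d := by
    rw [one_div]; exact inv_anti₀ (by linarith) hL
  have h2 : 1 / d ≤ 1 / 2 := one_div_le_one_div_of_le (by norm_num) hd
  exact ⟨inv_pos.2 (by linarith), h1, by linarith⟩

lemma ratio_close (p d m : ℝ) (hp : 0 ≤ p) (hpd : p ≤ d) (hd : 2 ≤ d) (hm : 0 < m)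
    (hm1 : m ≤ 1 / d) (hm2 : d / 2 ≤ d - m) : |p / (d - m) - p / d| ≤ 2 / d ^ 2 := by
  have hd0 : 0 < d := by linarith
  have hq : 0 < d - m := by linarith
  have : p / (d - m) - p / d = p * m / (d * (d - m)) := by field_simp; ring
  rw [this, abs_of_nonneg (by positivity), div_le_div_iff₀ (by positivity) (by positivity)]
  have h1 : m * d ≤ 1 := by rwa [le_div_iff₀ hd0] at hm1
  have h2 : p * m ≤ 1 := le_trans (by nlinarith) h1
  have h3 : d ^ 2 ≤ 2 * (d * (d - m)) := by nlinarith
  calc p * m * d ^ 2 ≤ 1 * d ^ 2 := by gcongr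
    _ ≤ _ := by linarith

lemma unit_lip (s t : ℝ) (hs : 0 ≤ s) (ht : 0 ≤ t) :
    √((s / √(s^2+1) - t / √(t^2+1))^2 + (1 / √(s^2+1) - 1 / √(t^2+1))^2) ≤ |s - t| := by
  have hM := Real.sq_sqrt (show 0 ≤ s^2+1 by positivity)
  have hN := Real.sq_sqrt (show 0 ≤ t^2+1 by positivity)
  have hM1 : 1 ≤ √(s^2+1) := Real.one_le_sqrt.2 (by nlinarith)
  have hN1 : 1 ≤ √(t^2+1) := Real.one_le_sqrt.2 (by nlinarith)
  set M := √(s^2+1)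
  set N := √(t^2+1)
  have hM0 : 0 < M := by linarith
  have hN0 : 0 < N := by linarith
  apply Real.sqrt_le_iff.2 ⟨abs_nonneg _, ?_⟩
  rw [sq_abs]
  have e : (s / M - t / N)^2 + (1 / M - 1 / N)^2 = 2 * (M * N - (1 + s * t)) / (M * N) := by
    have : (s / M - t / N)^2 + (1 / M - 1 / N)^2
      = (s^2+1) / M^2 + (t^2+1) / N^2 - 2 * (1 + s * t) / (M * N) := by field_simp; ring
    rw [this, ← hM, ← hN]; field_simp; ring
  have hP : 1 ≤ M * N := by nlinarith
  have hst : 0 ≤ s * t := by positivity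
  have key : (M * N - (1 + s * t)) * (M * N + (1 + s * t)) = (s - t)^2 := by
    have : (M*N)^2 = (s^2+1)*(t^2+1) := by rw [mul_pow, hM, hN]
    linear_combination this
  rw [e, div_le_iff₀ (by positivity)]
  have h0 : 0 ≤ M * N - (1 + s * t) := by
    by_contra hc
    push Not at hc
    nlinarith [sq_nonneg (s - t)]
  rw [← key]
  have : 2 ≤ (M * N + (1 + s * t)) * (M * N) := by nlinarith
  nlinarith

lemma unit_inv (s t : ℝ) (hs : 0 ≤ s) (ht : 0 ≤ t) (hs2 : s ≤ 2) (ht2 : t ≤ 2) :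
    |s - t| ≤
    10 * √((s / √(s^2+1) - t / √(t^2+1))^2 + (1 / √(s^2+1) - 1 / √(t^2+1))^2) := by
  have hM := Real.sq_sqrt (show 0 ≤ s^2+1 by positivity)
  have hN := Real.sq_sqrt (show 0 ≤ t^2+1 by positivity)
  have hM1 : 1 ≤ √(s^2+1) := Real.one_le_sqrt.2 (by nlinarith)
  have hN1 : 1 ≤ √(t^2+1) := Real.one_le_sqrt.2 (by nlinarith)
  set M := √(s^2+1)
  set N := √(t^2+1)
  have hM0 : 0 < M := by linarith
  have hN0 : 0 < N := by linarith
  set X := s / M - t / N with hX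
  set Y := 1 / M - 1 / N with hY
  have hXe : |X| ≤ √(X^2+Y^2) := Real.abs_le_sqrt (by nlinarith [sq_nonneg Y])
  have hYe : |Y| ≤ √(X^2+Y^2) := Real.abs_le_sqrt (by nlinarith [sq_nonneg X])
  set E := √(X^2+Y^2)
  have htN : t ≤ N := by nlinarith
  have hMN : M * N ≤ 5 := by nlinarith [sq_nonneg (M - N)]
  have id1 : s - t = M * X - M * (t * Y) := by
    rw [hX, hY]; field_simp; ring
  have hE : 0 ≤ E := Real.sqrt_nonneg _
  calc |s - t| ≤ |M * X| + |M * (t * Y)| := by rw [id1]; exact abs_sub _ _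
    _ = M * 1 * |X| + M * t * |Y| := by
        simp only [abs_mul, abs_of_pos hM0, abs_of_nonneg ht]; ring
    _ ≤ M * N * E + M * N * E := by gcongr
    _ = 2 * (M * N) * E := by ring
    _ ≤ 2 * 5 * E := by gcongr
    _ = 10 * E := by ring

lemma norm_form (p q : ℝ) (hq : 0 < q) :
    √(p^2 + q^2) = q * √((p/q)^2 + 1) := by
  rw [← Real.sqrt_sq hq.le, ← Real.sqrt_mul (by positivity), Real.sqrt_sq hq.le]
  congr 1; field_simp

noncomputable def xs (g : Matrix (Fin 2) (Fin 2) ℤ) : ℝ := (g 0 1 : ℝ) / (g 1 1 - (lamPlus g)⁻¹)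
noncomputable def ys (g : Matrix (Fin 2) (Fin 2) ℤ) : ℝ := (g 1 0 : ℝ) / (g 1 1 - (lamPlus g)⁻¹)

lemma vPlus_eq (g : Matrix (Fin 2) (Fin 2) ℤ) (hg : GoodI g) :
    vPlus g 0 = xs g / √(xs g ^ 2 + 1) ∧ vPlus g 1 = 1 / √(xs g ^ 2 + 1) := by
  have h := rd_of_good g hg
  have h2 := h.invL
  have hd := h.d2
  have e : lamPlus g - g 0 0 = g 1 1 - (lamPlus g)⁻¹ := by linarith [h.tr]
  have hq : 0 < (g 1 1 : ℝ) - (lamPlus g)⁻¹ := by linarith [h2.2.2]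
  have hpos : 0 < √(xs g ^ 2 + 1) := Real.sqrt_pos.2 (by positivity)
  simp only [vPlus, e, norm_form _ _ hq]
  change _ / (_ * √(xs g ^ 2 + 1)) = _ ∧ _ / (_ * √(xs g ^ 2 + 1)) = _
  constructor
  · simp only [Matrix.cons_val_zero]
    rw [← div_div]; rfl
  · simp only [Matrix.cons_val_one, Matrix.cons_val_zero]
    rw [← div_div, div_self hq.ne']

lemma vMinus_eq (g : Matrix (Fin 2) (Fin 2) ℤ) (hg : GoodI g) :
    vMinus g 0 = - (1 / √(ys g ^ 2 + 1)) ∧ vMinus g 1 = ys g / √(ys g ^ 2 + 1) := by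
  have h := rd_of_good g hg
  have h2 := h.invL
  have hd := h.d2
  have hq : 0 < (g 1 1 : ℝ) - (lamPlus g)⁻¹ := by linarith [h2.2.2]
  have hpos : 0 < √(ys g ^ 2 + 1) := Real.sqrt_pos.2 (by positivity)
  have e : ((lamPlus g)⁻¹ - g 1 1)^2 + (g 1 0 : ℝ)^2 = (g 1 0 : ℝ)^2 + (g 1 1 - (lamPlus g)⁻¹)^2 := by
    ring
  simp only [vMinus, e, norm_form _ _ hq]
  change _ / (_ * √(ys g ^ 2 + 1)) = _ ∧ _ / (_ * √(ys g ^ 2 + 1)) = _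
  constructor
  · simp only [Matrix.cons_val_zero]
    rw [← div_div, ← neg_sub, neg_div, div_self hq.ne', neg_div]
  · simp only [Matrix.cons_val_one, Matrix.cons_val_zero]
    rw [← div_div]; rfl

lemma xs_facts (g : Matrix (Fin 2) (Fin 2) ℤ) (hg : GoodI g) :
    0 ≤ xs g ∧ xs g ≤ 2 ∧ |xs g - g 0 1 / g 1 1| ≤ 2 / (g 1 1 : ℝ)^2 ∧
    0 ≤ ys g ∧ |ys g - g 1 0 / g 1 1| ≤ 2 / (g 1 1 : ℝ)^2 := by
  have h := rd_of_good g hg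
  obtain ⟨i1, i2, i3⟩ := h.invL
  have hd := h.d2
  have hb := h.bd
  have hc := h.cd
  have hb0 : (0:ℝ) ≤ g 0 1 := by linarith [h.a1, h.ab]
  have hc0 : (0:ℝ) ≤ g 1 0 := by linarith [h.a1, h.ac]
  have hq : 0 < (g 1 1 : ℝ) - (lamPlus g)⁻¹ := by linarith
  refine ⟨div_nonneg hb0 hq.le, ?_, ratio_close _ _ _ hb0 hb hd i1 i2 i3, div_nonneg hc0 hq.le,
    ratio_close _ _ _ hc0 hc hd i1 i2 i3⟩
  rw [xs, div_le_iff₀ hq]; linarith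

lemma frob_ge (g : Matrix (Fin 2) (Fin 2) ℤ) (hg : GoodI g) :
    1 / (g 1 1 : ℝ)^2 ≤ 4 * (frob g) ^ (-2 : ℤ) := by
  have h := rd_of_good g hg
  have h1 := h.a1
  have h2 := h.ab
  have h3 := h.ac
  have h4 := h.bd
  have h5 := h.cd
  have e : (frob g) ^ (-2 : ℤ) = 1 / ((g 0 0 : ℝ)^2 + (g 0 1 : ℝ)^2 + (g 1 0 : ℝ)^2 + (g 1 1 : ℝ)^2) := by
    rw [zpow_neg, one_div]
    congr 1
    exact Real.sq_sqrt (by positivity)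
  have hd : (0:ℝ) < g 1 1 := by linarith
  rw [e, mul_one_div, div_le_div_iff₀ (by positivity) (by positivity)]
  have : (g 0 0 : ℝ)^2 ≤ (g 1 1 : ℝ)^2 := pow_le_pow_left₀ (by linarith) (by linarith) 2
  have : (g 0 1 : ℝ)^2 ≤ (g 1 1 : ℝ)^2 := pow_le_pow_left₀ (by linarith) (by linarith) 2
  have : (g 1 0 : ℝ)^2 ≤ (g 1 1 : ℝ)^2 := pow_le_pow_left₀ (by linarith) (by linarith) 2
  linarith

lemma ratio_step {a b c d L a' b' c' d' L' : ℝ} (h : RD a b c d L) (h' : RD a' b' c' d' L') :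
    |(a*b'+b*d')/(c*b'+d*d') - b/d| ≤ 1/d^2 ∧ |(c*a'+d*c')/(c*b'+d*d') - c'/d'| ≤ 1/d'^2 ∧
    1/(c*b'+d*d')^2 ≤ 1/d^2 ∧ 1/(c*b'+d*d')^2 ≤ 1/d'^2 := by
  obtain ⟨a1, ab, ac, bd, cd, d2, det, -, -⟩ := h
  obtain ⟨a1', ab', ac', bd', cd', d2', det', -, -⟩ := h'
  have hd : 0 < d := by linarith
  have hd' : 0 < d' := by linarith
  have hc : 0 < c := by linarith
  have hb' : 0 < b' := by linarith
  have hcb : 0 < c * b' := by positivity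
  have hD : 0 < c*b'+d*d' := by positivity
  have D1 : d ≤ c*b'+d*d' := by nlinarith
  have D2 : d' ≤ c*b'+d*d' := by nlinarith
  refine ⟨?_, ?_, ?_, ?_⟩
  · have : (a*b'+b*d')/(c*b'+d*d') - b/d = b'/(d*(c*b'+d*d')) := by
      field_simp
      linear_combination b' * det
    rw [this, abs_of_pos (by positivity), div_le_div_iff₀ (by positivity) (by positivity)]
    nlinarith [mul_le_mul_of_nonneg_left bd' (sq_nonneg d), mul_pos hd hcb]
  · have : (c*a'+d*c')/(c*b'+d*d') - c'/d' = c/(d'*(c*b'+d*d')) := by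
      field_simp
      linear_combination c * det'
    rw [this, abs_of_pos (by positivity), div_le_div_iff₀ (by positivity) (by positivity)]
    nlinarith [mul_le_mul_of_nonneg_left cd (sq_nonneg d'), mul_pos hd' hcb]
  · gcongr
  · gcongr

set_option maxHeartbeats 1000000 in
lemma lam_step {a b c d L a' b' c' d' L' M : ℝ} (h : RD a b c d L) (h' : RD a' b' c' d' L')
    (hM : RD (a*a'+b*c') (a*b'+b*d') (c*a'+d*c') (c*b'+d*d') M) :
    |M - L * L'| ≤ (L * L') * (|b/d - b'/d'| + 5 * (1/d^2 + 1/d'^2)) := by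
  obtain ⟨i1, i2, -⟩ := h.invL
  obtain ⟨j1, j2, -⟩ := h'.invL
  obtain ⟨k1, k2, -⟩ := hM.invL
  have trM := hM.tr
  obtain ⟨a1, ab, ac, bd, cd, d2, det, Ld, tr⟩ := h
  obtain ⟨a1', ab', ac', bd', cd', d2', det', Ld', tr'⟩ := h'
  have hd : 0 < d := by linarith
  have hd' : 0 < d' := by linarith
  have hc : 0 < c := by linarith
  have hb' : 0 < b' := by linarith
  have hdd : 0 < d * d' := by positivity
  have hLL : d * d' ≤ L * L' := by gcongr; linarith
  have id1 : (a*a'+b*c') + (c*b'+d*d') - (a+d)*(a'+d')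
      = -(d*d')*((b/d - b'/d')*(c/d - c'/d')) - d*d'*(1/d^2+1/d'^2) := by
    have e1 : a = (1 + b*c)/d := by field_simp; linarith
    have e2 : a' = (1 + b'*c')/d' := by field_simp; linarith
    rw [e1, e2]; field_simp; ring
  have hy : |c/d - c'/d'| ≤ 1 := by
    have u1 : 0 ≤ c/d := by positivity
    have u2 : c/d ≤ 1 := (div_le_one hd).2 cd
    have u3 : 0 ≤ c'/d' := div_nonneg (by linarith) hd'.le
    have u4 : c'/d' ≤ 1 := (div_le_one hd').2 cd'
    rw [abs_le]; constructor <;> linarith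
  have hz : |(b/d - b'/d')*(c/d - c'/d')| ≤ |b/d - b'/d'| := by
    rw [abs_mul]; exact mul_le_of_le_one_right (abs_nonneg _) hy
  have LL : L * L' = (a+d)*(a'+d') - (a+d)*L'⁻¹ - (a'+d')*L⁻¹ + L⁻¹ * L'⁻¹ := by
    rw [← tr, ← tr']; ring
  have hMe : M = (a*a'+b*c') + (c*b'+d*d') - M⁻¹ := by linarith
  have f1 : (a+d)*L'⁻¹ ≤ d*d'*(2*(1/d'^2)) := by
    calc (a+d)*L'⁻¹ ≤ (2*d) * (1/d') := by gcongr; linarith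
      _ = _ := by field_simp
  have f2 : (a'+d')*L⁻¹ ≤ d*d'*(2*(1/d^2)) := by
    calc (a'+d')*L⁻¹ ≤ (2*d') * (1/d) := by gcongr; linarith
      _ = _ := by field_simp
  have f1' : 0 ≤ (a+d)*L'⁻¹ := mul_nonneg (by linarith) j1.le
  have f2' : 0 ≤ (a'+d')*L⁻¹ := mul_nonneg (by linarith) i1.le
  have g0 : 1/(d*d') ≤ d*d'*(1/d^2) := by
    have : d*d'*(1/d^2) = d'/d := by field_simp
    rw [this, div_le_div_iff₀ (by positivity) (by positivity)]
    have : 1 ≤ d' * d' := one_le_mul_of_one_le_of_one_le (by linarith) (by linarith)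
    calc 1 * d ≤ (d' * d') * d := mul_le_mul_of_nonneg_right this hd.le
      _ = _ := by ring
  have f3 : L⁻¹ * L'⁻¹ ≤ 1/(d*d') := by
    calc L⁻¹ * L'⁻¹ ≤ (1/d)*(1/d') := by gcongr
      _ = _ := by field_simp
  have f3' : 0 ≤ L⁻¹ * L'⁻¹ := by positivity
  have f4 : M⁻¹ ≤ 1/(d*d') := by
    refine k2.trans ?_
    apply one_div_le_one_div_of_le hdd
    linarith [mul_pos hc hb']
  have hx0 := abs_nonneg (b/d - b'/d')
  set Z := (b/d - b'/d')*(c/d - c'/d')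
  set X := |b/d - b'/d'|
  have q1 : 0 < 1/d^2 := by positivity
  have q2 : 0 < 1/d'^2 := by positivity
  set E := 1/d^2
  set E' := 1/d'^2
  have z := abs_le.1 hz
  have z1 := mul_le_mul_of_nonneg_left z.1 hdd.le
  have z2 := mul_le_mul_of_nonneg_left z.2 hdd.le
  have w1 := mul_pos hdd q1
  have w2 := mul_pos hdd q2
  have main : |M - L*L'| ≤ (d*d') * (X + 5*(E+E')) := by
    have diff : M - L * L' = -(d*d')*Z - d*d'*(E+E') - M⁻¹ + (a+d)*L'⁻¹ + (a'+d')*L⁻¹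
        - L⁻¹ * L'⁻¹ := by linarith
    rw [diff]
    clear_value Z X E E'
    generalize (a+d)*L'⁻¹ = u1 at *
    generalize (a'+d')*L⁻¹ = u2 at *
    generalize L⁻¹ * L'⁻¹ = u3 at *
    generalize M⁻¹ = u4 at *
    clear id1 LL diff hMe trM det det' hLL
    rw [abs_le]
    constructor <;> linarith
  refine main.trans ?_
  gcongr

lemma enorm_plus (g h : Matrix (Fin 2) (Fin 2) ℤ) (hg : GoodI g) (hh : GoodI h) :
    enorm2 (fun i => vPlus g i - vPlus h i) ≤ |xs g - xs h| ∧
    |xs g - xs h| ≤ 10 * enorm2 (fun i => vPlus g i - vPlus h i) := by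
  obtain ⟨g0, g1⟩ := vPlus_eq g hg
  obtain ⟨h0, h1⟩ := vPlus_eq h hh
  have G := xs_facts g hg
  have H := xs_facts h hh
  simp only [enorm2, g0, g1, h0, h1]
  exact ⟨unit_lip _ _ G.1 H.1, unit_inv _ _ G.1 H.1 G.2.1 H.2.1⟩

lemma enorm_minus (g h : Matrix (Fin 2) (Fin 2) ℤ) (hg : GoodI g) (hh : GoodI h) :
    enorm2 (fun i => vMinus g i - vMinus h i) ≤ |ys g - ys h| := by
  obtain ⟨g0, g1⟩ := vMinus_eq g hg
  obtain ⟨h0, h1⟩ := vMinus_eq h hh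
  have G := xs_facts g hg
  have H := xs_facts h hh
  simp only [enorm2, g0, g1, h0, h1]
  refine le_trans (le_of_eq ?_) (unit_lip _ _ G.2.2.2.1 H.2.2.2.1)
  congr 1; ring

/-- **Eigenvalues behave essentially multiplicatively on `Γ`** when expanding eigenvectors point
in nearby directions, and the expanding (resp. contracting) eigenvector of a product is close to
that of the first (resp. second) factor. -/
theorem eigenvalue_multiplicativity :
    ∃ C : ℝ, 0 < C ∧ ∀ γ γ' : Matrix (Fin 2) (Fin 2) ℤ, inGamma γ → inGamma γ' →
      |lamPlus (γ * γ') - lamPlus γ * lamPlus γ'| ≤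
        C * (lamPlus γ * lamPlus γ') *
          (enorm2 (fun i => vPlus γ i - vPlus γ' i) + (frob γ) ^ (-2 : ℤ) +
            (frob γ') ^ (-2 : ℤ)) ∧
      enorm2 (fun i => vPlus (γ * γ') i - vPlus γ i) ≤ C * (frob γ) ^ (-2 : ℤ) ∧
      enorm2 (fun i => vMinus (γ * γ') i - vMinus γ' i) ≤ C * (frob γ') ^ (-2 : ℤ) := by
  refine ⟨100, by norm_num, fun γ γ' hγ hγ' => ?_⟩
  have hg := good_of_inGamma γ hγ
  have hg' := good_of_inGamma γ' hγ'
  have hm := good_mul γ γ' hg hg'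
  have R := rd_of_good γ hg
  have R' := rd_of_good γ' hg'
  have RM := rd_of_good _ hm
  have F := frob_ge γ hg
  have F' := frob_ge γ' hg'
  have X := xs_facts γ hg
  have X' := xs_facts γ' hg'
  have XM := xs_facts _ hm
  have S := ratio_step R R'
  have P := enorm_plus γ γ' hg hg'
  have PM := enorm_plus (γ * γ') γ hm hg
  have NM := enorm_minus (γ * γ') γ' hm hg'
  simp only [Matrix.mul_apply, Fin.sum_univ_two, Int.cast_add, Int.cast_mul] at RM XM
  have T := lam_step R R' RM
  have d2 : ∀ x : ℝ, 2 / x ^ 2 = 2 * (1 / x ^ 2) := fun x => by ring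
  simp only [d2] at X X' XM
  obtain ⟨-, -, X1, -, X2⟩ := X
  obtain ⟨-, -, X1', -, X2'⟩ := X'
  obtain ⟨-, -, XM1, -, XM2⟩ := XM
  obtain ⟨S1, S2, S3, S4⟩ := S
  have hL : 0 ≤ lamPlus γ * lamPlus γ' :=
    mul_nonneg (by linarith [R.Ld, R.d2]) (by linarith [R'.Ld, R'.d2])
  have hF : 0 ≤ frob γ ^ (-2 : ℤ) := zpow_nonneg (Real.sqrt_nonneg _) _
  have hF' : 0 ≤ frob γ' ^ (-2 : ℤ) := zpow_nonneg (Real.sqrt_nonneg _) _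
  have hE : 0 ≤ enorm2 (fun i => vPlus γ i - vPlus γ' i) := Real.sqrt_nonneg _
  refine ⟨?_, ?_, ?_⟩
  · refine T.trans ?_
    rw [mul_comm (100 : ℝ), mul_assoc _ (100 : ℝ)]
    apply mul_le_mul_of_nonneg_left _ hL
    have : |(γ 0 1 : ℝ) / γ 1 1 - γ' 0 1 / γ' 1 1| ≤ |xs γ - xs γ'|
        + 2 * (1 / (γ 1 1 : ℝ) ^ 2) + 2 * (1 / (γ' 1 1 : ℝ) ^ 2) := by
      have p := abs_le.1 X1
      have p' := abs_le.1 X1'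
      have q := abs_le.1 (le_refl |xs γ - xs γ'|)
      rw [abs_le]; constructor <;> linarith
    linarith [P.2]
  · refine PM.1.trans ?_
    have p := abs_le.1 X1
    have p' := abs_le.1 XM1
    have q := abs_le.1 S1
    rw [abs_le]; constructor <;> linarith
  · refine NM.trans ?_
    have p := abs_le.1 X2'
    have p' := abs_le.1 XM2
    have q := abs_le.1 S2
    rw [abs_le]; constructor <;> linarith
end

section
/- There is a constant C₀ > 0 such that every non-identity γ ∈ Γ with ‖γ‖ ≥ C₀ satisfies |⟨v₊(γ), v₋(γ)^⊥⟩| ≥ 1/2, where (x,y)^⊥ = (−y,x); that is, the angle between the expanding and contracting eigenvectors of elements of Γ does not degenerate. -/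
theorem gamma_ineq : ∀ l : List ℕ, l ≠ [] → (∀ a ∈ l, 0 < a) →
    0 ≤ (l.map cfGen).prod 0 0 ∧ (l.map cfGen).prod 0 0 ≤ (l.map cfGen).prod 0 1 ∧
    (l.map cfGen).prod 0 0 ≤ (l.map cfGen).prod 1 0 ∧
    (l.map cfGen).prod 0 1 ≤ (l.map cfGen).prod 1 1 ∧
    (l.map cfGen).prod 1 0 ≤ (l.map cfGen).prod 1 1
  | [], h, _ => absurd rfl h
  | [a], _, ha => by
    have := ha a (by simp)
    simp [cfGen]
    omega
  | a :: b :: l, _, ha => by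
    have ih := gamma_ineq (b :: l) (by simp) (fun x hx => ha x (List.mem_cons_of_mem _ hx))
    have h1 : (1 : ℤ) ≤ a := by exact_mod_cast ha a (by simp)
    rw [List.map_cons, List.prod_cons]
    generalize (List.map cfGen (b :: l)).prod = M at ih
    obtain ⟨i1, i2, i3, i4, i5⟩ := ih
    simp only [cfGen, Matrix.mul_apply, Fin.sum_univ_two]
    simp
    refine ⟨by linarith, by linarith, by nlinarith, by nlinarith, by nlinarith⟩

theorem gamma_det (l : List ℕ) : (l.map cfGen).prod.det = (-1) ^ l.length := by
  induction l with
  | nil => simp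
  | cons a l ih =>
    rw [List.map_cons, List.prod_cons, Matrix.det_mul, ih, List.length_cons, pow_succ]
    simp [cfGen, Matrix.det_fin_two]

theorem angle_real (a b c d l m : ℝ) (hb : 0 ≤ b) (hc : 0 ≤ c) (hbd : b ≤ d)
    (hcd : c ≤ d) (hd : 10 ≤ d) (hm0 : 0 < m) (hm : m ≤ 1 / 2) (hdet : a * d - b * c = 1)
    (hs : l + m = a + d) (hp : l * m = 1) :
    1 / 2 ≤ |b / √(b ^ 2 + (l - a) ^ 2) * (-(c / √((m - d) ^ 2 + c ^ 2))) +
      (l - a) / √(b ^ 2 + (l - a) ^ 2) * ((m - d) / √((m - d) ^ 2 + c ^ 2))| := by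
  obtain ⟨x, hx⟩ : ∃ x, x = d - m := ⟨_, rfl⟩
  obtain ⟨y, hy⟩ : ∃ y, y = a - m := ⟨_, rfl⟩
  have hxp : 9 ≤ x := by linarith
  have h1 : l - a = x := by linarith
  have h2 : m - d = -x := by linarith
  have hbc : b * c = x * y := by
    have : l = a + d - m := by linarith
    subst this hx hy
    linarith
  have hy0 : 0 ≤ y := by
    have : 0 ≤ x * y := by rw [← hbc]; positivity
    exact nonneg_of_mul_nonneg_right this (by linarith)
  rw [h1, h2]
  have hP : 0 < b ^ 2 + x ^ 2 := by positivity
  have hQ : 0 < (-x) ^ 2 + c ^ 2 := by nlinarith [sq_nonneg c]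
  have hP' := Real.sqrt_pos.2 hP
  have hQ' := Real.sqrt_pos.2 hQ
  have e : b / √(b ^ 2 + x ^ 2) * (-(c / √((-x) ^ 2 + c ^ 2))) +
      x / √(b ^ 2 + x ^ 2) * (-x / √((-x) ^ 2 + c ^ 2)) =
      -(x * (x + y) / (√(b ^ 2 + x ^ 2) * √((-x) ^ 2 + c ^ 2))) := by
    field_simp
    linarith
  rw [e, abs_neg, abs_of_nonneg (by positivity), le_div_iff₀ (by positivity),
    ← Real.sqrt_mul hP.le]
  have hd2 : d ^ 2 ≤ 3 / 2 * x ^ 2 := by nlinarith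
  have hb2 : b ^ 2 ≤ d ^ 2 := by gcongr
  have hc2 : c ^ 2 ≤ d ^ 2 := by gcongr
  have hxy : 0 ≤ x * y := by positivity
  have key : √((b ^ 2 + x ^ 2) * ((-x) ^ 2 + c ^ 2)) ≤ 2 * (x * (x + y)) := by
    apply Real.sqrt_le_iff.2 ⟨by positivity, ?_⟩
    have e2 : (b ^ 2 + x ^ 2) * ((-x) ^ 2 + c ^ 2) = x ^ 2 * (y ^ 2 + b ^ 2 + c ^ 2 + x ^ 2) := by
      have : b ^ 2 * c ^ 2 = x ^ 2 * y ^ 2 := by rw [← mul_pow, hbc, mul_pow]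
      linear_combination this
    have e3 : (2 * (x * (x + y))) ^ 2 = x ^ 2 * (4 * (x + y) ^ 2) := by ring
    rw [e2, e3]
    apply mul_le_mul_of_nonneg_left _ (sq_nonneg x)
    nlinarith [sq_nonneg y]
  linarith

/-- **The angle between expanding and contracting eigenvectors does not degenerate on `Γ`**:
there is `C₀ > 0` such that every `γ ∈ Γ` with `‖γ‖ ≥ C₀` satisfies
`|⟨v₊(γ), v₋(γ)^⊥⟩| ≥ 1/2`, where `(x,y)^⊥ = (−y,x)`. -/
theorem eigenvector_angle_nondegenerate :
    ∃ C₀ : ℝ, 0 < C₀ ∧ ∀ γ : Matrix (Fin 2) (Fin 2) ℤ, inGamma γ → C₀ ≤ frob γ →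
      (1 : ℝ) / 2 ≤ |vPlus γ 0 * (-(vMinus γ 1)) + vPlus γ 1 * vMinus γ 0| := by
  refine ⟨20, by norm_num, ?_⟩
  rintro γ ⟨L, hL, hev, hpos, rfl⟩ hfrob
  have hin := gamma_ineq L (by rintro rfl; simp at hL) hpos
  have hdet := gamma_det L
  rw [(Nat.even_iff.2 hev).neg_one_pow, Matrix.det_fin_two] at hdet
  generalize (L.map cfGen).prod = γ at *
  obtain ⟨i1, i2, i3, i4, i5⟩ := hin
  have hdet' : (γ 0 0 : ℝ) * γ 1 1 - γ 0 1 * γ 1 0 = 1 := by exact_mod_cast hdet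
  have j1 : (0 : ℝ) ≤ γ 0 0 := by exact_mod_cast i1
  have j2 : (γ 0 0 : ℝ) ≤ γ 0 1 := by exact_mod_cast i2
  have j3 : (γ 0 0 : ℝ) ≤ γ 1 0 := by exact_mod_cast i3
  have j4 : (γ 0 1 : ℝ) ≤ γ 1 1 := by exact_mod_cast i4
  have j5 : (γ 1 0 : ℝ) ≤ γ 1 1 := by exact_mod_cast i5
  have hd : (10 : ℝ) ≤ γ 1 1 := by
    have h : (20 : ℝ) ≤ 2 * γ 1 1 := by
      refine hfrob.trans (Real.sqrt_le_iff.2 ⟨by linarith, ?_⟩)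
      nlinarith
    linarith
  have ht : trR γ = γ 0 0 + γ 1 1 := by simp [trR]
  have ht10 : 10 ≤ trR γ := by linarith
  have hsq : √(trR γ ^ 2 - 4) ^ 2 = trR γ ^ 2 - 4 := Real.sq_sqrt (by nlinarith)
  have hs0 := Real.sqrt_nonneg (trR γ ^ 2 - 4)
  have hl2 : 2 ≤ lamPlus γ := by unfold lamPlus; linarith
  have hinv : (lamPlus γ)⁻¹ = trR γ - lamPlus γ := by
    apply inv_eq_of_mul_eq_one_right
    unfold lamPlus
    linear_combination (-1 / 4) * hsq
  have := angle_real (γ 0 0) (γ 0 1) (γ 1 0) (γ 1 1) (lamPlus γ) (lamPlus γ)⁻¹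
    (by linarith) (by linarith) j4 j5 hd (by positivity)
    (by rw [one_div]; exact inv_anti₀ (by norm_num) hl2) hdet' (by rw [hinv, ht]; ring)
    (mul_inv_cancel₀ (by linarith))
  simpa [vPlus, vMinus] using this
end

section
/- Let A ≥ 2 be an integer, δ = δ_A, and let μ be the δ-dimensional Hausdorff measure restricted to 𝔠_A. Let x ∈ 𝔠_A be a density point of μ, i.e. a point such that for every ε > 0 one has μ((x−r, x+r)) ≥ r^{δ+ε} for all sufficiently small r > 0. Then there exist c > 0 and N₀ such that for all N ≥ N₀: #{γ ∈ Γ_A : ‖γ‖ < N and |slope(v₊(γ)) − x| < 1/log N} ≥ c·N^{2δ}/log N. -/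
open Filter MeasureTheory

/-- The Cantor set `𝔠_A` of irrationals in `[0,1]` all of whose continued fraction partial
quotients are at most `A` (equivalently, limits of convergents `[a₁,…,a_k]`, all `a_j ≤ A`). -/
def cantorA (A : ℕ) : Set ℝ :=
  {x | Irrational x ∧ 0 ≤ x ∧ x ≤ 1 ∧
    ∃ a : ℕ → ℕ, (∀ n, 1 ≤ a n ∧ a n ≤ A) ∧
      Tendsto (fun k => ((cfVal (List.ofFn fun i : Fin k => a i) : ℚ) : ℝ)) atTop (nhds x)}

/-- `δ_A`, the Hausdorff dimension of `𝔠_A` (as a real number). -/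
noncomputable def hdimA (A : ℕ) : ℝ := (dimH (cantorA A)).toReal

/-- Membership in the semigroup `Γ_A`: products of an even number (at least two) of generators
`(0 1; 1 a)` with `1 ≤ a ≤ A`. -/
def inGammaA (A : ℕ) (γ : Matrix (Fin 2) (Fin 2) ℤ) : Prop :=
  ∃ l : List ℕ, 2 ≤ l.length ∧ l.length % 2 = 0 ∧ (∀ a ∈ l, 1 ≤ a ∧ a ≤ A) ∧
    γ = (l.map cfGen).prod

/-- The slope `x/y` of a vector `(x,y)`. -/
noncomputable def vslope (v : Fin 2 → ℝ) : ℝ := v 0 / v 1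

open scoped Pointwise

/-- Möbius action. -/
noncomputable def mob (γ : Matrix (Fin 2) (Fin 2) ℤ) (y : ℝ) : ℝ :=
  ((γ 0 0 : ℝ) * y + γ 0 1) / ((γ 1 0 : ℝ) * y + γ 1 1)

/-- Matrices mapping `[0,1]` to itself. -/
structure PosM (γ : Matrix (Fin 2) (Fin 2) ℤ) : Prop where
  h00 : 0 ≤ γ 0 0
  h01 : 0 ≤ γ 0 1
  h10 : 0 ≤ γ 1 0
  h11 : 1 ≤ γ 1 1
  r1 : γ 0 1 ≤ γ 1 1
  r2 : γ 0 0 + γ 0 1 ≤ γ 1 0 + γ 1 1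
  det : (γ 0 0 * γ 1 1 - γ 0 1 * γ 1 0) ^ 2 = 1

structure BigM (γ : Matrix (Fin 2) (Fin 2) ℤ) : Prop where
  h00 : 1 ≤ γ 0 0
  c1 : γ 0 0 ≤ γ 0 1
  c2 : γ 1 0 ≤ γ 1 1
  r1 : γ 0 0 ≤ γ 1 0
  r2 : γ 0 1 ≤ γ 1 1
  h11 : 2 ≤ γ 1 1
  det : γ 0 0 * γ 1 1 - γ 0 1 * γ 1 0 = 1

theorem mul00 (γ η : Matrix (Fin 2) (Fin 2) ℤ) : (γ * η) 0 0 = γ 0 0 * η 0 0 + γ 0 1 * η 1 0 := by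
  simp [Matrix.mul_apply, Fin.sum_univ_two]
theorem mul01 (γ η : Matrix (Fin 2) (Fin 2) ℤ) : (γ * η) 0 1 = γ 0 0 * η 0 1 + γ 0 1 * η 1 1 := by
  simp [Matrix.mul_apply, Fin.sum_univ_two]
theorem mul10 (γ η : Matrix (Fin 2) (Fin 2) ℤ) : (γ * η) 1 0 = γ 1 0 * η 0 0 + γ 1 1 * η 1 0 := by
  simp [Matrix.mul_apply, Fin.sum_univ_two]
theorem mul11 (γ η : Matrix (Fin 2) (Fin 2) ℤ) : (γ * η) 1 1 = γ 1 0 * η 0 1 + γ 1 1 * η 1 1 := by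
  simp [Matrix.mul_apply, Fin.sum_univ_two]

theorem posM_one : PosM 1 := by constructor <;> simp

theorem PosM.mul {γ η : Matrix (Fin 2) (Fin 2) ℤ} (h : PosM γ) (k : PosM η) : PosM (γ * η) := by
  obtain ⟨a1, a2, a3, a4, a5, a6, a7⟩ := h
  obtain ⟨b1, b2, b3, b4, b5, b6, b7⟩ := k
  constructor
  · rw [mul00]; positivity
  · rw [mul01]; positivity
  · rw [mul10]; positivity
  · rw [mul11]; nlinarith [mul_nonneg a3 b2]
  · rw [mul01, mul11]
    nlinarith [mul_nonneg (sub_nonneg.2 a5) (sub_nonneg.2 b5), mul_nonneg (sub_nonneg.2 a6) b2]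
  · rw [mul00, mul01, mul10, mul11]
    nlinarith [mul_nonneg (sub_nonneg.2 a5) (sub_nonneg.2 b6),
      mul_nonneg (sub_nonneg.2 a6) (add_nonneg b1 b2)]
  · rw [mul00, mul01, mul10, mul11]
    have := congrArg₂ (· * ·) a7 b7
    beta_reduce at this
    rw [← mul_pow] at this
    rw [mul_one] at this
    rw [← this]; ring

theorem BigM.pos {γ : Matrix (Fin 2) (Fin 2) ℤ} (h : BigM γ) : PosM γ := by
  obtain ⟨a1, a2, a3, a4, a5, a6, a7⟩ := h
  constructor <;> first | linarith | (rw [a7]; norm_num)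

theorem BigM.mul {γ η : Matrix (Fin 2) (Fin 2) ℤ} (h : BigM γ) (k : BigM η) : BigM (γ * η) := by
  obtain ⟨a1, a2, a3, a4, a5, a6, a7⟩ := h
  obtain ⟨b1, b2, b3, b4, b5, b6, b7⟩ := k
  have p01 : 1 ≤ γ 0 1 := a1.trans a2
  have p10 : 1 ≤ γ 1 0 := a1.trans a4
  have q01 : 1 ≤ η 0 1 := b1.trans b2
  have q10 : 1 ≤ η 1 0 := b1.trans b4
  constructor
  · rw [mul00]; nlinarith
  · rw [mul00, mul01]; gcongr
  · rw [mul10, mul11]; gcongr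
  · rw [mul00, mul10]; gcongr
  · rw [mul01, mul11]; gcongr
  · rw [mul11]; nlinarith
  · rw [mul00, mul01, mul10, mul11]
    have := congrArg₂ (· * ·) a7 b7
    beta_reduce at this
    rw [mul_one] at this
    rw [← this]; ring

theorem posM_gen {a : ℕ} (ha : 1 ≤ a) : PosM (cfGen a) := by
  constructor <;> simp [cfGen] <;> omega

theorem bigM_pair {a b : ℕ} (ha : 1 ≤ a) (hb : 1 ≤ b) : BigM (cfGen a * cfGen b) := by
  have h1 : (1 : ℤ) ≤ a := by exact_mod_cast ha
  have h2 : (1 : ℤ) ≤ b := by exact_mod_cast hb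
  constructor <;> simp [cfGen] <;> nlinarith

theorem PosM.den {γ : Matrix (Fin 2) (Fin 2) ℤ} (h : PosM γ) {y : ℝ} (hy : 0 ≤ y) :
    (γ 1 1 : ℝ) ≤ (γ 1 0 : ℝ) * y + γ 1 1 ∧ (1 : ℝ) ≤ γ 1 1 := by
  have h1 : (0 : ℝ) ≤ γ 1 0 := by exact_mod_cast h.h10
  have h2 : (1 : ℝ) ≤ γ 1 1 := by exact_mod_cast h.h11
  exact ⟨by nlinarith, h2⟩

theorem PosM.mob_mem {γ : Matrix (Fin 2) (Fin 2) ℤ} (h : PosM γ) {y : ℝ} (hy : y ∈ Set.Icc (0:ℝ) 1) :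
    mob γ y ∈ Set.Icc (0:ℝ) 1 := by
  obtain ⟨d1, d2⟩ := h.den hy.1
  have h0 : (0 : ℝ) ≤ γ 0 0 := by exact_mod_cast h.h00
  have h1 : (0 : ℝ) ≤ γ 0 1 := by exact_mod_cast h.h01
  have r1 : (γ 0 1 : ℝ) ≤ γ 1 1 := by exact_mod_cast h.r1
  have r2 : (γ 0 0 : ℝ) + γ 0 1 ≤ γ 1 0 + γ 1 1 := by exact_mod_cast h.r2
  obtain ⟨hy0, hy1⟩ := hy
  constructor
  · unfold mob
    apply div_nonneg <;> nlinarith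
  · unfold mob
    rw [div_le_one (by linarith)]
    nlinarith

theorem PosM.mob_mul {γ η : Matrix (Fin 2) (Fin 2) ℤ} (h : PosM γ) (k : PosM η) {y : ℝ}
    (hy : y ∈ Set.Icc (0:ℝ) 1) : mob (γ * η) y = mob γ (mob η y) := by
  obtain ⟨d1, d2⟩ := k.den hy.1
  obtain ⟨d3, d4⟩ := (h.mul k).den hy.1
  obtain ⟨d5, d6⟩ := h.den (k.mob_mem hy).1
  have e1 : (η 1 0 : ℝ) * y + η 1 1 ≠ 0 := by linarith
  have e2 : ((γ * η) 1 0 : ℝ) * y + ((γ * η) 1 1 : ℤ) ≠ 0 := by linarith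
  have e3 : (γ 1 0 : ℝ) * mob η y + γ 1 1 ≠ 0 := by linarith
  have e4 : mob η y * ((η 1 0 : ℝ) * y + η 1 1) = (η 0 0 : ℝ) * y + η 0 1 := by
    unfold mob; exact div_mul_cancel₀ _ e1
  rw [mob, mob, div_eq_div_iff e2 e3]
  have : ((η 1 0 : ℝ) * y + η 1 1) * ((((γ * η) 0 0 : ℤ) * y + ((γ * η) 0 1 : ℤ)) * ((γ 1 0 : ℝ) * mob η y + γ 1 1)
      - (γ 0 0 * mob η y + γ 0 1) * (((γ * η) 1 0 : ℤ) * y + ((γ * η) 1 1 : ℤ))) = 0 := by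
    rw [mul00, mul01, mul10, mul11]
    push_cast
    set X := mob η y
    linear_combination ((((γ 0 0:ℝ) * η 0 0 + γ 0 1 * η 1 0) * y + (γ 0 0 * η 0 1 + γ 0 1 * η 1 1)) * γ 1 0 - γ 0 0 * ((γ 1 0 * η 0 0 + γ 1 1 * η 1 0) * y + (γ 1 0 * η 0 1 + γ 1 1 * η 1 1))) * e4
  rcases mul_eq_zero.1 this with h | h
  · exact absurd h e1
  · linarith

theorem PosM.mob_dist {γ : Matrix (Fin 2) (Fin 2) ℤ} (h : PosM γ) {y z : ℝ}
    (hy : y ∈ Set.Icc (0:ℝ) 1) (hz : z ∈ Set.Icc (0:ℝ) 1) :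
    |mob γ y - mob γ z| ≤ 1 / (γ 1 1 : ℝ) ^ 2 := by
  obtain ⟨d1, d2⟩ := h.den hy.1
  obtain ⟨d3, d4⟩ := h.den hz.1
  have hdet : |(γ 0 0 : ℝ) * γ 1 1 - γ 0 1 * γ 1 0| = 1 := by
    have : ((γ 0 0 : ℝ) * γ 1 1 - γ 0 1 * γ 1 0) ^ 2 = 1 := by exact_mod_cast h.det
    rw [← sq_abs] at this
    nlinarith [abs_nonneg ((γ 0 0 : ℝ) * γ 1 1 - γ 0 1 * γ 1 0)]
  have e : mob γ y - mob γ z = ((γ 0 0 : ℝ) * γ 1 1 - γ 0 1 * γ 1 0) * (y - z) /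
      (((γ 1 0 : ℝ) * y + γ 1 1) * ((γ 1 0 : ℝ) * z + γ 1 1)) := by
    have e1 : (γ 1 0 : ℝ) * y + γ 1 1 ≠ 0 := by linarith
    have e2 : (γ 1 0 : ℝ) * z + γ 1 1 ≠ 0 := by linarith
    unfold mob
    rw [div_sub_div _ _ e1 e2]
    congr 1; ring
  rw [e, abs_div, abs_mul, hdet, one_mul]
  have : |y - z| ≤ 1 := by
    rw [abs_le]; constructor <;> linarith [hy.1, hy.2, hz.1, hz.2]
  have hp : (0:ℝ) < ((γ 1 0 : ℝ) * y + γ 1 1) * ((γ 1 0 : ℝ) * z + γ 1 1) := by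
    apply mul_pos <;> linarith
  rw [abs_of_pos hp]
  gcongr
  rw [sq]
  apply mul_le_mul d1 d3 <;> linarith

/-- Product of the first `k` generators. -/
def PP (a : ℕ → ℕ) (k : ℕ) : Matrix (Fin 2) (Fin 2) ℤ := (((List.range k).map a).map cfGen).prod

theorem PP_zero (a : ℕ → ℕ) : PP a 0 = 1 := by simp [PP]

theorem PP_add (a : ℕ → ℕ) (k j : ℕ) : PP a (k + j) = PP a k * PP (fun i => a (k + i)) j := by
  simp [PP, List.range_add, Function.comp_def]

theorem PP_one (a : ℕ → ℕ) : PP a 1 = cfGen (a 0) := by simp [PP]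

theorem PP_two (a : ℕ → ℕ) : PP a 2 = cfGen (a 0) * cfGen (a 1) := by
  simp [PP, List.range_succ]

theorem PP_pos {a : ℕ → ℕ} (ha : ∀ n, 1 ≤ a n) (k : ℕ) : PosM (PP a k) := by
  induction k with
  | zero => rw [PP_zero]; exact posM_one
  | succ k ih =>
    rw [PP_add, PP_one]
    exact ih.mul (posM_gen (ha _))

/-- convergents -/
def cv (a : ℕ → ℕ) (k : ℕ) : ℝ := ((cfVal (List.ofFn fun i : Fin k => a i) : ℚ) : ℝ)

theorem cv_succ (a : ℕ → ℕ) (k : ℕ) : cv a (k + 1) = mob (cfGen (a 0)) (cv (fun i => a (1 + i)) k) := by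
  simp [cv, cfVal, mob, cfGen, List.ofFn_succ, add_comm]

theorem cv_mem {a : ℕ → ℕ} (ha : ∀ n, 1 ≤ a n) (k : ℕ) : cv a k ∈ Set.Icc (0:ℝ) 1 := by
  induction k generalizing a with
  | zero => simp [cv, cfVal]
  | succ k ih =>
    rw [cv_succ]
    exact (posM_gen (ha 0)).mob_mem (ih (fun n => ha _))

theorem cv_add {a : ℕ → ℕ} (ha : ∀ n, 1 ≤ a n) (k j : ℕ) :
    cv a (k + j) = mob (PP a k) (cv (fun i => a (k + i)) j) := by
  induction k generalizing a with
  | zero => simp [PP_zero, mob]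
  | succ k ih =>
    rw [add_right_comm, cv_succ, ih (fun n => ha _), add_comm k 1, PP_add, PP_one,
      PosM.mob_mul (posM_gen (ha 0)) (PP_pos (fun n => ha _) _) (cv_mem (fun n => ha _) _)]
    simp only [add_assoc]

theorem mem_mob {a : ℕ → ℕ} (ha : ∀ n, 1 ≤ a n) {x : ℝ}
    (hx : Tendsto (cv a) atTop (nhds x)) (k : ℕ) : x ∈ mob (PP a k) '' Set.Icc (0:ℝ) 1 := by
  have hc : IsClosed (mob (PP a k) '' Set.Icc (0:ℝ) 1) := by
    apply IsCompact.isClosed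
    apply isCompact_Icc.image_of_continuousOn
    unfold mob
    apply ContinuousOn.div (by fun_prop) (by fun_prop)
    intro y hy
    obtain ⟨d1, d2⟩ := (PP_pos ha k).den hy.1
    linarith
  apply hc.mem_of_tendsto hx
  filter_upwards [eventually_ge_atTop k] with n hn
  obtain ⟨j, rfl⟩ := Nat.exists_eq_add_of_le hn
  rw [cv_add ha]
  exact ⟨_, cv_mem (fun n => ha _) j, rfl⟩

theorem gamma_mul {A : ℕ} {γ η : Matrix (Fin 2) (Fin 2) ℤ} (h : inGammaA A γ) (k : inGammaA A η) :
    inGammaA A (γ * η) := by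
  obtain ⟨l, h1, h2, h3, rfl⟩ := h
  obtain ⟨m, k1, k2, k3, rfl⟩ := k
  refine ⟨l ++ m, by simp; omega, by simp; omega, ?_, by simp⟩
  intro a ha
  rcases List.mem_append.1 ha with h | h
  · exact h3 a h
  · exact k3 a h

theorem big_list : ∀ (n : ℕ) (l : List ℕ), l.length = 2 * (n + 1) → (∀ a ∈ l, 1 ≤ a) →
    BigM (l.map cfGen).prod := by
  intro n
  induction n with
  | zero =>
    intro l hl h
    match l, hl with
    | [a, b], _ =>
      simp only [List.map_cons, List.map_nil, List.prod_cons, List.prod_nil, mul_one]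
      exact bigM_pair (h a (by simp)) (h b (by simp))
  | succ n ih =>
    intro l hl h
    match l, hl with
    | a :: b :: l, hl =>
      simp only [List.map_cons, List.prod_cons, ← mul_assoc]
      refine (bigM_pair (h a (by simp)) (h b (by simp))).mul (ih l ?_ ?_)
      · simp at hl; omega
      · intro c hc; exact h c (by simp [hc])

theorem gamma_big {A : ℕ} {γ : Matrix (Fin 2) (Fin 2) ℤ} (h : inGammaA A γ) : BigM γ := by
  obtain ⟨l, h1, h2, h3, rfl⟩ := h
  exact big_list (l.length / 2 - 1) l (by omega) (fun a ha => (h3 a ha).1)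

theorem PP_gamma {A : ℕ} {a : ℕ → ℕ} (ha : ∀ n, 1 ≤ a n ∧ a n ≤ A) {m : ℕ} (hm : 1 ≤ m) :
    inGammaA A (PP a (2 * m)) := by
  refine ⟨(List.range (2 * m)).map a, by simp; omega, by simp, ?_, rfl⟩
  intro b hb
  obtain ⟨i, -, rfl⟩ := List.mem_map.1 hb
  exact ha i

/-- The stopping set. -/
def TT (A : ℕ) (R : ℝ) : Set (Matrix (Fin 2) (Fin 2) ℤ) :=
  {γ | inGammaA A γ ∧ R ≤ γ 1 1 ∧ (γ 1 1 : ℝ) < ((A:ℝ) + 1) ^ 2 * R}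

theorem fin_bdd (B : ℤ) : {γ : Matrix (Fin 2) (Fin 2) ℤ | ∀ i j, |γ i j| ≤ B}.Finite := by
  apply (Set.finite_Icc (α := Fin 2 → Fin 2 → ℤ) (fun _ _ => -B) (fun _ _ => B)).subset
  intro γ hγ
  exact ⟨fun i j => (abs_le.1 (hγ i j)).1, fun i j => (abs_le.1 (hγ i j)).2⟩

theorem TT_fin (A : ℕ) (R : ℝ) : (TT A R).Finite := by
  apply (fin_bdd ⌈((A:ℝ) + 1) ^ 2 * R⌉).subset
  rintro γ ⟨h, -, h2⟩
  have h3 : γ 1 1 ≤ ⌈((A:ℝ) + 1) ^ 2 * R⌉ := by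
    have := h2.trans_le (Int.le_ceil _)
    exact_mod_cast this.le
  obtain ⟨a1, a2, a3, a4, a5, a6, a7⟩ := gamma_big h
  intro i j
  rw [abs_le]
  fin_cases i <;> fin_cases j <;> simp <;> constructor <;> linarith

theorem hit {A : ℕ} {R : ℝ} (hR : 1 < R) {a : ℕ → ℕ} (ha : ∀ n, 1 ≤ a n ∧ a n ≤ A) :
    ∃ m, 1 ≤ m ∧ PP a (2 * m) ∈ TT A R := by
  have ha1 : ∀ n, 1 ≤ a n := fun n => (ha n).1
  have grow : ∀ m, (2:ℤ) ^ m ≤ PP a (2 * m) 1 1 := by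
    intro m
    induction m with
    | zero => simp [PP_zero]
    | succ m ih =>
      rw [mul_add, mul_one, PP_add, PP_two, mul11, pow_succ]
      have b := bigM_pair (ha1 (2 * m + 0)) (ha1 (2 * m + 1))
      have p := PP_pos ha1 (2 * m)
      have := b.pos.h01
      have := b.h11
      have := p.h10
      have : 0 ≤ PP a (2 * m) 1 0 * (cfGen (a (2 * m + 0)) * cfGen (a (2 * m + 1))) 0 1 := by
        positivity
      have : (0:ℤ) < 2 ^ m := by positivity
      nlinarith
  have ex : ∃ m, R ≤ (PP a (2 * m) 1 1 : ℝ) := by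
    obtain ⟨m, hm⟩ := pow_unbounded_of_one_lt R (one_lt_two)
    refine ⟨m, hm.le.trans ?_⟩
    exact_mod_cast grow m
  classical
  have h1 := Nat.find_spec ex
  have hne : Nat.find ex ≠ 0 := by
    intro h0
    rw [h0] at h1
    simp [PP_zero] at h1
    linarith
  obtain ⟨m, hm⟩ := Nat.exists_eq_succ_of_ne_zero hne
  have h2 := Nat.find_min ex (m := m) (by omega)
  rw [hm] at h1
  refine ⟨m + 1, by omega, PP_gamma ha (by omega), h1, ?_⟩
  push Not at h2
  have key : PP a (2 * (m + 1)) 1 1 ≤ ((A:ℤ) + 1) ^ 2 * PP a (2 * m) 1 1 := by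
    rw [mul_add, mul_one, PP_add, PP_two, mul11]
    have p := PP_pos ha1 (2 * m)
    have hc : PP a (2 * m) 1 0 ≤ PP a (2 * m) 1 1 := by
      rcases Nat.eq_zero_or_pos m with h | h
      · subst h; simp [PP_zero]
      · exact (gamma_big (PP_gamma ha h)).c2
    have e1 : (cfGen (a (2 * m + 0)) * cfGen (a (2 * m + 1))) 0 1 ≤ A := by
      simp [cfGen]; exact (ha _).2
    have e2 : (cfGen (a (2 * m + 0)) * cfGen (a (2 * m + 1))) 1 1 ≤ 1 + (A:ℤ) * A := by
      simp [cfGen]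
      have := (ha (2 * m)).2
      have := (ha (2 * m + 1)).2
      gcongr
    have e0 := (bigM_pair (ha1 (2 * m + 0)) (ha1 (2 * m + 1))).pos.h01
    have := p.h10
    have := p.h11
    calc _ ≤ PP a (2 * m) 1 1 * A + PP a (2 * m) 1 1 * (1 + (A:ℤ) * A) := by gcongr
      _ ≤ _ := by nlinarith [mul_nonneg (show (0:ℤ) ≤ A by positivity) (show 0 ≤ PP a (2 * m) 1 1 by linarith)]
  have key' : (PP a (2 * (m + 1)) 1 1 : ℝ) ≤ ((A:ℝ) + 1) ^ 2 * PP a (2 * m) 1 1 := by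
    exact_mod_cast key
  calc _ ≤ _ := key'
    _ < _ := by gcongr

theorem hit_pow {A : ℕ} {R : ℝ} (hR : 1 < R) (T : Finset (Matrix (Fin 2) (Fin 2) ℤ))
    (hT : ∀ γ, γ ∈ T ↔ γ ∈ TT A R) (n : ℕ) {a : ℕ → ℕ} (ha : ∀ n, 1 ≤ a n ∧ a n ≤ A) :
    ∃ k, PP a k ∈ T ^ n := by
  induction n generalizing a with
  | zero => exact ⟨0, by simp [PP_zero]⟩
  | succ n ih =>
    obtain ⟨m, -, hm⟩ := hit hR ha
    obtain ⟨k, hk⟩ := ih (a := fun i => a (2 * m + i)) (fun i => ha _)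
    refine ⟨2 * m + k, ?_⟩
    rw [PP_add, pow_succ']
    exact Finset.mul_mem_mul ((hT _).2 hm) hk

theorem pow_pos' {A : ℕ} {R : ℝ} (hR : 1 < R) (T : Finset (Matrix (Fin 2) (Fin 2) ℤ))
    (hT : ∀ γ, γ ∈ T ↔ γ ∈ TT A R) (n : ℕ) : ∀ γ ∈ T ^ n, PosM γ ∧ R ^ n ≤ (γ 1 1 : ℝ) := by
  induction n with
  | zero =>
    intro γ hγ
    simp at hγ
    subst hγ
    exact ⟨posM_one, by simp⟩
  | succ n ih =>
    intro γ hγ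
    rw [pow_succ', Finset.mem_mul] at hγ
    obtain ⟨η, h1, ζ, h2, rfl⟩ := hγ
    obtain ⟨i1, i2⟩ := ih ζ h2
    obtain ⟨j1, j2, -⟩ := (hT _).1 h1
    have p := (gamma_big j1).pos
    refine ⟨p.mul i1, ?_⟩
    rw [mul11, pow_succ']
    push_cast
    have : (0:ℝ) ≤ η 1 0 := by exact_mod_cast p.h10
    have : (0:ℝ) ≤ ζ 0 1 := by exact_mod_cast i1.h01
    have : (0:ℝ) ≤ η 1 1 := by linarith
    have : R * R ^ n ≤ η 1 1 * ζ 1 1 := by gcongr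
    nlinarith [mul_nonneg ‹(0:ℝ) ≤ η 1 0› ‹(0:ℝ) ≤ ζ 0 1›]

theorem hdim_le_one (A : ℕ) : dimH (cantorA A) ≤ 1 := by
  have := dimH_mono (Set.subset_univ (cantorA A))
  rwa [Real.dimH_univ] at this

theorem TT_card {A : ℕ} (hA : 2 ≤ A) {R : ℝ} (hR : 1 < R) :
    R ^ (2 * hdimA A) ≤ ((TT A R).ncard : ℝ) := by
  classical
  set T := (TT_fin A R).toFinset with hTdef
  have hT : ∀ γ, γ ∈ T ↔ γ ∈ TT A R := fun γ => by simp [hTdef]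
  have hcard : (TT A R).ncard = T.card := Set.ncard_eq_toFinset_card _ _
  rw [hcard]
  have hpos : 1 ≤ T.card := by
    obtain ⟨m, -, hm⟩ := hit (A := A) hR (a := fun _ => 1) (fun _ => ⟨le_rfl, by omega⟩)
    exact Finset.card_pos.2 ⟨_, (hT _).2 hm⟩
  have hposR : (1:ℝ) ≤ T.card := by exact_mod_cast hpos
  have hlog : 0 < Real.log R := Real.log_pos hR
  set s : ℝ := Real.log T.card / (2 * Real.log R) with hs
  have hs0 : 0 ≤ s := div_nonneg (Real.log_nonneg hposR) (by positivity)
  have hRs : R ^ (2 * s) = T.card := by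
    rw [Real.rpow_def_of_pos (by linarith), hs]
    rw [show Real.log R * (2 * (Real.log T.card / (2 * Real.log R))) = Real.log T.card by
      field_simp]
    exact Real.exp_log (by linarith)
  have hdim : hdimA A ≤ s := by
    have hH : μH[s] (cantorA A) ≤ 1 := by
      have hr : Tendsto (fun n : ℕ => ENNReal.ofReal ((1 / R ^ 2) ^ n)) atTop (nhds 0) := by
        rw [← ENNReal.ofReal_zero]
        apply ENNReal.tendsto_ofReal
        apply tendsto_pow_atTop_nhds_zero_of_lt_one (by positivity)
        rw [div_lt_one (by positivity)]
        nlinarith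
      have hd : ∀ n : ℕ, ∀ j : ↥(T ^ n), Metric.ediam (mob j.1 '' Set.Icc (0:ℝ) 1) ≤
          ENNReal.ofReal ((1 / R ^ 2) ^ n) := by
        intro n j
        obtain ⟨p, hp⟩ := pow_pos' hR T hT n j.1 j.2
        apply Metric.ediam_le
        rintro _ ⟨y, hy, rfl⟩ _ ⟨z, hz, rfl⟩
        rw [edist_dist, Real.dist_eq]
        apply ENNReal.ofReal_le_ofReal
        refine (p.mob_dist hy hz).trans ?_
        rw [div_pow, one_pow, ← pow_mul, mul_comm, pow_mul]
        have : 0 < R ^ n := by positivity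
        gcongr
      have := MeasureTheory.Measure.hausdorffMeasure_le_liminf_sum s (cantorA A)
        (fun n : ℕ => ENNReal.ofReal ((1 / R ^ 2) ^ n)) hr
        (fun n (j : ↥(T ^ n)) => mob j.1 '' Set.Icc (0:ℝ) 1)
        (Eventually.of_forall hd) (Eventually.of_forall ?_)
      · refine this.trans ?_
        apply Filter.liminf_le_of_le (by isBoundedDefault)
        intro b hb
        obtain ⟨n, hn⟩ := hb.exists
        refine hn.trans ?_
        calc _ ≤ ∑ j : ↥(T ^ n), ENNReal.ofReal ((1 / R ^ 2) ^ n) ^ s := by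
              gcongr with j
              exact hd n j
          _ = ((T ^ n).card : ENNReal) * ENNReal.ofReal ((1 / R ^ 2) ^ n) ^ s := by simp
          _ ≤ (T.card : ENNReal) ^ n * ENNReal.ofReal ((1 / R ^ 2) ^ n) ^ s := by
              gcongr
              exact_mod_cast Finset.card_pow_le
          _ = 1 := by
              rw [ENNReal.ofReal_rpow_of_nonneg (by positivity) hs0, ← ENNReal.ofReal_natCast,
                ← ENNReal.ofReal_pow (by positivity), ← ENNReal.ofReal_mul (by positivity)]
              rw [← ENNReal.ofReal_one]
              congr 1
              rw [← hRs, Real.rpow_mul (by linarith), ← Real.rpow_natCast, ← Real.rpow_mul (by positivity),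
                mul_comm s, Real.rpow_mul (by positivity), ← Real.mul_rpow (by positivity) (by positivity)]
              have : R ≠ 0 := by linarith
              rw [Real.rpow_natCast, Real.rpow_ofNat, ← mul_pow]
              rw [mul_one_div_cancel (by positivity)]
              simp
      · intro n x hxc
        obtain ⟨-, -, -, a, ha, hx⟩ := hxc
        obtain ⟨k, hk⟩ := hit_pow hR T hT n ha
        exact Set.mem_iUnion.2 ⟨⟨_, hk⟩, mem_mob (fun n => (ha n).1) hx k⟩
    have h2 : dimH (cantorA A) ≤ (s.toNNReal : ENNReal) := by
      apply dimH_le_of_hausdorffMeasure_ne_top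
      rw [Real.coe_toNNReal _ hs0]
      exact ne_top_of_le_ne_top ENNReal.one_ne_top hH
    unfold hdimA
    apply ENNReal.toReal_le_of_le_ofReal hs0
    exact h2
  rw [← hRs]
  exact Real.rpow_le_rpow_of_exponent_le hR.le (by linarith)

theorem slope_mem {γ η : Matrix (Fin 2) (Fin 2) ℤ} (h : BigM γ) (k : BigM η) :
    vslope (vPlus (γ * η)) ∈ mob γ '' Set.Icc (0:ℝ) 1 := by
  have hm := h.mul k
  have aux : ∀ ζ : Matrix (Fin 2) (Fin 2) ℤ, BigM ζ →
      0 < lamPlus ζ - ζ 0 0 ∧ 0 < lamPlus ζ ∧ vslope (vPlus ζ) = ζ 0 1 / (lamPlus ζ - ζ 0 0) ∧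
      lamPlus ζ ^ 2 - (ζ 0 0 + ζ 1 1) * lamPlus ζ + 1 = 0 := by
    intro ζ hz
    have a1 : (1:ℝ) ≤ ζ 0 0 := by exact_mod_cast hz.h00
    have a2 : (2:ℝ) ≤ ζ 1 1 := by exact_mod_cast hz.h11
    have a3 : (ζ 0 0:ℝ) ≤ ζ 1 1 := by exact_mod_cast hz.r1.trans hz.c2
    have t3 : trR ζ = ζ 0 0 + ζ 1 1 := by unfold trR; push_cast; ring
    have hs : 0 < trR ζ ^ 2 - 4 := by rw [t3]; nlinarith
    have hq := Real.sqrt_pos.2 hs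
    have hq2 := Real.sq_sqrt hs.le
    have p1 : 0 < lamPlus ζ - ζ 0 0 := by unfold lamPlus; linarith
    refine ⟨p1, by linarith, ?_, ?_⟩
    · have hb : 0 < Real.sqrt ((ζ 0 1 : ℝ) ^ 2 + (lamPlus ζ - (ζ 0 0 : ℝ)) ^ 2) := by
        apply Real.sqrt_pos.2; positivity
      simp only [vslope, vPlus]
      rw [div_div_div_cancel_right₀ hb.ne']
      simp
    · rw [← t3]; unfold lamPlus; linear_combination hq2 / 4
  obtain ⟨p1, p2, p3, p4⟩ := aux _ hm
  set l := lamPlus (γ * η)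
  have hb0 : (1:ℝ) ≤ (γ * η) 0 1 := by exact_mod_cast hm.h00.trans hm.c1
  set z := vslope (vPlus (γ * η)) with hz
  have hz0 : 0 < z := by rw [p3]; positivity
  have hfix : z * (l - (γ * η) 0 0) = (γ * η) 0 1 := by rw [p3]; field_simp
  -- second coordinate eigen equation
  have hdet : ((γ * η) 0 0 : ℝ) * (γ * η) 1 1 - (γ * η) 0 1 * (γ * η) 1 0 = 1 := by
    exact_mod_cast hm.det
  have hfix2 : (γ * η) 1 0 * z + (γ * η) 1 1 = l := by
    have : ((γ * η) 0 1 : ℝ) ≠ 0 := by linarith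
    have h2 : (l - (γ * η) 0 0) * ((γ * η) 1 0 * z + (γ * η) 1 1 - l) = 0 := by
      linear_combination ((γ * η) 1 0 : ℝ) * hfix - p4 - hdet
    rcases mul_eq_zero.1 h2 with h | h
    · linarith
    · linarith
  have hy : mob η z ∈ Set.Icc (0:ℝ) 1 := by
    have b1 : (1:ℝ) ≤ η 0 0 := by exact_mod_cast k.h00
    have b2 : (η 0 0:ℝ) ≤ η 0 1 := by exact_mod_cast k.c1
    have b3 : (η 0 0:ℝ) ≤ η 1 0 := by exact_mod_cast k.r1
    have b4 : (η 0 1:ℝ) ≤ η 1 1 := by exact_mod_cast k.r2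
    constructor
    · unfold mob; apply div_nonneg <;> nlinarith
    · unfold mob; rw [div_le_one (by nlinarith)]; nlinarith
  refine ⟨mob η z, hy, ?_⟩
  obtain ⟨d1, d2⟩ := k.pos.den hz0.le
  have e1 : (η 1 0 : ℝ) * z + η 1 1 ≠ 0 := by linarith
  obtain ⟨d3, d4⟩ := h.pos.den hy.1
  have e4 : mob η z * ((η 1 0 : ℝ) * z + η 1 1) = (η 0 0 : ℝ) * z + η 0 1 := by
    unfold mob; exact div_mul_cancel₀ _ e1
  set Y := mob η z
  unfold mob
  rw [div_eq_iff (by linarith)]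
  rw [mul00, mul01] at hfix
  rw [mul10, mul11] at hfix2
  push_cast at hfix hfix2
  apply mul_left_cancel₀ e1
  linear_combination ((γ 0 0 : ℝ) - z * γ 1 0) * e4 - hfix - z * hfix2

theorem frob_le {γ : Matrix (Fin 2) (Fin 2) ℤ} (h : BigM γ) : frob γ ≤ 2 * γ 1 1 := by
  have a1 : (1:ℝ) ≤ γ 0 0 := by exact_mod_cast h.h00
  have b2 : (γ 0 0:ℝ) ≤ γ 0 1 := by exact_mod_cast h.c1
  have b3 : (γ 0 0:ℝ) ≤ γ 1 0 := by exact_mod_cast h.r1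
  have b4 : (γ 0 1:ℝ) ≤ γ 1 1 := by exact_mod_cast h.r2
  have b5 : (γ 1 0:ℝ) ≤ γ 1 1 := by exact_mod_cast h.c2
  unfold frob
  apply Real.sqrt_le_iff.2
  constructor
  · linarith
  · nlinarith

theorem frob_abs {γ : Matrix (Fin 2) (Fin 2) ℤ} {N : ℕ} (h : frob γ < N) : ∀ i j, |γ i j| ≤ (N:ℤ) := by
  have hN : (0:ℝ) < N := lt_of_le_of_lt (Real.sqrt_nonneg _) h
  unfold frob at h
  rw [Real.sqrt_lt' hN] at h
  have : ∀ i j, |(γ i j : ℝ)| ≤ N := by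
    intro i j
    apply abs_le_of_sq_le_sq _ hN.le
    fin_cases i <;> fin_cases j <;> simp <;> nlinarith [sq_nonneg (γ 0 0 : ℝ), sq_nonneg (γ 0 1 : ℝ), sq_nonneg (γ 1 0 : ℝ), sq_nonneg (γ 1 1 : ℝ)]
  intro i j
  exact_mod_cast this i j

theorem count_bound {A : ℕ} (hA : 2 ≤ A) {x : ℝ} (hx : x ∈ cantorA A) (N : ℕ)
    (hlog : 1 ≤ Real.log N)
    (hR : 1 < (N:ℝ) / (4 * ((A:ℝ) + 1) ^ 4 * Real.sqrt (2 * Real.log N))) :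
    ((N:ℝ) / (4 * ((A:ℝ) + 1) ^ 4 * Real.sqrt (2 * Real.log N))) ^ (2 * hdimA A) ≤
      (Set.ncard {γ : Matrix (Fin 2) (Fin 2) ℤ |
            inGammaA A γ ∧ frob γ < (N : ℝ) ∧
            |vslope (vPlus γ) - x| < 1 / Real.log (N : ℝ)} : ℝ) := by
  set L := Real.sqrt (2 * Real.log N) with hL
  set R := (N:ℝ) / (4 * ((A:ℝ) + 1) ^ 4 * L) with hRd
  have hL2 : L ^ 2 = 2 * Real.log N := Real.sq_sqrt (by linarith)
  have hL1 : 1 < L := by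
    rw [hL]; apply Real.lt_sqrt_of_sq_lt; linarith
  obtain ⟨-, -, -, a, ha, hxt⟩ := hx
  obtain ⟨m, hm, hu, hu1, hu2⟩ := hit hL1 ha
  set u := PP a (2 * m) with hud
  have ub := gamma_big hu
  have hxm : x ∈ mob u '' Set.Icc (0:ℝ) 1 := mem_mob (fun n => (ha n).1) hxt _
  refine (TT_card hA hR).trans ?_
  have hinj : Function.Injective (fun γ : Matrix (Fin 2) (Fin 2) ℤ => u * γ) := by
    have hdet : u.det = 1 := by rw [Matrix.det_fin_two]; exact ub.det
    have hun : IsUnit u := by rw [Matrix.isUnit_iff_isUnit_det, hdet]; exact isUnit_one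
    exact hun.mul_right_injective
  rw [← Set.ncard_image_of_injective (TT A R) hinj]
  norm_cast
  apply Set.ncard_le_ncard
  · rintro _ ⟨v, ⟨hv, hv1, hv2⟩, rfl⟩
    have vb := gamma_big hv
    refine ⟨gamma_mul hu hv, ?_, ?_⟩
    · refine (frob_le (ub.mul vb)).trans_lt ?_
      have e1 : ((u * v) 1 1 : ℝ) ≤ 2 * (u 1 1 * v 1 1) := by
        rw [mul11]; push_cast
        have b4 : (v 0 1:ℝ) ≤ v 1 1 := by exact_mod_cast vb.r2
        have b5 : (u 1 0:ℝ) ≤ u 1 1 := by exact_mod_cast ub.c2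
        have b6 : (0:ℝ) ≤ v 0 1 := by exact_mod_cast vb.pos.h01
        have b7 : (0:ℝ) ≤ u 1 1 := by linarith
        have : (u 1 0:ℝ) * v 0 1 ≤ u 1 1 * v 1 1 := by gcongr
        linarith
      have e2 : (u 1 1 * v 1 1 : ℝ) < (((A:ℝ) + 1) ^ 2 * L) * (((A:ℝ) + 1) ^ 2 * R) := by
        apply mul_lt_mul'' hu2 hv2 <;> linarith
      have e3 : 4 * ((((A:ℝ) + 1) ^ 2 * L) * (((A:ℝ) + 1) ^ 2 * R)) = N := by
        rw [hRd]
        have : L ≠ 0 := by linarith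
        field_simp
      linarith
    · obtain ⟨y, hy, hye⟩ := slope_mem ub vb
      obtain ⟨w, hw, rfl⟩ := hxm
      rw [← hye]
      refine (ub.pos.mob_dist hy hw).trans_lt ?_
      apply one_div_lt_one_div_of_lt (by linarith)
      nlinarith
  · apply (fin_bdd N).subset
    rintro γ ⟨-, h, -⟩
    exact frob_abs h

theorem density_point_direction_count (A : ℕ) (hA : 2 ≤ A) (x : ℝ) (hx : x ∈ cantorA A)
    (hdens : ∀ ε : ℝ, 0 < ε → ∃ r₀ : ℝ, 0 < r₀ ∧ ∀ r : ℝ, 0 < r → r < r₀ →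
      ENNReal.ofReal (r ^ (hdimA A + ε)) ≤
        ((μH[hdimA A]).restrict (cantorA A)) (Set.Ioo (x - r) (x + r))) :
    ∃ c : ℝ, 0 < c ∧ ∃ N₀ : ℕ, ∀ N : ℕ, N₀ ≤ N →
      c * (N : ℝ) ^ (2 * hdimA A) / Real.log (N : ℝ) ≤
        (Set.ncard {γ : Matrix (Fin 2) (Fin 2) ℤ |
            inGammaA A γ ∧ frob γ < (N : ℝ) ∧
            |vslope (vPlus γ) - x| < 1 / Real.log (N : ℝ)} : ℝ) := by
  have hδ0 : 0 ≤ hdimA A := ENNReal.toReal_nonneg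
  have hδ1 : hdimA A ≤ 1 := by
    apply ENNReal.toReal_le_of_le_ofReal zero_le_one
    simpa using hdim_le_one A
  set K : ℝ := 4 * ((A:ℝ) + 1) ^ 4 with hK
  have hK1 : 1 ≤ K := by
    have : (1:ℝ) ≤ ((A:ℝ) + 1) ^ 4 := one_le_pow₀ (by linarith [show (0:ℝ) ≤ A by positivity])
    linarith
  have hlogT : Tendsto (fun N : ℕ => Real.log N) atTop atTop :=
    Real.tendsto_log_atTop.comp tendsto_natCast_atTop_atTop
  have hlil : ∀ᶠ N : ℕ in atTop, ‖Real.log N‖ ≤ (1 / (4 * K)) * ‖(N:ℝ)‖ :=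
    tendsto_natCast_atTop_atTop.eventually
      (Real.isLittleO_log_id_atTop.def (c := 1 / (4 * K)) (by positivity))
  obtain ⟨N₀, hN₀⟩ := eventually_atTop.1 ((hlogT.eventually_ge_atTop 1).and
    (hlil.and (eventually_ge_atTop 1)))
  refine ⟨1 / (2 * K ^ 2), by positivity, N₀, fun N hN => ?_⟩
  obtain ⟨h1, h2, h3⟩ := hN₀ N hN
  have hNp : (0:ℝ) < N := by exact_mod_cast h3
  rw [Real.norm_of_nonneg (by linarith), Real.norm_of_nonneg hNp.le] at h2
  have hsq2 : Real.sqrt (2 * Real.log N) ^ 2 = 2 * Real.log N := Real.sq_sqrt (by linarith)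
  have hsq1 : 1 ≤ Real.sqrt (2 * Real.log N) := Real.one_le_sqrt.2 (by linarith)
  set L := Real.sqrt (2 * Real.log N)
  have hLle : L ≤ 2 * Real.log N := by nlinarith
  have hR : 1 < (N:ℝ) / (K * L) := by
    rw [one_lt_div (by positivity)]
    have : K * Real.log N ≤ N / 4 := by
      calc K * Real.log N ≤ K * (1 / (4 * K) * N) := by gcongr
        _ = N / 4 := by field_simp
    nlinarith
  refine le_trans ?_ (count_bound hA hx N h1 hR)
  rw [Real.div_rpow hNp.le (by positivity)]
  have e : (K * L) ^ (2 * hdimA A) ≤ 2 * K ^ 2 * Real.log N := by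
    rw [Real.rpow_mul (by positivity), Real.rpow_ofNat, mul_pow, hsq2]
    calc _ ≤ (K ^ 2 * (2 * Real.log N)) ^ (1:ℝ) := by
          apply Real.rpow_le_rpow_of_exponent_le _ hδ1
          nlinarith [one_le_pow₀ hK1 (n := 2)]
      _ = _ := by rw [Real.rpow_one]; ring
  calc _ = (N:ℝ) ^ (2 * hdimA A) / (2 * K ^ 2 * Real.log N) := by
        field_simp
    _ ≤ _ := by gcongr
end

section
/- For every C₀ ≥ 1 there exists C > 0 such that the following holds. Let X ≥ Y ≥ 1 be reals, q ≥ 1 an integer and K ≥ 1 a real with (qK)^{13/5} ≤ Y, and let η, η' ∈ ℤ² be primitive vectors (coordinates coprime) with C₀⁻¹·X/Y ≤ |η| ≤ C₀·X/Y and C₀⁻¹·Y ≤ |η'| ≤ C₀·Y. Then #{γ ∈ SL₂(ℤ) : C₀⁻¹·Y ≤ ‖γ‖ ≤ C₀·Y, |γη − η'| < X/(YK), and γη ≡ η' (mod q)} ≤ C·(Y/(qK))². -/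
/-- The Euclidean norm of an integer vector in `ℤ²`. -/
noncomputable def enormZ (v : Fin 2 → ℤ) : ℝ :=
  Real.sqrt (((v 0 : ℝ)) ^ 2 + ((v 1 : ℝ)) ^ 2)

theorem aux_core {α : Type*} [DecidableEq α] (S : Finset α) (a b c d : α → ℤ) (M B : ℕ)
    (inj : ∀ p ∈ S, ∀ r ∈ S, a p = a r → b p = b r → c p = c r → d p = d r → p = r)
    (hdet : ∀ p ∈ S, a p * d p - b p * c p = 1)
    (hle : ∀ p ∈ S, c p ^ 2 + d p ^ 2 ≤ a p ^ 2 + b p ^ 2)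
    (hB : ∀ p ∈ S, |b p| ≤ B)
    (hM : ∀ p ∈ S, ∀ r ∈ S, b p = b r → a p - a r ≤ M) :
    S.card ≤ 5 * (M + 1) * (2 * B + 1) := by
  have h1 : S.card ≤ 5 * (M + 1) * (Finset.Icc (-(B : ℤ)) B).card := by
    apply Finset.card_le_mul_card_image_of_maps_to (f := b)
    · intro p hp
      have := abs_le.1 (hB p hp)
      simp only [Finset.coe_Icc, Set.mem_Icc, Finset.mem_Icc]
      exact this
    intro b0 _
    rcases (S.filter (fun p => b p = b0)).eq_empty_or_nonempty with he | hne
    · rw [he]; simp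
    obtain ⟨m, hm, hmin⟩ := Finset.exists_min_image _ a hne
    rw [Finset.mem_filter] at hm
    have h2 : (S.filter (fun p => b p = b0)).card ≤
        5 * (Finset.Icc (a m) (a m + M)).card := by
      apply Finset.card_le_mul_card_image_of_maps_to (f := a)
      · intro p hp
        have h3 := hmin p hp
        have hp' := Finset.mem_filter.1 hp
        have h4 := hM p hp'.1 m hm.1 (hp'.2.trans hm.2.symm)
        simp only [Finset.coe_Icc, Set.mem_Icc, Finset.mem_Icc]
        constructor <;> linarith
      intro a0 _
      rcases ((S.filter (fun p => b p = b0)).filter (fun p => a p = a0)).eq_empty_or_nonempty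
        with he | ⟨p0, hp0⟩
      · rw [he]; simp
      simp only [Finset.mem_filter] at hp0
      obtain ⟨⟨hp0, hb0⟩, ha0⟩ := hp0
      have key : ∀ p ∈ S, b p = b0 → a p = a0 →
          c p - c p0 = (d p0 * c p - c p0 * d p) * a0 ∧
          d p - d p0 = (d p0 * c p - c p0 * d p) * b0 := by
        intro p hp hb ha
        have e1 := hdet p hp
        have e2 := hdet p0 hp0
        rw [hb, ha] at e1
        rw [hb0, ha0] at e2
        constructor
        · linear_combination (-c p) * e2 + c p0 * e1
        · linear_combination (-d p) * e2 + d p0 * e1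
      have h5 : (Finset.Icc (-2 : ℤ) 2).card = 5 := by decide
      rw [← h5]
      apply Finset.card_le_card_of_injOn (fun p => d p0 * c p - c p0 * d p)
      · intro p hp
        simp only [Finset.coe_filter, Set.mem_ofPred_eq, Finset.mem_filter] at hp
        obtain ⟨⟨hp, hb⟩, ha⟩ := hp
        obtain ⟨k1, k2⟩ := key p hp hb ha
        have e1 := hdet p hp
        have l1 := hle p hp
        have l2 := hle p0 hp0
        rw [hb, ha] at e1 l1
        rw [hb0, ha0] at l2
        simp only [Finset.coe_Icc, Set.mem_Icc]
        generalize d p0 * c p - c p0 * d p = t at *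
        have hpos : 0 < a0 ^ 2 + b0 ^ 2 := by
          by_contra hcon
          have za : a0 = 0 := by nlinarith [sq_nonneg a0, sq_nonneg b0]
          have zb : b0 = 0 := by nlinarith [sq_nonneg a0, sq_nonneg b0]
          rw [za, zb] at e1
          simp at e1
        have ht : t ^ 2 * (a0 ^ 2 + b0 ^ 2) ≤ 4 * (a0 ^ 2 + b0 ^ 2) := by
          have : t ^ 2 * (a0 ^ 2 + b0 ^ 2) = (c p - c p0) ^ 2 + (d p - d p0) ^ 2 := by
            rw [k1, k2]; ring
          rw [this]
          nlinarith [sq_nonneg (c p + c p0), sq_nonneg (d p + d p0)]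
        have ht2 : t ^ 2 ≤ 4 := le_of_mul_le_mul_right ht hpos
        constructor <;> nlinarith
      · intro p hp r hr hpr
        simp only [Finset.coe_filter, Set.mem_ofPred_eq, Finset.mem_filter] at hp hr
        obtain ⟨⟨hp, hb⟩, ha⟩ := hp
        obtain ⟨⟨hr, hb'⟩, ha'⟩ := hr
        obtain ⟨k1, k2⟩ := key p hp hb ha
        obtain ⟨k3, k4⟩ := key r hr hb' ha'
        simp only at hpr
        rw [hpr] at k1 k2
        exact inj p hp r hr (ha.trans ha'.symm) (hb.trans hb'.symm) (by linarith) (by linarith)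
    rw [Int.card_Icc] at h2
    have : (a m + M + 1 - a m).toNat = M + 1 := by omega
    rwa [this] at h2
  rw [Int.card_Icc] at h1
  have : ((B : ℤ) + 1 - (-(B : ℤ))).toNat = 2 * B + 1 := by omega
  rwa [this] at h1

theorem aux_strip (C x y n w : ℝ) (a b a' b' : ℤ) (hn : 0 < n) (hC : 1 ≤ C)
    (hxy : x ^ 2 + y ^ 2 = n ^ 2) (h : y ^ 2 ≤ x ^ 2)
    (h1 : |a * x + b * y - w| ≤ C * n) (h2 : |a' * x + b' * y - w| ≤ C * n) (hb : b = b') :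
    a - a' ≤ (⌊4 * C⌋₊ : ℤ) := by
  subst hb
  have hx : n ≤ 2 * |x| := by
    apply le_of_sq_le_sq _ (by positivity) 
    rw [mul_pow, sq_abs]; nlinarith
  have hx0 : 0 < |x| := by linarith
  have h3 : |((a : ℝ) - a') * x| ≤ 2 * (C * n) := by
    have : ((a : ℝ) - a') * x = (a * x + b * y - w) - (a' * x + b * y - w) := by ring
    rw [this]
    exact (abs_sub _ _).trans (by linarith)
  rw [abs_mul] at h3
  have h4 : |(a : ℝ) - a'| * |x| ≤ (4 * C) * |x| := by nlinarith
  have h5 := le_of_mul_le_mul_right h4 hx0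
  have h6 : ((a - a' : ℤ) : ℝ) ≤ 4 * C := by
    push_cast; exact (le_abs_self _).trans h5
  rw [Int.natCast_floor_eq_floor (by positivity)]
  exact Int.le_floor.2 h6

set_option maxHeartbeats 2000000

/-- **Congruence counting in `SL₂(ℤ)`** (Lemma 6.1 of Bourgain–Kontorovich): for
`(qK)^{13/5} ≤ Y ≤ X` and primitive vectors `η, η' ∈ ℤ²` with `|η| ≍ X/Y` and `|η'| ≍ Y`,
`#{γ ∈ SL₂(ℤ) : ‖γ‖ ≍ Y, |γη − η'| < X/(YK), γη ≡ η' (mod q)} ≪ (Y/(qK))²`. -/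
theorem sl2_congruence_count (C₀ : ℝ) (hC₀ : 1 ≤ C₀) :
    ∃ C : ℝ, 0 < C ∧
      ∀ (X Y : ℝ) (q : ℕ) (K : ℝ) (η η' : Fin 2 → ℤ),
        1 ≤ Y → Y ≤ X → 1 ≤ q → 1 ≤ K →
        ((q : ℝ) * K) ^ ((13 : ℝ) / 5) ≤ Y →
        IsCoprime (η 0) (η 1) → IsCoprime (η' 0) (η' 1) →
        C₀⁻¹ * (X / Y) ≤ enormZ η → enormZ η ≤ C₀ * (X / Y) →
        C₀⁻¹ * Y ≤ enormZ η' → enormZ η' ≤ C₀ * Y →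
        (Set.ncard {γ : Matrix (Fin 2) (Fin 2) ℤ | γ.det = 1 ∧
              C₀⁻¹ * Y ≤ frob γ ∧ frob γ ≤ C₀ * Y ∧
              enormZ (γ.mulVec η - η') < X / (Y * K) ∧
              ∀ i : Fin 2, (q : ℤ) ∣ (γ.mulVec η i - η' i)} : ℝ)
          ≤ C * (Y / ((q : ℝ) * K)) ^ 2 := by
  refine ⟨60 * C₀ * (4 * C₀ + 1), by positivity, ?_⟩
  intro X Y q K η η' hY hXY hq hK hqK _ _ hη1 _ _ _
  set T := {γ : Matrix (Fin 2) (Fin 2) ℤ | γ.det = 1 ∧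
              C₀⁻¹ * Y ≤ frob γ ∧ frob γ ≤ C₀ * Y ∧
              enormZ (γ.mulVec η - η') < X / (Y * K) ∧
              ∀ i : Fin 2, (q : ℤ) ∣ (γ.mulVec η i - η' i)} with hT
  by_cases hfin : T.Finite
  swap
  · rw [Set.Infinite.ncard hfin]
    simp only [Nat.cast_zero]
    positivity
  have hC0 : 0 < C₀ := by linarith
  have hY0 : 0 < Y := by linarith
  have hX0 : 0 < X := by linarith
  have hq' : (1 : ℝ) ≤ q := by exact_mod_cast hq
  set n := enormZ η with hn
  have hn0 : 0 < n := lt_of_lt_of_le (by positivity) hη1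
  have hnsq : (η 0 : ℝ) ^ 2 + (η 1 : ℝ) ^ 2 = n ^ 2 := by
    rw [hn, enormZ, Real.sq_sqrt (by positivity)]
  have hXn : X / Y ≤ C₀ * n := by
    rw [inv_mul_le_iff₀ hC0] at hη1
    exact hη1
  have hXK : X / (Y * K) ≤ C₀ * n := by
    refine le_trans ?_ hXn
    apply div_le_div_of_nonneg_left hX0.le hY0
    nlinarith
  set S := hfin.toFinset with hS
  have hdet : ∀ γ ∈ S, γ 0 0 * γ 1 1 - γ 0 1 * γ 1 0 = 1 := by
    intro γ hγ
    have := ((Set.Finite.mem_toFinset hfin).1 hγ).1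
    rwa [Matrix.det_fin_two] at this
  have hent : ∀ γ ∈ S, ∀ i j, |γ i j| ≤ (⌊C₀ * Y⌋₊ : ℤ) := by
    intro γ hγ i j
    have h := ((Set.Finite.mem_toFinset hfin).1 hγ).2.2.1
    have h2 : |(γ i j : ℝ)| ≤ frob γ := by
      rw [frob]
      apply Real.abs_le_sqrt
      fin_cases i <;> fin_cases j <;> simp <;> nlinarith [sq_nonneg (γ 0 0 : ℝ),
        sq_nonneg (γ 0 1 : ℝ), sq_nonneg (γ 1 0 : ℝ), sq_nonneg (γ 1 1 : ℝ)]
    rw [Int.natCast_floor_eq_floor (by positivity)]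
    apply Int.le_floor.2
    push_cast
    linarith
  have hrow : ∀ γ ∈ S, ∀ i, |(γ i 0 : ℝ) * η 0 + γ i 1 * η 1 - η' i| ≤ C₀ * n := by
    intro γ hγ i
    have h := ((Set.Finite.mem_toFinset hfin).1 hγ).2.2.2.1
    refine le_trans ?_ (h.le.trans hXK)
    rw [enormZ]
    apply Real.abs_le_sqrt
    simp only [Matrix.mulVec, dotProduct, Fin.sum_univ_two, Pi.sub_apply]
    push_cast
    fin_cases i
    · exact le_add_of_nonneg_right (sq_nonneg _)
    · exact le_add_of_nonneg_left (sq_nonneg _)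
  have hext : ∀ γ δ : Matrix (Fin 2) (Fin 2) ℤ, γ 0 0 = δ 0 0 → γ 0 1 = δ 0 1 →
      γ 1 0 = δ 1 0 → γ 1 1 = δ 1 1 → γ = δ := by
    intro γ δ h1 h2 h3 h4
    ext i j
    fin_cases i <;> fin_cases j <;> assumption
  set N := 5 * (⌊4 * C₀⌋₊ + 1) * (2 * ⌊C₀ * Y⌋₊ + 1) with hN
  have hA : (S.filter (fun γ => γ 1 0 ^ 2 + γ 1 1 ^ 2 ≤ γ 0 0 ^ 2 + γ 0 1 ^ 2)).card ≤ N := by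
    rcases le_total ((η 1 : ℝ) ^ 2) ((η 0 : ℝ) ^ 2) with hc | hc
    · apply aux_core _ (fun γ => γ 0 0) (fun γ => γ 0 1) (fun γ => γ 1 0) (fun γ => γ 1 1)
      · intro p _ r _ h1 h2 h3 h4
        exact hext p r h1 h2 h3 h4
      · intro p hp
        exact hdet p (Finset.mem_filter.1 hp).1
      · intro p hp
        exact (Finset.mem_filter.1 hp).2
      · intro p hp
        exact hent p (Finset.mem_filter.1 hp).1 _ _
      · intro p hp r hr hb
        exact aux_strip C₀ (η 0) (η 1) n (η' 0) _ _ _ _ hn0 hC₀ hnsq hc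
          (hrow p (Finset.mem_filter.1 hp).1 0) (hrow r (Finset.mem_filter.1 hr).1 0) hb
    · apply aux_core _ (fun γ => γ 0 1) (fun γ => γ 0 0) (fun γ => -γ 1 1) (fun γ => -γ 1 0)
      · intro p _ r _ h1 h2 h3 h4
        exact hext p r h2 h1 (neg_injective h4) (neg_injective h3)
      · intro p hp
        linarith [hdet p (Finset.mem_filter.1 hp).1]
      · intro p hp
        linarith [(Finset.mem_filter.1 hp).2]
      · intro p hp
        exact hent p (Finset.mem_filter.1 hp).1 _ _
      · intro p hp r hr hb
        refine aux_strip C₀ (η 1) (η 0) n (η' 0) _ _ _ _ hn0 hC₀ (by linarith) hc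
          ?_ ?_ hb
        · rw [add_comm (_ * _)]; exact hrow p (Finset.mem_filter.1 hp).1 0
        · rw [add_comm (_ * _)]; exact hrow r (Finset.mem_filter.1 hr).1 0
  have hB : (S.filter (fun γ => ¬ (γ 1 0 ^ 2 + γ 1 1 ^ 2 ≤ γ 0 0 ^ 2 + γ 0 1 ^ 2))).card
      ≤ N := by
    rcases le_total ((η 1 : ℝ) ^ 2) ((η 0 : ℝ) ^ 2) with hc | hc
    · apply aux_core _ (fun γ => γ 1 0) (fun γ => γ 1 1) (fun γ => -γ 0 0) (fun γ => -γ 0 1)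
      · intro p _ r _ h1 h2 h3 h4
        exact hext p r (neg_injective h3) (neg_injective h4) h1 h2
      · intro p hp
        linarith [hdet p (Finset.mem_filter.1 hp).1]
      · intro p hp
        linarith [(Finset.mem_filter.1 hp).2]
      · intro p hp
        exact hent p (Finset.mem_filter.1 hp).1 _ _
      · intro p hp r hr hb
        exact aux_strip C₀ (η 0) (η 1) n (η' 1) _ _ _ _ hn0 hC₀ hnsq hc
          (hrow p (Finset.mem_filter.1 hp).1 1) (hrow r (Finset.mem_filter.1 hr).1 1) hb
    · apply aux_core _ (fun γ => γ 1 1) (fun γ => γ 1 0) (fun γ => γ 0 1) (fun γ => γ 0 0)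
      · intro p _ r _ h1 h2 h3 h4
        exact hext p r h4 h3 h2 h1
      · intro p hp
        linarith [hdet p (Finset.mem_filter.1 hp).1]
      · intro p hp
        linarith [(Finset.mem_filter.1 hp).2]
      · intro p hp
        exact hent p (Finset.mem_filter.1 hp).1 _ _
      · intro p hp r hr hb
        refine aux_strip C₀ (η 1) (η 0) n (η' 1) _ _ _ _ hn0 hC₀ (by linarith) hc
          ?_ ?_ hb
        · rw [add_comm (_ * _)]; exact hrow p (Finset.mem_filter.1 hp).1 1
        · rw [add_comm (_ * _)]; exact hrow r (Finset.mem_filter.1 hr).1 1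
  have hcard : S.card ≤ 2 * N := by
    rw [← Finset.card_filter_add_card_filter_not
      (fun γ => γ 1 0 ^ 2 + γ 1 1 ^ 2 ≤ γ 0 0 ^ 2 + γ 0 1 ^ 2)]
    omega
  rw [Set.ncard_eq_toFinset_card T hfin]
  have hcardR : (S.card : ℝ) ≤ 2 * N := by exact_mod_cast hcard
  have f1 : (⌊4 * C₀⌋₊ : ℝ) ≤ 4 * C₀ := Nat.floor_le (by positivity)
  have f2 : (⌊C₀ * Y⌋₊ : ℝ) ≤ C₀ * Y := Nat.floor_le (by positivity)
  have hNR : (N : ℝ) ≤ 5 * (4 * C₀ + 1) * (2 * (C₀ * Y) + 1) := by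
    rw [hN]; push_cast; gcongr
  have hCY : 1 ≤ C₀ * Y := by nlinarith
  have hN2 : (N : ℝ) ≤ 5 * (4 * C₀ + 1) * (3 * (C₀ * Y)) := by
    refine hNR.trans ?_
    gcongr
    linarith
  have hQ : 1 ≤ (q : ℝ) * K := by nlinarith
  have hQ2 : ((q : ℝ) * K) ^ 2 ≤ Y := by
    refine le_trans ?_ hqK
    rw [← Real.rpow_natCast]
    apply Real.rpow_le_rpow_of_exponent_le hQ
    norm_num
  have hfinal : Y ≤ (Y / ((q : ℝ) * K)) ^ 2 := by
    rw [div_pow, le_div_iff₀ (by positivity)]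
    nlinarith
  calc (S.card : ℝ) ≤ 2 * N := hcardR
    _ ≤ 60 * C₀ * (4 * C₀ + 1) * Y := by nlinarith [mul_pos hC0 hY0]
    _ ≤ _ := by gcongr
end
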